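/- Let s ≥ 3 and r ≥ 2 be integers and let (𝓗_n) be a non-clustered sequence of nonempty s-uniform hypergraphs that has the rainbow star-constellation property for r colours. For all β_s > 0 and c > 0 there exists β_c > 0 such that the following holds: for every sequence p_n ∈ [0,1] with p_n ≥ c·p_{𝓗_n} for all n, the probability that the random set Z = V(𝓗_n)_{p_n} has the following property tends to 1 as n → ∞: every partial colouring ψ of V(𝓗_n) with colours {1,…,r} whose domain is contained in Z under which the number of pairs (i, S), with i ∈ {1,…,r} and S an i-rainbow (r−1)-star, is at least β_s·(p_n/p_{𝓗_n})^{(r−1)(s−1)}·v(𝓗_n), also has at least β_c·(p_n/p_{𝓗_n})^{(r−1)(s−1)s}·e(𝓗_n) pairs (i, C) with i ∈ {1,…,r} and C an i-rainbow constellation. -/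

import Mathlib

open Filter
open scoped Classical

open Classical in
/-- The probability that the binomial random subset of the finite set `X`,
in which each element is retained independently with probability `p`,
satisfies the predicate `P`. -/
noncomputable def probSub {α : Type*} (X : Finset α) (p : ℝ) (P : Finset α → Prop) : ℝ :=
  ∑ S ∈ X.powerset, if P S then p ^ S.card * (1 - p) ^ (X.card - S.card) else 0

/-- The degree of the vertex set `T` in the hypergraph `H`: the number of edges
of `H` containing `T`. -/
noncomputable def degH {V : Type*} (H : Finset (Finset V)) (T : Finset V) : ℕ :=
  (H.filter fun e => T ⊆ e).card

/-- `Δ_t(H)`: the maximum degree of a `t`-element vertex set in `H`. -/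
noncomputable def maxDeg {V : Type*} [Fintype V] (H : Finset (Finset V)) (t : ℕ) : ℕ :=
  (Finset.univ.filter fun T : Finset V => T.card = t).sup (degH H)

/-- `p_𝓗 := (v(𝓗)/e(𝓗))^{1/(s−1)}`. -/
noncomputable def pH {V : Type*} [Fintype V] (s : ℕ) (H : Finset (Finset V)) : ℝ :=
  ((Fintype.card V : ℝ) / (H.card : ℝ)) ^ (1 / ((s : ℝ) - 1))

/-- A sequence of `s`-uniform hypergraphs is non-clustered:
`Δ₁(𝓗_n) = O(e(𝓗_n)/v(𝓗_n))` and, for each `t ∈ {2,…,s−1}`,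
`Δ_t(𝓗_n) = o(p_{𝓗_n}^{t−1}·e(𝓗_n)/v(𝓗_n))`. -/
def NonClustered (s : ℕ) (V : ℕ → Type) [∀ n, Fintype (V n)]
    (H : ∀ n, Finset (Finset (V n))) : Prop :=
  (∃ C : ℝ, ∀ n, (maxDeg (H n) 1 : ℝ) ≤ C * ((H n).card : ℝ) / (Fintype.card (V n) : ℝ)) ∧
  ∀ t : ℕ, 2 ≤ t → t ≤ s - 1 → ∀ ε : ℝ, 0 < ε →
    ∀ᶠ n in atTop, (maxDeg (H n) t : ℝ) ≤
      ε * pH s (H n) ^ (t - 1) * ((H n).card : ℝ) / (Fintype.card (V n) : ℝ)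


open Classical in
/-- A `k`-star in `H` with centre `v`: a set `S` of `k` edges of `H` that
pairwise intersect exactly in `{v}` (and all contain `v`). -/
noncomputable def IsStar {V : Type*} (H : Finset (Finset V)) (k : ℕ)
    (S : Finset (Finset V)) (v : V) : Prop :=
  S.card = k ∧ S ⊆ H ∧ (∀ e ∈ S, v ∈ e) ∧
    ∀ e ∈ S, ∀ f ∈ S, e ≠ f → e ∩ f = {v}

open Classical in
/-- A constellation with base `A` in `H`: `A` is an edge of `H` and `F` assigns
to each vertex `v` of `A` a `k`-star of `H` centred at `v` (and `∅` to all
other vertices), the supports of these stars being pairwise disjoint. -/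
noncomputable def IsConstellation {V : Type*} (H : Finset (Finset V)) (k : ℕ)
    (A : Finset V) (F : V → Finset (Finset V)) : Prop :=
  A ∈ H ∧ (∀ v ∈ A, IsStar H k (F v) v) ∧ (∀ v, v ∉ A → F v = ∅) ∧
    ∀ v ∈ A, ∀ w ∈ A, v ≠ w → Disjoint ((F v).sup id) ((F w).sup id)

/-- With respect to the partial colouring `ψ`, the `(r−1)`-star `S` with centre
`v` is `i`-rainbow: its edges can be labelled injectively with colours `≠ i` so
that all vertices of an edge other than the centre get the colour of its label. -/
def IsRainbowStar {V : Type*} (r : ℕ) (ψ : V → Option (Fin r))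
    (S : Finset (Finset V)) (v : V) (i : Fin r) : Prop :=
  ∃ g : Finset V → Fin r, Set.InjOn g ↑S ∧ (∀ e ∈ S, g e ≠ i) ∧
    ∀ e ∈ S, ∀ u ∈ e, u ≠ v → ψ u = some (g e)

/-- The number of rainbow `(r−1)`-stars of `H` under the partial colouring `ψ`
(counted as pairs of a star and its centre). -/
noncomputable def numRainbowStars {V : Type*} (r : ℕ) (H : Finset (Finset V))
    (ψ : V → Option (Fin r)) : ℕ :=
  Nat.card {P : Finset (Finset V) × V //
    IsStar H (r - 1) P.1 P.2 ∧ ∃ i, IsRainbowStar r ψ P.1 P.2 i}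

/-- The number of rainbow constellations of `H` under the partial colouring `ψ`
(counted as pairs of a base edge and an assignment of stars to its vertices). -/
noncomputable def numRainbowConstellations {V : Type*} (r : ℕ) (H : Finset (Finset V))
    (ψ : V → Option (Fin r)) : ℕ :=
  Nat.card {P : Finset V × (V → Finset (Finset V)) //
    IsConstellation H (r - 1) P.1 P.2 ∧ ∃ i, ∀ v ∈ P.1, IsRainbowStar r ψ (P.2 v) v i}

/-- The sequence `(𝓗_n)` has the rainbow star-constellation property for `r`
colours: every partial colouring making at least `β·e^{r−1}/v^{r−2}` stars
rainbow makes at least `γ·e^{s(r−1)+1}/v^{s(r−1)}` constellations rainbow. -/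
def RainbowSC (s r : ℕ) (V : ℕ → Type) [∀ n, Fintype (V n)]
    (H : ∀ n, Finset (Finset (V n))) : Prop :=
  ∀ β : ℝ, 0 < β → ∃ γ : ℝ, 0 < γ ∧ ∀ᶠ n in atTop,
    ∀ ψ : V n → Option (Fin r),
      β * ((H n).card : ℝ) ^ (r - 1) / (Fintype.card (V n) : ℝ) ^ (r - 2) ≤
        (numRainbowStars r (H n) ψ : ℝ) →
      γ * ((H n).card : ℝ) ^ (s * (r - 1) + 1) / (Fintype.card (V n) : ℝ) ^ (s * (r - 1)) ≤
        (numRainbowConstellations r (H n) ψ : ℝ)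


/-- The number of pairs `(i, S)` where `S` is an `i`-rainbow `(r−1)`-star of
`H` under the partial colouring `ψ` (stars counted with their centres). -/
noncomputable def numRainbowStarPairs {V : Type*} (r : ℕ) (H : Finset (Finset V))
    (ψ : V → Option (Fin r)) : ℕ :=
  Nat.card {P : Fin r × (Finset (Finset V) × V) //
    IsStar H (r - 1) P.2.1 P.2.2 ∧ IsRainbowStar r ψ P.2.1 P.2.2 P.1}

/-- The number of pairs `(i, C)` where `C` is an `i`-rainbow constellation of
`H` under the partial colouring `ψ`. -/
noncomputable def numRainbowConstPairs {V : Type*} (r : ℕ) (H : Finset (Finset V))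
    (ψ : V → Option (Fin r)) : ℕ :=
  Nat.card {P : Fin r × (Finset V × (V → Finset (Finset V))) //
    IsConstellation H (r - 1) P.2.1 P.2.2 ∧
      ∀ v ∈ P.2.1, IsRainbowStar r ψ (P.2.2 v) v P.1}

section BinomialExpectation

variable {V : Type*} [Fintype V]

/-- The expectation of `f` over the binomial random subset of `V` with density `p`. -/
noncomputable def binomExp (p : ℝ) (f : Finset V → ℝ) : ℝ :=
  ∑ Z : Finset V, p ^ Z.card * (1 - p) ^ (Fintype.card V - Z.card) * f Z

lemma binomExp_mono {p : ℝ} (h0 : 0 ≤ p) (h1 : p ≤ 1) {f g : Finset V → ℝ}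
    (h : ∀ Z, f Z ≤ g Z) : binomExp p f ≤ binomExp p g :=
  Finset.sum_le_sum fun Z _ => mul_le_mul_of_nonneg_left (h Z)
    (mul_nonneg (pow_nonneg h0 _) (pow_nonneg (sub_nonneg.2 h1) _))

lemma binomExp_add (p : ℝ) (f g : Finset V → ℝ) :
    binomExp p (fun Z => f Z + g Z) = binomExp p f + binomExp p g := by
  simp only [binomExp, mul_add, Finset.sum_add_distrib]

lemma binomExp_const_mul (p a : ℝ) (f : Finset V → ℝ) :
    binomExp p (fun Z => a * f Z) = a * binomExp p f := by
  simp only [binomExp, Finset.mul_sum]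
  exact Finset.sum_congr rfl fun _ _ => by ring

lemma binomExp_sum {ι : Type*} (p : ℝ) (s : Finset ι) (f : ι → Finset V → ℝ) :
    binomExp p (fun Z => ∑ i ∈ s, f i Z) = ∑ i ∈ s, binomExp p (f i) := by
  simp only [binomExp, Finset.mul_sum]
  exact Finset.sum_comm

lemma binomExp_const (p a : ℝ) : binomExp (V := V) p (fun _ => a) = a := by
  have h := Finset.sum_pow_mul_eq_add_pow p (1 - p) (Finset.univ : Finset V)
  simp only [Finset.powerset_univ, Finset.card_univ, add_sub_cancel, one_pow] at h
  simp only [binomExp, ← Finset.sum_mul, h, one_mul]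

lemma binomExp_subset (p : ℝ) (S : Finset V) :
    binomExp p (fun Z => if S ⊆ Z then 1 else 0) = p ^ S.card := by
  have h := Finset.sum_pow_mul_eq_add_pow p (1 - p) Sᶜ
  simp only [add_sub_cancel, one_pow] at h
  simp only [binomExp, mul_ite, mul_one, mul_zero]
  have h' : p ^ S.card = ∑ T ∈ Sᶜ.powerset,
      p ^ S.card * (p ^ T.card * (1 - p) ^ (Sᶜ.card - T.card)) := by
    rw [← Finset.mul_sum, h, mul_one]
  rw [← Finset.sum_filter, h']
  refine Finset.sum_bij' (fun Z _ => Z \ S) (fun T _ => S ∪ T) ?_ ?_ ?_ ?_ ?_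
  · intro Z _
    simp only [Finset.mem_powerset]
    intro x hx
    simpa using (Finset.mem_sdiff.1 hx).2
  · intro T _
    simp
  · intro Z hZ
    exact Finset.union_sdiff_of_subset (Finset.mem_filter.1 hZ).2
  · intro T hT
    have : Disjoint S T := by
      rw [Finset.mem_powerset, Finset.subset_compl_iff_disjoint_right] at hT
      exact hT.symm
    exact Finset.union_sdiff_cancel_left this
  · intro Z hZ
    have hS := (Finset.mem_filter.1 hZ).2
    have h1 : Z.card = S.card + (Z \ S).card := by
      rw [Finset.card_sdiff_of_subset hS]
      have := Finset.card_le_card hS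
      omega
    have h2 : Fintype.card V - Z.card = Sᶜ.card - (Z \ S).card := by
      rw [Finset.card_compl]; omega
    rw [h2, h1, pow_add]; ring

lemma probSub_eq_binomExp (p : ℝ) (P : Finset V → Prop) :
    probSub Finset.univ p P = binomExp p (fun Z => if P Z then 1 else 0) := by
  simp only [probSub, binomExp, Finset.powerset_univ, mul_ite, mul_one, mul_zero,
    Finset.card_univ]

/-- If some set has expectation at most `a` it has a value at most `a`. -/
lemma exists_le_of_binomExp_le {p a : ℝ} (h0 : 0 ≤ p) (h1 : p ≤ 1) {f : Finset V → ℝ}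
    (h : binomExp p f < a) : ∃ Z, f Z ≤ a := by
  by_contra! hcon
  have := binomExp_mono h0 h1 (f := fun _ => a) (g := f) fun Z => (hcon Z).le
  rw [binomExp_const] at this
  linarith

lemma binomExp_markov {p a : ℝ} (h0 : 0 ≤ p) (h1 : p ≤ 1) {f : Finset V → ℝ}
    (hf : ∀ Z, 0 ≤ f Z) (ha : 0 < a) {P : Finset V → Prop} (hP : ∀ Z, P Z → a ≤ f Z) :
    binomExp p (fun Z => if P Z then 1 else 0) ≤ binomExp p f / a := by
  rw [div_eq_inv_mul, ← binomExp_const_mul]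
  refine binomExp_mono h0 h1 fun Z => ?_
  split_ifs with h
  · rw [← div_eq_inv_mul, le_div_iff₀ ha, one_mul]; exact hP Z h
  · exact mul_nonneg (inv_nonneg.2 ha.le) (hf Z)

/-- Union bound in complementary form. -/
lemma one_sub_le_probSub {ι : Type*} {p : ℝ} (h0 : 0 ≤ p) (h1 : p ≤ 1) (s : Finset ι)
    {P : Finset V → Prop} {Q : ι → Finset V → Prop}
    (h : ∀ Z, (∀ i ∈ s, ¬ Q i Z) → P Z) :
    1 - ∑ i ∈ s, binomExp p (fun Z => if Q i Z then 1 else 0) ≤ probSub Finset.univ p P := by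
  rw [probSub_eq_binomExp, sub_le_iff_le_add, ← binomExp_sum, ← binomExp_add]
  refine (binomExp_const (V := V) p 1).symm.le.trans (binomExp_mono h0 h1 fun Z => ?_)
  have hnn : ∀ i ∈ s, (0 : ℝ) ≤ if Q i Z then 1 else 0 := fun i _ => by split_ifs <;> norm_num
  by_cases hZ : ∀ i ∈ s, ¬ Q i Z
  · rw [if_pos (h Z hZ)]
    linarith [Finset.sum_nonneg hnn]
  · push Not at hZ
    obtain ⟨i, hi, hQ⟩ := hZ
    have h2 := Finset.single_le_sum hnn hi
    rw [if_pos hQ] at h2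
    split_ifs <;> linarith

lemma probSub_le_one {p : ℝ} (h0 : 0 ≤ p) (h1 : p ≤ 1) (P : Finset V → Prop) :
    probSub Finset.univ p P ≤ 1 := by
  rw [probSub_eq_binomExp]
  exact (binomExp_mono h0 h1 (g := fun _ => 1) fun Z => by split_ifs <;> norm_num).trans
    (binomExp_const p 1).le

/-- Chebyshev's inequality for the number of members of a family of sets contained in a
binomial random set. -/
lemma binomExp_chebyshev {B : Type*} [Fintype B] (S : B → Finset V) {p μ ρ : ℝ}
    (h0 : 0 ≤ p) (h1 : p ≤ 1) (hμ : 0 < μ)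
    (hρ : 0 ≤ ρ) (hmean : ∑ b, p ^ (S b).card ≤ μ)
    (hoverlap : ∀ b, ∑ b' with ¬ Disjoint (S b) (S b'), p ^ (S b' \ S b).card ≤ ρ) :
    binomExp p (fun Z => if 2 * μ < ((Finset.univ.filter fun b => S b ⊆ Z).card : ℝ) then 1 else 0)
      ≤ ρ / μ := by
  set X : Finset V → ℝ := fun Z => ∑ b, if S b ⊆ Z then 1 else 0 with hX
  set m : ℝ := ∑ b, p ^ (S b).card with hm
  have hEX : binomExp p X = m := by
    rw [hX, binomExp_sum]; simp only [binomExp_subset, hm]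
  have hm0 : 0 ≤ m := Finset.sum_nonneg fun b _ => pow_nonneg h0 _
  have hEX2 : binomExp p (fun Z => X Z ^ 2) ≤ m ^ 2 + m * ρ := by
    have h2 : ∀ Z, X Z ^ 2 = ∑ b, ∑ b', if S b ∪ S b' ⊆ Z then (1 : ℝ) else 0 := by
      intro Z
      rw [sq, hX, Finset.sum_mul_sum]
      refine Finset.sum_congr rfl fun b _ => Finset.sum_congr rfl fun b' _ => ?_
      simp only [Finset.union_subset_iff]
      by_cases hb : S b ⊆ Z <;> by_cases hb' : S b' ⊆ Z <;> simp [hb, hb']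
    simp only [h2, binomExp_sum, binomExp_subset]
    rw [sq, hm, Finset.sum_mul, Finset.sum_mul, ← Finset.sum_add_distrib]
    refine Finset.sum_le_sum fun b _ => ?_
    have h3 : ∀ b', p ^ (S b ∪ S b').card ≤ p ^ (S b).card * p ^ (S b').card +
        if ¬ Disjoint (S b) (S b') then p ^ (S b).card * p ^ (S b' \ S b).card else 0 := by
      intro b'
      by_cases hd : Disjoint (S b) (S b')
      · rw [Finset.card_union_of_disjoint hd, pow_add]; simp [hd]
      · rw [if_pos hd, ← pow_add, ← pow_add, ← Finset.card_union_of_disjoint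
          (Finset.disjoint_sdiff), Finset.union_sdiff_self_eq_union]
        linarith [pow_nonneg h0 ((S b).card + (S b').card)]
    calc ∑ b', p ^ (S b ∪ S b').card
        ≤ ∑ b', (p ^ (S b).card * p ^ (S b').card +
          if ¬ Disjoint (S b) (S b') then p ^ (S b).card * p ^ (S b' \ S b).card else 0) :=
          Finset.sum_le_sum fun b' _ => h3 b'
      _ = p ^ (S b).card * m + p ^ (S b).card *
          ∑ b' with ¬ Disjoint (S b) (S b'), p ^ (S b' \ S b).card := by
          rw [Finset.sum_add_distrib, ← Finset.mul_sum, ← Finset.sum_filter, ← Finset.mul_sum]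
      _ ≤ _ := by
          have := mul_le_mul_of_nonneg_left (hoverlap b) (pow_nonneg h0 (S b).card)
          linarith
  have hvar : binomExp p (fun Z => (X Z - m) ^ 2) ≤ m * ρ := by
    have : (fun Z => (X Z - m) ^ 2) = fun Z => X Z ^ 2 + ((-2 * m) * X Z + m ^ 2) := by
      funext Z; ring
    rw [this, binomExp_add, binomExp_add, binomExp_const_mul, binomExp_const, hEX]
    linarith
  calc _ ≤ binomExp p (fun Z => (X Z - m) ^ 2) / μ ^ 2 := by
        refine binomExp_markov h0 h1 (fun Z => sq_nonneg _) (by positivity) fun Z hZ => ?_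
        have : X Z = ((Finset.univ.filter fun b => S b ⊆ Z).card : ℝ) := by
          simp [hX, Finset.sum_boole]
        rw [← this] at hZ
        exact pow_le_pow_left₀ hμ.le (by linarith) 2
    _ ≤ μ * ρ / μ ^ 2 := by gcongr; exact hvar.trans (mul_le_mul_of_nonneg_right hmean hρ)
    _ = ρ / μ := by field_simp

end BinomialExpectation

section TupleFamilies

variable {V Γ : Type*} [Fintype V] [Fintype Γ] {k : ℕ}

/-- Prescribing the values of a family of `k`-tuples on a nonempty set of at least `a`
positions leaves at most `K * p ^ (|S| - 1) * M` tuples. -/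
def PinBound (pt : Γ → Fin k → V) (p M K : ℝ) (a : ℕ) : Prop :=
  ∀ S : Finset (Fin k), S.Nonempty → a ≤ S.card → ∀ σ : Fin k → V,
    ((Finset.univ.filter fun γ => ∀ q ∈ S, pt γ q = σ q).card : ℝ) ≤ K * p ^ (S.card - 1) * M

variable {pt : Γ → Fin k → V} {p M K : ℝ}

lemma PinBound.card_le (h : PinBound pt p M K 1) (q : Fin k) :
    (Fintype.card Γ : ℝ) ≤ K * Fintype.card V * M := by
  have h1 : (Fintype.card Γ : ℝ) =
      ∑ v : V, ((Finset.univ.filter fun γ => pt γ q = v).card : ℝ) := by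
    rw [← Finset.card_univ, Finset.card_eq_sum_card_fiberwise (f := fun γ => pt γ q)
      (t := Finset.univ) (by simp)]
    push_cast
    rfl
  rw [h1]
  have h2 : ∀ v ∈ (Finset.univ : Finset V),
      ((Finset.univ.filter fun γ => pt γ q = v).card : ℝ) ≤ K * M := by
    intro v _
    simpa using h {q} (by simp) (by simp) (fun _ => v)
  refine (Finset.sum_le_sum h2).trans ?_
  simp only [Finset.sum_const, Finset.card_univ, nsmul_eq_mul]
  exact le_of_eq (by ring)

/-- Weighted count of the extensions of a partial tuple, each extension being weighted by the
probability that its positions in `Q` are covered, given that `U` is. -/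
lemma PinBound.extension_sum_le (hinj : ∀ γ, Function.Injective (pt γ)) (hp : 0 ≤ p)
    {a : ℕ} (h : PinBound pt p M K a) (U : Finset V) (Q R₀ : Finset (Fin k))
    (hR : R₀.Nonempty) (ha : a ≤ R₀.card) (σ : Fin k → V) (hσ : ∀ q ∈ R₀, q ∈ Q → σ q ∈ U) :
    ∑ γ with ∀ q ∈ R₀, pt γ q = σ q, p ^ (Q.image (pt γ) \ U).card
      ≤ ((U.card : ℝ) + 1) ^ k * (K * p ^ ((R₀ ∪ Q).card - 1) * M) := by
  set τ : Γ → Fin k → Option U := fun γ q =>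
    if hq : q ∈ Q ∧ pt γ q ∈ U then some ⟨pt γ q, hq.2⟩ else none with hτ
  have hfib : ∀ t ∈ (Finset.univ : Finset (Fin k → Option U)),
      ∑ γ ∈ (Finset.univ.filter fun γ => ∀ q ∈ R₀, pt γ q = σ q).filter (fun γ => τ γ = t),
        p ^ (Q.image (pt γ) \ U).card ≤ K * p ^ ((R₀ ∪ Q).card - 1) * M := by
    intro t _
    set S : Finset (Fin k) := R₀ ∪ Q.filter fun q => t q ≠ none with hS
    have hSne : S.Nonempty := hR.mono Finset.subset_union_left
    have hSa : a ≤ S.card := ha.trans (Finset.card_le_card Finset.subset_union_left)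
    set W := (Finset.univ.filter fun γ => ∀ q ∈ R₀, pt γ q = σ q).filter (fun γ => τ γ = t)
      with hW
    set σ' : Fin k → V := fun q => if q ∈ R₀ then σ q else (t q).elim (σ q) (fun u => u.1)
      with hσ'
    have hWS : W ⊆ Finset.univ.filter fun γ => ∀ q ∈ S, pt γ q = σ' q := by
      intro γ hγ
      simp only [hW, Finset.mem_filter, Finset.mem_univ, true_and] at hγ ⊢
      intro q hq
      by_cases hq0 : q ∈ R₀
      · simp only [hσ', if_pos hq0]; exact hγ.1 q hq0
      · simp only [hS, Finset.mem_union, hq0, false_or, Finset.mem_filter] at hq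
        simp only [hσ', if_neg hq0]
        have hq2 := hq.2
        rw [← hγ.2] at hq2 ⊢
        by_cases hc : q ∈ Q ∧ pt γ q ∈ U
        · simp only [hτ, dif_pos hc, Option.elim]
        · simp only [hτ, dif_neg hc, ne_eq, not_true_eq_false] at hq2
    have hwt : ∀ γ ∈ W, (Q.image (pt γ) \ U).card = (Q \ S).card := by
      intro γ hγ
      simp only [hW, Finset.mem_filter, Finset.mem_univ, true_and] at hγ
      have : Q.image (pt γ) \ U = (Q \ S).image (pt γ) := by
        ext v
        simp only [Finset.mem_sdiff, Finset.mem_image]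
        constructor
        · rintro ⟨⟨q, hq, rfl⟩, hv⟩
          refine ⟨q, ⟨hq, ?_⟩, rfl⟩
          simp only [hS, Finset.mem_union, Finset.mem_filter, not_or, not_and, not_not]
          refine ⟨fun hq0 => hv ?_, fun _ => ?_⟩
          · rw [hγ.1 q hq0]; exact hσ q hq0 hq
          · rw [← hγ.2]
            simp only [hτ]
            rw [dif_neg (fun hc => hv hc.2)]
        · rintro ⟨q, ⟨hq, hqS⟩, rfl⟩
          refine ⟨⟨q, hq, rfl⟩, fun hv => hqS ?_⟩
          simp only [hS, Finset.mem_union, Finset.mem_filter]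
          right
          refine ⟨hq, ?_⟩
          rw [← hγ.2]
          simp only [hτ]
          rw [dif_pos ⟨hq, hv⟩]
          simp
      rw [this, Finset.card_image_of_injective _ (hinj γ)]
    have hcard : (R₀ ∪ Q).card = S.card + (Q \ S).card := by
      rw [← Finset.card_union_of_disjoint Finset.disjoint_sdiff]
      congr 1
      ext q
      simp only [hS, Finset.mem_union, Finset.mem_sdiff, Finset.mem_filter]
      tauto
    have hSpos := hSne.card_pos
    have hexp : (R₀ ∪ Q).card - 1 = (S.card - 1) + (Q \ S).card := by omega
    rw [Finset.sum_congr rfl (fun γ hγ => by rw [hwt γ hγ]), Finset.sum_const, nsmul_eq_mul, hexp,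
      pow_add]
    have hc : (W.card : ℝ) ≤ K * p ^ (S.card - 1) * M :=
      (Nat.cast_le.2 (Finset.card_le_card hWS)).trans (h S hSne hSa σ')
    calc (W.card : ℝ) * p ^ (Q \ S).card ≤ K * p ^ (S.card - 1) * M * p ^ (Q \ S).card :=
          mul_le_mul_of_nonneg_right hc (pow_nonneg hp _)
      _ = _ := by ring
  rw [← Finset.sum_fiberwise_of_maps_to (g := τ) (t := Finset.univ) (by simp)]
  refine (Finset.sum_le_sum hfib).trans (le_of_eq ?_)
  rw [Finset.sum_const, nsmul_eq_mul, Finset.card_univ]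
  simp [Fintype.card_option, Fintype.card_coe]

end TupleFamilies

section PairMoments

variable {V Γ : Type*} [Fintype V] [Fintype Γ] {k : ℕ}
variable {pt : Γ → Fin k → V} {p M K : ℝ}

/-- The vertices that a pair of tuples occupies at the positions in `Q`. -/
noncomputable def pairCover (pt : Γ → Fin k → V) (Q : Finset (Fin k)) (x : Γ × Γ) : Finset V :=
  Q.image (pt x.1) ∪ Q.image (pt x.2)

lemma card_pairCover_le (Q : Finset (Fin k)) (x : Γ × Γ) : (pairCover pt Q x).card ≤ 2 * k := by
  have h : ∀ γ, (Q.image (pt γ)).card ≤ k := fun γ =>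
    Finset.card_image_le.trans (by simpa using Finset.card_le_univ Q)
  have := Finset.card_union_le (Q.image (pt x.1)) (Q.image (pt x.2))
  have h1 := h x.1
  have h2 := h x.2
  unfold pairCover
  omega

lemma PinBound.extension_sum_single_le (hinj : ∀ γ, Function.Injective (pt γ)) (hp : 0 ≤ p)
    (h : PinBound pt p M K 1) (U : Finset V) (Q : Finset (Fin k)) (b : Fin k) (v : V)
    (hv : b ∈ Q → v ∈ U) :
    ∑ γ with pt γ b = v, p ^ (Q.image (pt γ) \ U).card
      ≤ ((U.card : ℝ) + 1) ^ k * (K * p ^ ((insert b Q).card - 1) * M) := by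
  have := h.extension_sum_le hinj hp U Q {b} (by simp) (by simp) (fun _ => v)
    (by simpa using hv)
  simpa only [Finset.mem_singleton, forall_eq, Finset.singleton_union] using this

/-- A sum over glued pairs, in which the first tuple satisfies `P`, is controlled by the sum over
the first tuple. -/
lemma PinBound.pair_sum_le (hinj : ∀ γ, Function.Injective (pt γ)) (hp : 0 ≤ p)
    (hM : 0 ≤ M) (hK : 0 ≤ K)
    (h : PinBound pt p M K 1) (U : Finset V) (hU : U.card ≤ 2 * k) (Q : Finset (Fin k))
    (a b : Fin k) (hab : b ∈ Q → a ∈ Q) (P : Γ → Prop) :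
    ∑ x : Γ × Γ with pt x.1 a = pt x.2 b ∧ P x.1, p ^ (pairCover pt Q x \ U).card
      ≤ (∑ γ with P γ, p ^ (Q.image (pt γ) \ U).card) *
        ((3 * k + 1 : ℝ) ^ k * (K * p ^ ((insert b Q).card - 1) * M)) := by
  have h1 : ∀ γ γ', p ^ (pairCover pt Q (γ, γ') \ U).card =
      p ^ (Q.image (pt γ) \ U).card * p ^ (Q.image (pt γ') \ (U ∪ Q.image (pt γ))).card := by
    intro γ γ'
    rw [← pow_add, ← Finset.card_union_of_disjoint]
    · congr 2
      ext v
      simp only [pairCover, Finset.mem_sdiff, Finset.mem_union]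
      tauto
    · rw [Finset.disjoint_left]
      intro v hv hv'
      simp only [Finset.mem_sdiff, Finset.mem_union] at hv hv'
      tauto
  rw [Finset.sum_filter, Fintype.sum_prod_type, Finset.sum_filter, Finset.sum_mul]
  refine Finset.sum_le_sum fun γ _ => ?_
  by_cases hPγ : P γ
  · simp only [hPγ, and_true, if_true]
    simp only [h1]
    rw [← Finset.sum_filter, ← Finset.mul_sum]
    refine mul_le_mul_of_nonneg_left ?_ (pow_nonneg hp _)
    have h2 := h.extension_sum_single_le hinj hp (U ∪ Q.image (pt γ)) Q b (pt γ a)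
      (fun hb => Finset.mem_union_right _ (Finset.mem_image_of_mem _ (hab hb)))
    have h3 : (U ∪ Q.image (pt γ)).card ≤ 3 * k := by
      have h4 : (Q.image (pt γ)).card ≤ k :=
        Finset.card_image_le.trans (by simpa using Finset.card_le_univ Q)
      have := Finset.card_union_le U (Q.image (pt γ))
      omega
    have h3' : ((U ∪ Q.image (pt γ)).card : ℝ) ≤ 3 * k := by exact_mod_cast h3
    calc _ = ∑ γ' with pt γ' b = pt γ a, p ^ (Q.image (pt γ') \ (U ∪ Q.image (pt γ))).card := by
          simp only [eq_comm]
      _ ≤ _ := h2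
      _ ≤ _ := by gcongr
  · simp [hPγ]

lemma PinBound.pair_mean_le (hinj : ∀ γ, Function.Injective (pt γ)) (hp : 0 ≤ p)
    (hM : 0 ≤ M) (hK : 0 ≤ K)
    (h : PinBound pt p M K 1) (Q : Finset (Fin k)) (a b : Fin k) (hab : b ∈ Q → a ∈ Q) :
    ∑ x : Γ × Γ with pt x.1 a = pt x.2 b, p ^ (pairCover pt Q x).card
      ≤ (3 * k + 1 : ℝ) ^ k * K ^ 2 * Fintype.card V * M ^ 2 *
        p ^ (Q.card + ((insert b Q).card - 1)) := by
  have h1 := h.pair_sum_le hinj hp hM hK ∅ (by simp) Q a b hab (fun _ => True)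
  simp only [and_true, Finset.sdiff_empty, Finset.filter_true] at h1
  refine h1.trans ?_
  have h2 : ∑ γ, p ^ (Q.image (pt γ)).card ≤ (K * Fintype.card V * M) * p ^ Q.card := by
    simp only [Finset.card_image_of_injective _ (hinj _), Finset.sum_const, nsmul_eq_mul,
      Finset.card_univ]
    exact mul_le_mul_of_nonneg_right (h.card_le b) (pow_nonneg hp _)
  calc _ ≤ (K * Fintype.card V * M) * p ^ Q.card *
        ((3 * k + 1 : ℝ) ^ k * (K * p ^ ((insert b Q).card - 1) * M)) := by gcongr
    _ = _ := by rw [pow_add]; ring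

lemma PinBound.pair_anchored_le (hinj : ∀ γ, Function.Injective (pt γ)) (hp : 0 ≤ p)
    (hM : 0 ≤ M) (hK : 0 ≤ K)
    (h : PinBound pt p M K 1) (U : Finset V) (hU : U.card ≤ 2 * k) (Q : Finset (Fin k))
    (a b : Fin k) (hab : b ∈ Q → a ∈ Q) (q : Fin k) (hq : q ∈ Q) (u : V) (hu : u ∈ U) :
    p * ∑ x : Γ × Γ with pt x.1 a = pt x.2 b ∧ pt x.1 q = u, p ^ (pairCover pt Q x \ U).card
      ≤ (3 * k + 1 : ℝ) ^ (2 * k) * K ^ 2 * M ^ 2 * p ^ (Q.card + ((insert b Q).card - 1)) := by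
  have h1 := h.pair_sum_le hinj hp hM hK U hU Q a b hab (fun γ => pt γ q = u)
  have h2 := h.extension_sum_single_le hinj hp U Q q u (fun _ => hu)
  rw [Finset.insert_eq_of_mem hq] at h2
  have hU' : (U.card : ℝ) ≤ 3 * k := by
    have : U.card ≤ 3 * k := by omega
    exact_mod_cast this
  have h3 : ((U.card : ℝ) + 1) ^ k * (K * p ^ (Q.card - 1) * M) ≤
      (3 * k + 1 : ℝ) ^ k * (K * p ^ (Q.card - 1) * M) := by gcongr
  have hQ : p ^ Q.card = p * p ^ (Q.card - 1) := by
    rw [← pow_succ', Nat.sub_add_cancel (Finset.card_pos.2 ⟨q, hq⟩)]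
  calc _ ≤ p * ((3 * k + 1 : ℝ) ^ k * (K * p ^ (Q.card - 1) * M) *
        ((3 * k + 1 : ℝ) ^ k * (K * p ^ ((insert b Q).card - 1) * M))) := by
        refine mul_le_mul_of_nonneg_left (h1.trans ?_) hp
        exact mul_le_mul_of_nonneg_right (h2.trans h3) (by positivity)
    _ = _ := by rw [pow_add, hQ]; ring

lemma PinBound.pair_overlap_le (hinj : ∀ γ, Function.Injective (pt γ)) (hp : 0 ≤ p)
    (hM : 0 ≤ M) (hK : 0 ≤ K)
    (h : PinBound pt p M K 1) (U : Finset V) (hU : U.card ≤ 2 * k) (Q : Finset (Fin k))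
    (a b : Fin k) (hab : a ∈ Q ↔ b ∈ Q) :
    p * ∑ x : Γ × Γ with pt x.1 a = pt x.2 b ∧ ¬ Disjoint U (pairCover pt Q x),
        p ^ (pairCover pt Q x \ U).card
      ≤ 4 * k ^ 2 * (3 * k + 1 : ℝ) ^ (2 * k) * K ^ 2 * M ^ 2 *
        p ^ (Q.card + ((insert b Q).card - 1)) := by
  set A : ℝ := (3 * k + 1 : ℝ) ^ (2 * k) * K ^ 2 * M ^ 2 *
    p ^ (Q.card + ((insert b Q).card - 1)) with hA
  have hA0 : 0 ≤ A := by positivity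
  have hins : (insert a Q).card = (insert b Q).card := by
    by_cases ha : a ∈ Q
    · rw [Finset.insert_eq_of_mem ha, Finset.insert_eq_of_mem (hab.1 ha)]
    · rw [Finset.card_insert_of_notMem ha, Finset.card_insert_of_notMem (fun hb => ha (hab.2 hb))]
  have h1 : ∀ q ∈ Q, ∀ u ∈ U, p * ∑ x : Γ × Γ with pt x.1 a = pt x.2 b ∧ pt x.1 q = u,
      p ^ (pairCover pt Q x \ U).card ≤ A := fun q hq u hu =>
    h.pair_anchored_le hinj hp hM hK U hU Q a b hab.2 q hq u hu
  have h2 : ∀ q ∈ Q, ∀ u ∈ U, p * ∑ x : Γ × Γ with pt x.1 a = pt x.2 b ∧ pt x.2 q = u,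
      p ^ (pairCover pt Q x \ U).card ≤ A := by
    intro q hq u hu
    have h3 := h.pair_anchored_le hinj hp hM hK U hU Q b a hab.1 q hq u hu
    rw [hins] at h3
    refine le_trans (le_of_eq ?_) h3
    congr 1
    rw [Finset.sum_filter, Finset.sum_filter]
    refine Fintype.sum_equiv (Equiv.prodComm Γ Γ) _ _ fun x => ?_
    simp only [Equiv.prodComm_apply, Prod.fst_swap, Prod.snd_swap, pairCover,
      Finset.union_comm (Q.image (pt x.2)), eq_comm (a := pt x.2 b)]
  have h3 : ∑ x : Γ × Γ with pt x.1 a = pt x.2 b ∧ ¬ Disjoint U (pairCover pt Q x),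
        p ^ (pairCover pt Q x \ U).card ≤
      ∑ q ∈ Q, ∑ u ∈ U, ((∑ x : Γ × Γ with pt x.1 a = pt x.2 b ∧ pt x.1 q = u,
        p ^ (pairCover pt Q x \ U).card) + ∑ x : Γ × Γ with pt x.1 a = pt x.2 b ∧ pt x.2 q = u,
        p ^ (pairCover pt Q x \ U).card) := by
    simp only [Finset.sum_filter, ← Finset.sum_add_distrib]
    simp_rw [Finset.sum_comm (s := U) (t := Finset.univ)]
    rw [Finset.sum_comm]
    refine Finset.sum_le_sum fun x _ => ?_
    have hnn : ∀ q ∈ Q, ∀ u ∈ U, (0 : ℝ) ≤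
        (if pt x.1 a = pt x.2 b ∧ pt x.1 q = u then p ^ (pairCover pt Q x \ U).card else 0) +
        (if pt x.1 a = pt x.2 b ∧ pt x.2 q = u then p ^ (pairCover pt Q x \ U).card else 0) := by
      intro q _ u _
      have := pow_nonneg hp (pairCover pt Q x \ U).card
      split_ifs <;> linarith
    by_cases hx : pt x.1 a = pt x.2 b ∧ ¬ Disjoint U (pairCover pt Q x)
    · rw [if_pos hx]
      obtain ⟨u, hu, hu'⟩ := Finset.not_disjoint_iff.1 hx.2
      have : ∃ q ∈ Q, pt x.1 q = u ∨ pt x.2 q = u := by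
        simp only [pairCover, Finset.mem_union, Finset.mem_image] at hu'
        rcases hu' with ⟨q, hq, h⟩ | ⟨q, hq, h⟩
        exacts [⟨q, hq, Or.inl h⟩, ⟨q, hq, Or.inr h⟩]
      obtain ⟨q, hq, hqu⟩ := this
      refine le_trans ?_ (Finset.single_le_sum (fun q hq => Finset.sum_nonneg (hnn q hq)) hq)
      refine le_trans ?_ (Finset.single_le_sum (hnn q hq) hu)
      have := pow_nonneg hp (pairCover pt Q x \ U).card
      rcases hqu with hqu | hqu
      · rw [if_pos ⟨hx.1, hqu⟩]
        split_ifs <;> linarith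
      · rw [if_pos (c := pt x.1 a = pt x.2 b ∧ pt x.2 q = u) ⟨hx.1, hqu⟩]
        split_ifs <;> linarith
    · rw [if_neg hx]
      exact Finset.sum_nonneg fun q hq => Finset.sum_nonneg (hnn q hq)
  have h4 : p * ∑ q ∈ Q, ∑ u ∈ U, ((∑ x : Γ × Γ with pt x.1 a = pt x.2 b ∧ pt x.1 q = u,
        p ^ (pairCover pt Q x \ U).card) + ∑ x : Γ × Γ with pt x.1 a = pt x.2 b ∧ pt x.2 q = u,
        p ^ (pairCover pt Q x \ U).card) ≤ ∑ q ∈ Q, ∑ u ∈ U, (2 * A) := by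
    rw [Finset.mul_sum]
    refine Finset.sum_le_sum fun q hq => ?_
    rw [Finset.mul_sum]
    refine Finset.sum_le_sum fun u hu => ?_
    rw [mul_add]
    linarith [h1 q hq u hu, h2 q hq u hu]
  refine (mul_le_mul_of_nonneg_left h3 hp).trans (h4.trans ?_)
  simp only [Finset.sum_const, nsmul_eq_mul]
  have hQ : (Q.card : ℝ) ≤ k := by
    have : Q.card ≤ k := by simpa using Finset.card_le_univ Q
    exact_mod_cast this
  have hU' : (U.card : ℝ) ≤ 2 * k := by exact_mod_cast hU
  calc (Q.card : ℝ) * (U.card * (2 * A)) ≤ k * (2 * k * (2 * A)) := by gcongr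
    _ = _ := by rw [hA]; ring

/-- The constant in `PinBound.pair_concentration`. -/
noncomputable def pairConst (k : ℕ) (K : ℝ) : ℝ := 4 * (k + 1) ^ 2 * (3 * k + 1) ^ (2 * k) * K ^ 2

lemma pairConst_pos (k : ℕ) {K : ℝ} (hK : 0 < K) : 0 < pairConst k K := by
  unfold pairConst; positivity

/-- The number of glued pairs of tuples whose positions in `Q` lie in a binomial random set is
concentrated. -/
lemma PinBound.pair_concentration (hinj : ∀ γ, Function.Injective (pt γ)) (hp : 0 < p)
    (hp1 : p ≤ 1) (hM : 0 < M) (hK : 0 < K) (hV : 0 < Fintype.card V)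
    (h : PinBound pt p M K 1) (Q : Finset (Fin k)) (a b : Fin k) (hab : a ∈ Q ↔ b ∈ Q) :
    binomExp p (fun Z => if 2 * (pairConst k K * Fintype.card V * M ^ 2 *
        p ^ (Q.card + ((insert b Q).card - 1))) <
      ((Finset.univ.filter fun x : Γ × Γ => pt x.1 a = pt x.2 b ∧ pairCover pt Q x ⊆ Z).card : ℝ)
      then 1 else 0) ≤ 1 / (p * Fintype.card V) := by
  have hV' : (0 : ℝ) < Fintype.card V := by exact_mod_cast hV
  set E := p ^ (Q.card + ((insert b Q).card - 1)) with hE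
  have hE0 : 0 < E := pow_pos hp _
  have hc := pairConst_pos k hK
  have hbig : (1 : ℝ) ≤ 3 * k + 1 := by
    have : (0 : ℝ) ≤ k := Nat.cast_nonneg k
    linarith
  have hc1 : (3 * k + 1 : ℝ) ^ k * K ^ 2 ≤ pairConst k K := by
    unfold pairConst
    have h1 : (3 * k + 1 : ℝ) ^ k ≤ (3 * k + 1 : ℝ) ^ (2 * k) :=
      pow_le_pow_right₀ hbig (by omega)
    have h2 : (1 : ℝ) ≤ 4 * (k + 1) ^ 2 := by nlinarith [Nat.cast_nonneg (α := ℝ) k]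
    have h3 : (0 : ℝ) ≤ (3 * k + 1 : ℝ) ^ (2 * k) := by positivity
    have h4 : (3 * k + 1 : ℝ) ^ k ≤ 4 * (k + 1) ^ 2 * (3 * k + 1 : ℝ) ^ (2 * k) := by nlinarith
    exact mul_le_mul_of_nonneg_right h4 (by positivity)
  have hc2 : 4 * k ^ 2 * (3 * k + 1 : ℝ) ^ (2 * k) * K ^ 2 ≤ pairConst k K := by
    unfold pairConst
    have : (k : ℝ) ≤ k + 1 := by linarith
    gcongr
  set B := {x : Γ × Γ // pt x.1 a = pt x.2 b} with hB
  have key := binomExp_chebyshev (B := B) (fun x => pairCover pt Q x.1) (p := p)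
    (μ := pairConst k K * Fintype.card V * M ^ 2 * E) (ρ := pairConst k K * M ^ 2 * E / p)
    hp.le hp1 (by positivity) (by positivity) ?_ ?_
  · have hcard : ∀ Z, (Finset.univ.filter fun x : B => pairCover pt Q x.1 ⊆ Z).card =
        (Finset.univ.filter fun x : Γ × Γ => pt x.1 a = pt x.2 b ∧ pairCover pt Q x ⊆ Z).card := by
      intro Z
      rw [← Finset.card_map (Function.Embedding.subtype _)]
      congr 1
      ext x
      simp
      tauto
    simp only [hcard] at key
    refine key.trans (le_of_eq ?_)
    field_simp
  · have h1 := h.pair_mean_le hinj hp.le hM.le hK.le Q a b hab.2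
    rw [Finset.sum_subtype (p := fun x : Γ × Γ => pt x.1 a = pt x.2 b) _ (by simp)] at h1
    refine h1.trans ?_
    have : 0 ≤ Fintype.card V * M ^ 2 * E := by positivity
    calc _ = ((3 * k + 1 : ℝ) ^ k * K ^ 2) * (Fintype.card V * M ^ 2 * E) := by rw [hE]; ring
      _ ≤ pairConst k K * (Fintype.card V * M ^ 2 * E) := by gcongr
      _ = _ := by ring
  · intro y
    have h1 := h.pair_overlap_le hinj hp.le hM.le hK.le (pairCover pt Q y.1)
      (card_pairCover_le Q y.1) Q a b hab
    have h2 : ∑ x : B with ¬ Disjoint (pairCover pt Q y.1) (pairCover pt Q x.1),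
        p ^ (pairCover pt Q x.1 \ pairCover pt Q y.1).card =
        ∑ x : Γ × Γ with pt x.1 a = pt x.2 b ∧ ¬ Disjoint (pairCover pt Q y.1) (pairCover pt Q x),
        p ^ (pairCover pt Q x \ pairCover pt Q y.1).card := by
      rw [← Finset.filter_filter, Finset.sum_filter, Finset.sum_filter (s := Finset.filter _ _),
        Finset.sum_subtype (p := fun x : Γ × Γ => pt x.1 a = pt x.2 b) _ (by simp)]
    rw [h2, le_div_iff₀ hp, mul_comm]
    refine h1.trans ?_
    have : 0 ≤ M ^ 2 * E := by positivity
    calc _ = (4 * k ^ 2 * (3 * k + 1 : ℝ) ^ (2 * k) * K ^ 2) * (M ^ 2 * E) := by rw [hE]; ring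
      _ ≤ pairConst k K * (M ^ 2 * E) := by gcongr
      _ = _ := by ring

/-- Pairs of tuples agreeing at `b` and at a further position of `Q` are rare. -/
lemma PinBound.clustered_pair_prob_le (hinj : ∀ γ, Function.Injective (pt γ)) (hp : 0 < p)
    (hp1 : p ≤ 1) (hM : 0 < M) (hK : 0 < K) (hV : 0 < Fintype.card V) {θ : ℝ} (hθ : 0 < θ)
    (h : PinBound pt p M K 1) (h' : PinBound pt p M θ 2) (Q : Finset (Fin k)) (b : Fin k)
    (hb : b ∉ Q) {ζ : ℝ} (hζ : 0 < ζ) :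
    binomExp p (fun Z => if ζ * (Fintype.card V * M ^ 2 * p ^ (2 * Q.card)) <
      ((Finset.univ.filter fun x : Γ × Γ => pt x.1 b = pt x.2 b ∧ (∃ q ∈ Q, pt x.1 q = pt x.2 q) ∧
        pairCover pt Q x ⊆ Z).card : ℝ)
      then 1 else 0) ≤ k * (k + 1) ^ k * K * θ / ζ := by
  have hV' : (0 : ℝ) < Fintype.card V := by exact_mod_cast hV
  set A := Fintype.card V * M ^ 2 * p ^ (2 * Q.card) with hA
  have hA0 : 0 < A := by positivity
  set B := Finset.univ.filter fun x : Γ × Γ => pt x.1 b = pt x.2 b ∧ (∃ q ∈ Q, pt x.1 q = pt x.2 q)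
    with hB
  refine (binomExp_markov (a := ζ * A)
    (f := fun Z => ∑ x ∈ B, if pairCover pt Q x ⊆ Z then 1 else 0)
    hp.le hp1 (fun Z => Finset.sum_nonneg fun x _ => by split_ifs <;> norm_num)
    (by positivity) fun Z hZ => ?_).trans ?_
  · refine hZ.le.trans (le_of_eq ?_)
    rw [Finset.sum_boole, hB, Finset.filter_filter]
    simp only [and_assoc]
  · rw [div_le_div_iff₀ (by positivity) hζ, binomExp_sum]
    simp only [binomExp_subset]
    have hγ : ∀ γ : Γ, ∀ q ∈ Q, ∑ γ' with pt γ' b = pt γ b ∧ pt γ' q = pt γ q,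
        p ^ (Q.image (pt γ') \ Q.image (pt γ)).card ≤
          (k + 1 : ℝ) ^ k * (θ * p ^ Q.card * M) := by
      intro γ q hq
      have hbq : b ≠ q := fun h => hb (h ▸ hq)
      have h1 := h'.extension_sum_le hinj hp.le (Q.image (pt γ)) Q {b, q} (by simp)
        (by rw [Finset.card_pair hbq]) (pt γ) (fun q' _ hq' => Finset.mem_image_of_mem _ hq')
      have h2 : ({b, q} ∪ Q : Finset (Fin k)).card - 1 = Q.card := by
        have : ({b, q} ∪ Q : Finset (Fin k)) = insert b Q := by
          ext x; simp only [Finset.mem_union, Finset.mem_insert, Finset.mem_singleton]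
          constructor
          · rintro ((rfl | rfl) | h) <;> simp_all
          · rintro (rfl | h) <;> simp_all
        rw [this, Finset.card_insert_of_notMem hb]; simp
      rw [h2] at h1
      simp only [Finset.mem_insert, Finset.mem_singleton, forall_eq_or_imp, forall_eq] at h1
      refine h1.trans ?_
      have h3 : ((Q.image (pt γ)).card : ℝ) ≤ k := by
        have : (Q.image (pt γ)).card ≤ k :=
          Finset.card_image_le.trans (by simpa using Finset.card_le_univ Q)
        exact_mod_cast this
      gcongr
    have hsum : ∑ x ∈ B, p ^ (pairCover pt Q x).card ≤
        ∑ γ : Γ, ∑ q ∈ Q, p ^ Q.card * ((k + 1 : ℝ) ^ k * (θ * p ^ Q.card * M)) := by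
      rw [hB, Finset.sum_filter, Fintype.sum_prod_type]
      refine Finset.sum_le_sum fun γ _ => ?_
      calc _ ≤ ∑ γ', ∑ q ∈ Q, p ^ Q.card * (if pt γ' b = pt γ b ∧ pt γ' q = pt γ q then
            p ^ (Q.image (pt γ') \ Q.image (pt γ)).card else 0) := by
            refine Finset.sum_le_sum fun γ' _ => ?_
            have hnn : ∀ q ∈ Q, (0 : ℝ) ≤ p ^ Q.card * (if pt γ' b = pt γ b ∧ pt γ' q = pt γ q then
              p ^ (Q.image (pt γ') \ Q.image (pt γ)).card else 0) := by
              intro q _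
              split_ifs <;> positivity
            split_ifs with hx
            · obtain ⟨hb', q, hq, hqq⟩ := hx
              refine le_trans ?_ (Finset.single_le_sum hnn hq)
              rw [if_pos ⟨hb'.symm, hqq.symm⟩, ← Finset.card_image_of_injective Q (hinj γ),
                ← pow_add, ← Finset.card_union_of_disjoint Finset.disjoint_sdiff,
                Finset.union_sdiff_self_eq_union, pairCover]
            · exact Finset.sum_nonneg hnn
        _ = ∑ q ∈ Q, p ^ Q.card * ∑ γ' with pt γ' b = pt γ b ∧ pt γ' q = pt γ q,
            p ^ (Q.image (pt γ') \ Q.image (pt γ)).card := by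
            rw [Finset.sum_comm]
            refine Finset.sum_congr rfl fun q _ => ?_
            rw [← Finset.mul_sum, Finset.sum_filter]
        _ ≤ _ := Finset.sum_le_sum fun q hq =>
            mul_le_mul_of_nonneg_left (hγ γ q hq) (by positivity)
    simp only [Finset.sum_const, nsmul_eq_mul, Finset.card_univ] at hsum
    have hQ : (Q.card : ℝ) ≤ k := by
      have : Q.card ≤ k := by simpa using Finset.card_le_univ Q
      exact_mod_cast this
    have hΓ := h.card_le b
    calc _ ≤ (K * Fintype.card V * M) *
          (k * (p ^ Q.card * ((k + 1 : ℝ) ^ k * (θ * p ^ Q.card * M)))) * ζ := by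
          refine mul_le_mul_of_nonneg_right (hsum.trans ?_) hζ.le
          gcongr
      _ = _ := by rw [hA, two_mul, pow_add]; ring

end PairMoments

section Selection

variable {V : Type*} [Fintype V]

/-- A random subset of `A` of density `δ` has roughly the expected size and carries at most twice
the expected weight of pairs. -/
lemma exists_subset_pair_weight_le {B : Type*} [Fintype B] (a : B → ℝ) (ha : ∀ b, 0 ≤ a b)
    (x y : B → V) (A : Finset V) {δ B₀ : ℝ} (hδ : 0 < δ) (hδ1 : δ ≤ 1) (hA : 16 ≤ δ * A.card)
    (hB₀ : 0 < B₀)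
    (h : ∑ b, a b * (if x b ∈ A ∧ y b ∈ A then δ ^ ({x b, y b} : Finset V).card else 0) ≤ B₀) :
    ∃ T ⊆ A, δ * A.card / 2 ≤ T.card ∧ (T.card : ℝ) ≤ 2 * (δ * A.card) ∧
      ∑ b, a b * (if x b ∈ T ∧ y b ∈ T then 1 else 0) ≤ 2 * B₀ := by
  set m : ℝ := δ * A.card with hm
  have hm0 : 0 < m := by linarith
  set X : Finset V → ℝ := fun Z => ∑ v ∈ A, if {v} ⊆ Z then 1 else 0 with hX
  have hXcard : ∀ Z, X Z = ((Z ∩ A).card : ℝ) := by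
    intro Z
    simp only [hX, Finset.singleton_subset_iff, Finset.sum_boole]
    congr 2
    ext v
    simp [and_comm]
  have hEX : binomExp δ X = m := by
    rw [hX, binomExp_sum]
    simp only [binomExp_subset, Finset.card_singleton, pow_one, Finset.sum_const, nsmul_eq_mul, hm]
    ring
  have hEX2 : binomExp δ (fun Z => X Z ^ 2) ≤ m ^ 2 + m := by
    have h2 : ∀ Z, X Z ^ 2 = ∑ v ∈ A, ∑ w ∈ A, if ({v, w} : Finset V) ⊆ Z then (1 : ℝ) else 0 := by
      intro Z
      rw [sq, hX, Finset.sum_mul_sum]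
      refine Finset.sum_congr rfl fun v _ => Finset.sum_congr rfl fun w _ => ?_
      simp only [Finset.insert_subset_iff, Finset.singleton_subset_iff]
      by_cases hv : v ∈ Z <;> by_cases hw : w ∈ Z <;> simp [hv, hw]
    simp only [h2, binomExp_sum, binomExp_subset]
    have h3 : ∀ v ∈ A, ∑ w ∈ A, δ ^ ({v, w} : Finset V).card ≤ δ * m + δ := by
      intro v hv
      have h4 : ∀ w ∈ A, δ ^ ({v, w} : Finset V).card ≤ δ ^ 2 + if v = w then δ else 0 := by
        intro w _
        by_cases hvw : v = w
        · subst hvw; simp; positivity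
        · rw [Finset.card_pair hvw]; simp [hvw]
      refine (Finset.sum_le_sum h4).trans ?_
      rw [Finset.sum_add_distrib, Finset.sum_ite_eq, if_pos hv, Finset.sum_const, nsmul_eq_mul, hm]
      exact le_of_eq (by ring)
    refine (Finset.sum_le_sum h3).trans ?_
    rw [Finset.sum_const, nsmul_eq_mul]
    exact le_of_eq (by rw [hm]; ring)
  have hvar : binomExp δ (fun Z => (X Z - m) ^ 2) ≤ m := by
    have : (fun Z => (X Z - m) ^ 2) = fun Z => X Z ^ 2 + ((-2 * m) * X Z + m ^ 2) := by
      funext Z; ring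
    rw [this, binomExp_add, binomExp_add, binomExp_const_mul, binomExp_const, hEX]
    linarith
  set F : Finset V → ℝ := fun Z => ∑ b, a b * (if x b ∈ Z ∩ A ∧ y b ∈ Z ∩ A then 1 else 0) with hF
  have hEF : binomExp δ F ≤ B₀ := by
    refine le_trans (le_of_eq ?_) h
    rw [hF, binomExp_sum]
    refine Finset.sum_congr rfl fun b _ => ?_
    rw [binomExp_const_mul]
    congr 1
    split_ifs with hb
    · rw [← binomExp_subset]
      congr 1
      funext Z
      simp [hb.1, hb.2, Finset.insert_subset_iff]
    · refine Eq.trans (congrArg _ (funext fun Z => if_neg ?_)) (binomExp_const δ 0)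
      simp only [Finset.mem_inter]
      tauto
  have hE : binomExp δ (fun Z => F Z + B₀ / (2 * m) * (X Z - m) ^ 2) < 2 * B₀ := by
    rw [binomExp_add, binomExp_const_mul]
    have : B₀ / (2 * m) * binomExp δ (fun Z => (X Z - m) ^ 2) ≤ B₀ / (2 * m) * m := by gcongr
    have h5 : B₀ / (2 * m) * m = B₀ / 2 := by field_simp
    linarith
  obtain ⟨Z, hZ⟩ := exists_le_of_binomExp_le hδ.le hδ1 hE
  have hFnn : 0 ≤ F Z := Finset.sum_nonneg fun b _ => mul_nonneg (ha b) (by split_ifs <;> norm_num)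
  have hdev : (X Z - m) ^ 2 ≤ (m / 2) ^ 2 := by
    have h6 : B₀ / (2 * m) * (X Z - m) ^ 2 ≤ 2 * B₀ := by linarith
    rw [div_mul_eq_mul_div, div_le_iff₀ (by positivity)] at h6
    have h7 : (X Z - m) ^ 2 ≤ 4 * m := by
      by_contra! hcon
      nlinarith
    nlinarith
  have habs := abs_le_of_sq_le_sq' hdev (by positivity)
  rw [hXcard] at habs
  refine ⟨Z ∩ A, Finset.inter_subset_right, by linarith [habs.1], by linarith [habs.2], ?_⟩
  have : 0 ≤ B₀ / (2 * m) * (X Z - m) ^ 2 := by positivity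
  change F Z ≤ _
  linarith

end Selection

section Stages

variable {V Γ : Type*} [Fintype V] [Fintype Γ] {k r : ℕ}

/-- The tuples that respect the colour classes `C` when position `q` has colour `χ q`. -/
noncomputable def inClass (pt : Γ → Fin k → V) (χ : Fin k → Fin r) (C : Fin r → Finset V) :
    Finset Γ :=
  Finset.univ.filter fun γ => ∀ q, pt γ q ∈ C (χ q)

/-- The tuples whose first `i` positions lie in the selected sets `T` and whose remaining positions
respect the colour classes `C`. -/
noncomputable def stageSet (pt : Γ → Fin k → V) (χ : Fin k → Fin r) (C : Fin r → Finset V)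
    (T : Fin k → Finset V) (i : ℕ) : Finset Γ :=
  Finset.univ.filter fun γ => ∀ q : Fin k,
    ((q : ℕ) < i → pt γ q ∈ T q) ∧ (i ≤ (q : ℕ) → pt γ q ∈ C (χ q))

/-- The tuples through `x` at position `i` whose earlier positions lie in `T` and whose later
positions respect `C`. -/
noncomputable def linkSet (pt : Γ → Fin k → V) (χ : Fin k → Fin r) (C : Fin r → Finset V)
    (T : Fin k → Finset V) (i : Fin k) (x : V) : Finset Γ :=
  Finset.univ.filter fun γ => pt γ i = x ∧ ∀ q : Fin k,
    (q < i → pt γ q ∈ T q) ∧ (i < q → pt γ q ∈ C (χ q))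

/-- The vertices of `C (χ i)` whose link has at least `τ` tuples. -/
noncomputable def heavySet (pt : Γ → Fin k → V) (χ : Fin k → Fin r) (C : Fin r → Finset V)
    (T : Fin k → Finset V) (i : Fin k) (τ : ℝ) : Finset V :=
  (C (χ i)).filter fun x => τ ≤ ((linkSet pt χ C T i x).card : ℝ)

/-- Contribution of position `q` to the potential: selected positions must lie in `T`, the others
must lie in `Z` and are weighted by their probability of being selected. -/
noncomputable def pairWeight (pt : Γ → Fin k → V) (Z : Finset V) (δ : ℝ) (T : Fin k → Finset V)
    (i : ℕ) (q : Fin k) (x : Γ × Γ) : ℝ :=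
  if (q : ℕ) < i then (if pt x.1 q ∈ T q ∧ pt x.2 q ∈ T q then 1 else 0)
  else if pt x.1 q ∈ Z ∧ pt x.2 q ∈ Z then δ ^ ({pt x.1 q, pt x.2 q} : Finset V).card else 0

/-- The second-moment potential after `i` selections. -/
noncomputable def potential (pt : Γ → Fin k → V) (Z : Finset V) (δ p : ℝ) (T : Fin k → Finset V)
    (i : ℕ) : ℝ :=
  ∑ l ∈ Finset.univ.filter (fun l : Fin k => i ≤ (l : ℕ)), ((δ * p) ^ (2 * (l : ℕ)))⁻¹ *
    ∑ x : Γ × Γ with pt x.1 l = pt x.2 l, ∏ q with q < l, pairWeight pt Z δ T i q x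

variable {pt : Γ → Fin k → V} {χ : Fin k → Fin r} {C : Fin r → Finset V} {T : Fin k → Finset V}
  {Z : Finset V} {δ p : ℝ}

lemma pairWeight_nonneg (hδ : 0 ≤ δ) (i : ℕ) (q : Fin k) (x : Γ × Γ) :
    0 ≤ pairWeight pt Z δ T i q x := by
  unfold pairWeight
  split_ifs <;> positivity

lemma stageSet_card_eq_sum (i : Fin k) :
    (stageSet pt χ C T i).card = ∑ x ∈ C (χ i), (linkSet pt χ C T i x).card := by
  rw [Finset.card_eq_sum_card_fiberwise (f := fun γ => pt γ i) (t := C (χ i))]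
  · refine Finset.sum_congr rfl fun x hx => ?_
    congr 1
    ext γ
    simp only [stageSet, linkSet, Finset.mem_filter, Finset.mem_univ, true_and, Fin.lt_def]
    constructor
    · rintro ⟨h1, h2⟩
      exact ⟨h2, fun q => ⟨(h1 q).1, fun hq => (h1 q).2 hq.le⟩⟩
    · rintro ⟨h1, h2⟩
      refine ⟨fun q => ⟨(h2 q).1, fun hq => ?_⟩, h1⟩
      rcases hq.lt_or_eq with hq | hq
      · exact (h2 q).2 hq
      · have : q = i := Fin.ext hq.symm
        rw [this, h1]; exact hx
  · intro γ hγ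
    simp only [stageSet, Finset.mem_coe, Finset.mem_filter, Finset.mem_univ, true_and] at hγ
    exact (hγ i).2 le_rfl

lemma stageSet_succ_card_eq_sum (i : Fin k) (A : Finset V) :
    (stageSet pt χ C (Function.update T i A) (i + 1)).card =
      ∑ x ∈ A, (linkSet pt χ C T i x).card := by
  rw [Finset.card_eq_sum_card_fiberwise (f := fun γ => pt γ i) (t := A)]
  · refine Finset.sum_congr rfl fun x hx => ?_
    congr 1
    ext γ
    simp only [stageSet, linkSet, Finset.mem_filter, Finset.mem_univ, true_and, Fin.lt_def]
    constructor
    · rintro ⟨h1, h2⟩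
      refine ⟨h2, fun q => ⟨fun hq => ?_, fun hq => (h1 q).2 hq⟩⟩
      have := (h1 q).1 (by omega)
      rwa [Function.update_of_ne (by rintro rfl; omega)] at this
    · rintro ⟨h1, h2⟩
      refine ⟨fun q => ⟨fun hq => ?_, fun hq => (h2 q).2 hq⟩, h1⟩
      by_cases hqi : q = i
      · subst hqi; rw [Function.update_self, h1]; exact hx
      · rw [Function.update_of_ne hqi]
        refine (h2 q).1 ?_
        have : (q : ℕ) ≠ i := fun h => hqi (Fin.ext h)
        omega
  · intro γ hγ
    simp only [stageSet, Finset.mem_coe, Finset.mem_filter, Finset.mem_univ, true_and] at hγ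
    simpa using (hγ i).1 (by omega)

/-- The squared link sizes are controlled by the potential. -/
lemma sum_link_sq_le (hδ : 0 < δ) (hp : 0 < p) (i : Fin k) :
    ∑ x, ((linkSet pt χ C T i x).card : ℝ) ^ 2 ≤
      (δ * p) ^ (2 * (i : ℕ)) * potential pt Z δ p T i := by
  have hdp : 0 < (δ * p) ^ (2 * (i : ℕ)) := by positivity
  have h1 : ((δ * p) ^ (2 * (i : ℕ)))⁻¹ *
      ∑ x : Γ × Γ with pt x.1 i = pt x.2 i, ∏ q with q < i, pairWeight pt Z δ T i q x ≤
      potential pt Z δ p T i := by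
    refine Finset.single_le_sum (f := fun l : Fin k => ((δ * p) ^ (2 * (l : ℕ)))⁻¹ *
      ∑ x : Γ × Γ with pt x.1 l = pt x.2 l, ∏ q with q < l, pairWeight pt Z δ T i q x)
      (fun l _ => ?_) (by simp)
    exact mul_nonneg (by positivity) (Finset.sum_nonneg fun x _ =>
      Finset.prod_nonneg fun q _ => pairWeight_nonneg hδ.le _ _ _)
  rw [inv_mul_le_iff₀ hdp] at h1
  refine le_trans ?_ h1
  have h2 : ∑ x, ((linkSet pt χ C T i x).card : ℝ) ^ 2 =
      ∑ y ∈ Finset.univ.biUnion fun x => linkSet pt χ C T i x ×ˢ linkSet pt χ C T i x, (1 : ℝ) := by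
    rw [Finset.sum_biUnion]
    · refine Finset.sum_congr rfl fun x _ => ?_
      rw [Finset.sum_const, Finset.card_product, nsmul_eq_mul, mul_one, sq]; push_cast; rfl
    · intro x _ x' _ hxx'
      rw [Function.onFun, Finset.disjoint_left]
      intro y hy hy'
      simp only [Finset.mem_product, linkSet, Finset.mem_filter] at hy hy'
      exact hxx' (hy.1.2.1.symm.trans hy'.1.2.1)
  rw [h2]
  have hsub : (Finset.univ.biUnion fun x => linkSet pt χ C T i x ×ˢ linkSet pt χ C T i x) ⊆
      Finset.univ.filter fun x : Γ × Γ => pt x.1 i = pt x.2 i := by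
    intro y hy
    simp only [Finset.mem_biUnion, Finset.mem_univ, true_and, Finset.mem_product, linkSet,
      Finset.mem_filter] at hy ⊢
    obtain ⟨x, h1, h2⟩ := hy
    rw [h1.1, h2.1]
  refine le_trans (Finset.sum_le_sum fun y hy => ?_)
    (Finset.sum_le_sum_of_subset_of_nonneg hsub fun x _ _ =>
      Finset.prod_nonneg fun q _ => pairWeight_nonneg hδ.le _ _ _)
  simp only [Finset.mem_biUnion, Finset.mem_univ, true_and, Finset.mem_product, linkSet,
      Finset.mem_filter] at hy
  obtain ⟨x, h1, h2⟩ := hy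
  rw [Finset.prod_eq_one]
  intro q hq
  simp only [Finset.mem_filter, Finset.mem_univ, true_and] at hq
  unfold pairWeight
  rw [if_pos (Fin.lt_def.1 hq), if_pos ⟨(h1.2 q).1 hq, (h2.2 q).1 hq⟩]

/-- Many tuples and a bounded potential force a large heavy set. -/
lemma heavySet_card_ge (hδ : 0 < δ) (hp : 0 < p) (i : Fin k) {lam Y M : ℝ} (hlam : 0 < lam)
    (hY : 0 < Y) (hM : 0 < M) (hV : 0 < Fintype.card V)
    (hL : lam * (δ * p) ^ (i : ℕ) * Fintype.card V * M ≤ (stageSet pt χ C T i).card)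
    (hΨ : potential pt Z δ p T i ≤ Y * Fintype.card V * M ^ 2) :
    lam ^ 2 / (4 * Y) * Fintype.card V ≤
      ((heavySet pt χ C T i (lam / 2 * (δ * p) ^ (i : ℕ) * M)).card : ℝ) := by
  have hN : (0 : ℝ) < Fintype.card V := by exact_mod_cast hV
  set N : ℝ := (Fintype.card V : ℝ) with hNdef
  set d := (δ * p) ^ (i : ℕ) with hd
  have hd0 : 0 < d := by positivity
  set U := heavySet pt χ C T i (lam / 2 * d * M) with hU
  set φ : V → ℝ := fun x => ((linkSet pt χ C T i x).card : ℝ) with hφ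
  have h1 : ((stageSet pt χ C T i).card : ℝ) = ∑ x ∈ C (χ i), φ x := by
    rw [stageSet_card_eq_sum]; push_cast; rfl
  have h2 : ∑ x ∈ C (χ i), φ x ≤ ∑ x ∈ U, φ x + N * (lam / 2 * d * M) := by
    rw [← Finset.sum_filter_add_sum_filter_not (C (χ i)) (fun x => lam / 2 * d * M ≤ φ x)]
    refine add_le_add le_rfl ?_
    calc _ ≤ ∑ x ∈ (C (χ i)).filter (fun x => ¬ lam / 2 * d * M ≤ φ x), lam / 2 * d * M :=
          Finset.sum_le_sum fun x hx => (not_le.1 (Finset.mem_filter.1 hx).2).le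
      _ ≤ _ := by
          rw [Finset.sum_const, nsmul_eq_mul]
          have : (((C (χ i)).filter (fun x => ¬ lam / 2 * d * M ≤ φ x)).card : ℝ) ≤ N := by
            rw [hNdef]
            exact Nat.cast_le.2 (Finset.card_le_univ _)
          gcongr
  have h3 : lam / 2 * d * N * M ≤ ∑ x ∈ U, φ x := by
    rw [h1] at hL
    nlinarith
  have h4 : (∑ x ∈ U, φ x) ^ 2 ≤ U.card * ∑ x ∈ U, φ x ^ 2 := by
    have := Finset.sum_mul_sq_le_sq_mul_sq U (fun _ => (1 : ℝ)) φ
    simpa using this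
  have h5 : ∑ x ∈ U, φ x ^ 2 ≤ d ^ 2 * (Y * N * M ^ 2) := by
    refine (Finset.sum_le_univ_sum_of_nonneg fun x => sq_nonneg _).trans ?_
    refine (sum_link_sq_le (Z := Z) hδ hp i).trans ?_
    rw [mul_comm 2, pow_mul]
    gcongr
  have h6 : (lam / 2 * d * N * M) ^ 2 ≤ U.card * (d ^ 2 * (Y * N * M ^ 2)) :=
    (pow_le_pow_left₀ (by positivity) h3 2).trans (h4.trans (by gcongr))
  rw [div_mul_eq_mul_div, div_le_iff₀ (by positivity)]
  have h7 : 0 < d ^ 2 * N * M ^ 2 := by positivity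
  refine le_of_mul_le_mul_right ?_ h7
  nlinarith

/-- Selecting a random subset at position `i` at most doubles the potential bound. -/
lemma exists_selection (hδ : 0 < δ) (hδ1 : δ ≤ 1) (hp : 0 < p) (i : Fin k) (A : Finset V)
    (hAZ : A ⊆ Z) (hA : 16 ≤ δ * A.card) {B₀ : ℝ} (hB₀ : 0 < B₀)
    (hΨ : potential pt Z δ p T i ≤ B₀) :
    ∃ S ⊆ A, δ * A.card / 2 ≤ S.card ∧ (S.card : ℝ) ≤ 2 * (δ * A.card) ∧
      potential pt Z δ p (Function.update T i S) (i + 1) ≤ 2 * B₀ := by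
  set a : Fin k × (Γ × Γ) → ℝ := fun b =>
    if i < b.1 ∧ pt b.2.1 b.1 = pt b.2.2 b.1 then
      ((δ * p) ^ (2 * (b.1 : ℕ)))⁻¹ *
        ∏ q ∈ (Finset.univ.filter fun q => q < b.1).erase i, pairWeight pt Z δ T i q b.2
    else 0 with ha
  have ha0 : ∀ b, 0 ≤ a b := by
    intro b
    simp only [ha]
    split_ifs
    · exact mul_nonneg (by positivity) (Finset.prod_nonneg fun q _ => pairWeight_nonneg hδ.le _ _ _)
    · exact le_rfl
  obtain ⟨S, hSA, hS1, hS2, hS⟩ := exists_subset_pair_weight_le a ha0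
    (fun b => pt b.2.1 i) (fun b => pt b.2.2 i) A hδ hδ1 hA hB₀ (by
      refine le_trans ?_ hΨ
      rw [potential, Fintype.sum_prod_type, Finset.sum_filter]
      refine Finset.sum_le_sum fun l _ => ?_
      by_cases hil : i < l
      · rw [if_pos (Fin.lt_def.1 hil).le, Finset.sum_filter, Finset.mul_sum]
        refine Finset.sum_le_sum fun x _ => ?_
        simp only [ha]
        by_cases hx : pt x.1 l = pt x.2 l
        · rw [if_pos ⟨hil, hx⟩, if_pos hx, mul_assoc]
          refine mul_le_mul_of_nonneg_left ?_ (by positivity)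
          rw [← Finset.prod_erase_mul _ _ (show i ∈ Finset.univ.filter fun q => q < l by simpa)]
          refine mul_le_mul_of_nonneg_left ?_
            (Finset.prod_nonneg fun q _ => pairWeight_nonneg hδ.le _ _ _)
          unfold pairWeight
          rw [if_neg (lt_irrefl _)]
          by_cases hxA : pt x.1 i ∈ A ∧ pt x.2 i ∈ A
          · rw [if_pos hxA, if_pos ⟨hAZ hxA.1, hAZ hxA.2⟩]
          · rw [if_neg hxA]; split_ifs <;> positivity
        · rw [if_neg (fun h => hx h.2), if_neg hx]; simp
      · simp only [ha, hil, false_and, if_false, zero_mul, Finset.sum_const_zero]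
        split_ifs
        · exact mul_nonneg (by positivity) (Finset.sum_nonneg fun x _ =>
            Finset.prod_nonneg fun q _ => pairWeight_nonneg hδ.le _ _ _)
        · exact le_rfl)
  refine ⟨S, hSA, hS1, hS2, le_trans (le_of_eq ?_) hS⟩
  rw [potential, Fintype.sum_prod_type, Finset.sum_filter]
  refine Finset.sum_congr rfl fun l _ => ?_
  by_cases hil : i < l
  · rw [if_pos (Nat.succ_le_of_lt (Fin.lt_def.1 hil)), Finset.sum_filter, Finset.mul_sum]
    refine Finset.sum_congr rfl fun x _ => ?_
    simp only [ha]
    by_cases hx : pt x.1 l = pt x.2 l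
    · rw [if_pos hx, if_pos ⟨hil, hx⟩, mul_assoc]
      congr 1
      rw [← Finset.prod_erase_mul _ _ (show i ∈ Finset.univ.filter fun q => q < l by simpa)]
      congr 1
      · refine Finset.prod_congr rfl fun q hq => ?_
        have hqi := (Finset.mem_erase.1 hq).1
        have hqi' : (q : ℕ) ≠ i := fun h => hqi (Fin.ext h)
        unfold pairWeight
        rw [Function.update_of_ne hqi]
        by_cases hlt : (q : ℕ) < i
        · rw [if_pos hlt, if_pos (by omega)]
        · rw [if_neg hlt, if_neg (by omega)]
      · unfold pairWeight
        rw [if_pos (Nat.lt_succ_self _), Function.update_self]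
    · rw [if_neg hx, if_neg (fun h => hx h.2)]; simp
  · simp only [ha, hil, false_and, if_false, zero_mul, Finset.sum_const_zero]
    rw [if_neg]
    rw [Fin.lt_def] at hil
    omega

end Stages

section Containers

/-- Density of surviving tuples after `i` selections. -/
noncomputable def lamSeq (ε η Y : ℝ) : ℕ → ℝ
  | 0 => ε
  | i + 1 => η * (lamSeq ε η Y i ^ 2 / (4 * (2 ^ i * Y))) * lamSeq ε η Y i / 4

/-- Density of the heavy set after `i` selections. -/
noncomputable def heavySeq (ε η Y : ℝ) (i : ℕ) : ℝ := lamSeq ε η Y i ^ 2 / (4 * (2 ^ i * Y))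

lemma lamSeq_pos {ε η Y : ℝ} (hε : 0 < ε) (hη : 0 < η) (hY : 0 < Y) (i : ℕ) :
    0 < lamSeq ε η Y i := by
  induction i with
  | zero => exact hε
  | succ i ih => unfold lamSeq; positivity

lemma heavySeq_pos {ε η Y : ℝ} (hε : 0 < ε) (hη : 0 < η) (hY : 0 < Y) (i : ℕ) :
    0 < heavySeq ε η Y i := by
  have := lamSeq_pos hε hη hY i
  unfold heavySeq; positivity

variable {V Γ : Type*} [Fintype V] [Fintype Γ] {k r : ℕ}

/-- Either the colour classes `I` contain many tuples, or some heavy set determined by few vertices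
of `I` is almost avoided by its colour class. -/
lemma many_or_sparse_heavy (pt : Γ → Fin k → V) (χ : Fin k → Fin r) (C I : Fin r → Finset V)
    (Z : Finset V) {δ p M ε η Y : ℝ} (hδ : 0 < δ) (hδ1 : δ ≤ 1) (hp : 0 < p) (hM : 0 < M)
    (hε : 0 < ε) (hη : 0 < η) (hη1 : η ≤ 1) (hY : 0 < Y) (hV : 0 < Fintype.card V)
    (hpN : 1 ≤ p * Fintype.card V)
    (hbig : ∀ i < k, 16 ≤ δ * (η * p * (heavySeq ε η Y i * Fintype.card V)))
    (hΨ : potential pt Z δ p (fun _ => ∅) 0 ≤ Y * Fintype.card V * M ^ 2)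
    (hI : ∀ j, I j ⊆ Z) (hC : ε * Fintype.card V * M ≤ (inClass pt χ C).card) :
    lamSeq ε η Y k * (δ * p) ^ k * Fintype.card V * M ≤ (inClass pt χ I).card ∨
    ∃ (i : Fin k) (T : Fin k → Finset V), (∀ q, T q ⊆ I (χ q)) ∧
      (∀ q, ((T q).card : ℝ) ≤ 4 * δ * p * Fintype.card V) ∧
      heavySeq ε η Y i * Fintype.card V ≤
        ((heavySet pt χ C T i (lamSeq ε η Y i / 2 * (δ * p) ^ (i : ℕ) * M)).card : ℝ) ∧
      ((I (χ i) ∩ heavySet pt χ C T i (lamSeq ε η Y i / 2 * (δ * p) ^ (i : ℕ) * M)).card : ℝ) <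
        η * p * (heavySet pt χ C T i (lamSeq ε η Y i / 2 * (δ * p) ^ (i : ℕ) * M)).card := by
  rw [or_iff_not_imp_right]
  intro hno
  push Not at hno
  have hN : (0 : ℝ) < Fintype.card V := by exact_mod_cast hV
  have hlam := lamSeq_pos hε hη hY
  have hind : ∀ i : ℕ, i ≤ k → ∃ T : Fin k → Finset V, (∀ q, T q ⊆ I (χ q)) ∧
      (∀ q, ((T q).card : ℝ) ≤ 4 * δ * p * Fintype.card V) ∧
      lamSeq ε η Y i * (δ * p) ^ i * Fintype.card V * M ≤ (stageSet pt χ C T i).card ∧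
      potential pt Z δ p T i ≤ 2 ^ i * Y * Fintype.card V * M ^ 2 := by
    intro i
    induction i with
    | zero =>
      intro _
      refine ⟨fun _ => ∅, fun _ => Finset.empty_subset _, fun _ => ?_, ?_, ?_⟩
      · simp only [Finset.card_empty, Nat.cast_zero]; positivity
      · have : stageSet pt χ C (fun _ => ∅) 0 = inClass pt χ C := by
          ext γ; simp [stageSet, inClass]
        rw [this]
        simpa [lamSeq] using hC
      · simpa using hΨ
    | succ i ih =>
      intro hik
      obtain ⟨T, hTI, hTc, hL, hP⟩ := ih (by omega)
      set i' : Fin k := ⟨i, by omega⟩ with hi'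
      set U := heavySet pt χ C T i' (lamSeq ε η Y i / 2 * (δ * p) ^ i * M) with hU
      have hUc : heavySeq ε η Y i * Fintype.card V ≤ (U.card : ℝ) :=
        heavySet_card_ge (i := i') (Z := Z) hδ hp (hlam i) (by positivity) hM hV hL hP
      have hIU := hno i' T hTI hTc hUc
      change η * p * (U.card : ℝ) ≤ ((I (χ i') ∩ U).card : ℝ) at hIU
      obtain ⟨A, hAsub, hAcard⟩ := Finset.exists_subset_card_eq (Nat.ceil_le.2 hIU)
      have hA1 : η * p * (heavySeq ε η Y i * Fintype.card V) ≤ (A.card : ℝ) := by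
        rw [hAcard]
        refine le_trans ?_ (Nat.le_ceil _)
        gcongr
      have hA2 : (A.card : ℝ) ≤ 2 * p * Fintype.card V := by
        rw [hAcard]
        have h1 := (Nat.ceil_lt_add_one (show 0 ≤ η * p * (U.card : ℝ) by positivity)).le
        have h2 : (U.card : ℝ) ≤ Fintype.card V := by exact_mod_cast Finset.card_le_univ U
        have h3 : η * p * (U.card : ℝ) ≤ 1 * p * Fintype.card V := by gcongr
        linarith
      have hA3 : 16 ≤ δ * A.card :=
        (hbig i (by omega)).trans (mul_le_mul_of_nonneg_left hA1 hδ.le)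
      have hAI : A ⊆ I (χ i') := hAsub.trans Finset.inter_subset_left
      obtain ⟨S, hSA, hS1, hS2, hSP⟩ := exists_selection (pt := pt) (T := T) (Z := Z) hδ hδ1 hp i' A
        (hAI.trans (hI _)) hA3 (B₀ := 2 ^ i * Y * Fintype.card V * M ^ 2) (by positivity) hP
      refine ⟨Function.update T i' S, fun q => ?_, fun q => ?_, ?_, ?_⟩
      · by_cases hq : q = i'
        · subst hq; rw [Function.update_self]; exact hSA.trans hAI
        · rw [Function.update_of_ne hq]; exact hTI q
      · by_cases hq : q = i'
        · rw [hq, Function.update_self]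
          refine hS2.trans ?_
          nlinarith
        · rw [Function.update_of_ne hq]; exact hTc q
      · have h1 := stageSet_succ_card_eq_sum (pt := pt) (χ := χ) (C := C) (T := T) i' S
        have h2 : ((stageSet pt χ C (Function.update T i' S) (i + 1)).card : ℝ) =
            ∑ x ∈ S, ((linkSet pt χ C T i' x).card : ℝ) := by
          rw [show i + 1 = (i' : ℕ) + 1 from rfl, h1]; push_cast; rfl
        rw [h2]
        have h3 : ∀ x ∈ S, lamSeq ε η Y i / 2 * (δ * p) ^ i * M ≤
            ((linkSet pt χ C T i' x).card : ℝ) := fun x hx =>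
          (Finset.mem_filter.1 ((Finset.mem_inter.1 (hAsub (hSA hx))).2)).2
        have h4 := Finset.card_nsmul_le_sum S _ _ h3
        rw [nsmul_eq_mul] at h4
        refine le_trans ?_ h4
        have h5 : δ * (η * p * (heavySeq ε η Y i * Fintype.card V)) / 2 ≤ (S.card : ℝ) := by
          refine le_trans ?_ hS1
          gcongr
        have h6 := hlam i
        calc _ = δ * (η * p * (heavySeq ε η Y i * Fintype.card V)) / 2 *
              (lamSeq ε η Y i / 2 * (δ * p) ^ i * M) := by
              rw [lamSeq, ← heavySeq, pow_succ]; ring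
          _ ≤ _ := by gcongr
      · refine hSP.trans (le_of_eq ?_)
        rw [pow_succ]; ring
  obtain ⟨T, hTI, _, hL, _⟩ := hind k le_rfl
  refine hL.trans ?_
  have : stageSet pt χ C T k ⊆ inClass pt χ I := by
    intro γ hγ
    simp only [stageSet, inClass, Finset.mem_filter, Finset.mem_univ, true_and] at hγ ⊢
    exact fun q => hTI q ((hγ q).1 q.2)
  exact_mod_cast Finset.card_le_card this

variable {J : Type*} [Fintype J]

/-- Remove the heavy set at position `i` from its colour class. -/
noncomputable def shrink (pt : Γ → Fin k → V) (χ : Fin k → Fin r) (C : Fin r → Finset V)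
    (T : Fin k → Finset V) (i : Fin k) (τ : ℝ) : Fin r → Finset V :=
  Function.update C (χ i) (C (χ i) \ heavySet pt χ C T i τ)

/-- The containers obtained from the full vertex set in at most `ρ` shrinking rounds, each
determined by subsets of `F`. -/
noncomputable def containers (pt : Γ → Fin k → V) (χ : J → Fin k → Fin r) (τ : ℕ → ℝ)
    (F : Finset V) : ℕ → Finset (Fin r → Finset V)
  | 0 => {fun _ => Finset.univ}
  | ρ + 1 => containers pt χ τ F ρ ∪
      Finset.image (fun y : (Fin r → Finset V) × J × Fin k × (Fin k → Finset V) =>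
          shrink pt (χ y.2.1) y.1 y.2.2.2 y.2.2.1 (τ y.2.2.1))
        (containers pt χ τ F ρ ×ˢ (Finset.univ ×ˢ (Finset.univ ×ˢ
          Fintype.piFinset fun _ => F.powerset)))

lemma card_containers_le (pt : Γ → Fin k → V) (χ : J → Fin k → Fin r) (τ : ℕ → ℝ)
    (F : Finset V) (ρ : ℕ) :
    (containers pt χ τ F ρ).card ≤ (1 + Fintype.card J * k * 2 ^ (k * F.card)) ^ ρ := by
  induction ρ with
  | zero => simp [containers]
  | succ ρ ih =>
    rw [containers, pow_succ]
    refine (Finset.card_union_le _ _).trans ?_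
    refine (Nat.add_le_add_left Finset.card_image_le _).trans ?_
    have h : (Fintype.piFinset fun _ : Fin k => F.powerset).card = 2 ^ (k * F.card) := by
      rw [Fintype.card_piFinset]
      simp [Finset.card_powerset, ← pow_mul, mul_comm]
    rw [Finset.card_product, Finset.card_product, Finset.card_product, h]
    simp only [Finset.card_univ, Fintype.card_fin]
    calc _ = (containers pt χ τ F ρ).card * (1 + Fintype.card J * k * 2 ^ (k * F.card)) := by ring
      _ ≤ _ := Nat.mul_le_mul_right _ ih

lemma containers_mono_set (pt : Γ → Fin k → V) (χ : J → Fin k → Fin r) (τ : ℕ → ℝ)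
    {F F' : Finset V} (h : F ⊆ F') (ρ : ℕ) :
    containers pt χ τ F ρ ⊆ containers pt χ τ F' ρ := by
  induction ρ with
  | zero => exact subset_rfl
  | succ ρ ih =>
    rw [containers, containers]
    refine Finset.union_subset_union ih (Finset.image_subset_image ?_)
    refine Finset.product_subset_product ih (Finset.product_subset_product subset_rfl
      (Finset.product_subset_product subset_rfl ?_))
    exact Fintype.piFinset_subset _ _ fun _ => Finset.powerset_mono.2 h

lemma containers_mono_rounds (pt : Γ → Fin k → V) (χ : J → Fin k → Fin r) (τ : ℕ → ℝ)
    (F : Finset V) {ρ ρ' : ℕ} (h : ρ ≤ ρ') :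
    containers pt χ τ F ρ ⊆ containers pt χ τ F ρ' := by
  induction h with
  | refl => exact subset_rfl
  | step _ ih => exact ih.trans (by rw [containers]; exact Finset.subset_union_left)

/-- Colour classes containing few tuples are almost covered by a container with few tuples which is
determined by few vertices. -/
lemma many_or_container (pt : Γ → Fin k → V) (χ : J → Fin k → Fin r) (I : Fin r → Finset V)
    (Z : Finset V) {δ p M ε η Y u : ℝ} (hδ : 0 < δ) (hδ1 : δ ≤ 1) (hp : 0 < p) (hM : 0 < M)
    (hε : 0 < ε) (hη : 0 < η) (hη1 : η ≤ 1) (hY : 0 < Y) (hV : 0 < Fintype.card V)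
    (hpN : 1 ≤ p * Fintype.card V) (hu : ∀ i < k, u ≤ heavySeq ε η Y i)
    (hbig : 16 ≤ δ * (η * p * (u * Fintype.card V)))
    (hΨ : potential pt Z δ p (fun _ => ∅) 0 ≤ Y * Fintype.card V * M ^ 2)
    (hI : ∀ j, I j ⊆ Z) (R : ℕ) (hR : r < R * u) :
    (∃ ι, lamSeq ε η Y k * (δ * p) ^ k * Fintype.card V * M ≤ (inClass pt (χ ι) I).card) ∨
    ∃ (F : Finset V) (C : Fin r → Finset V), F ⊆ Z ∧
      (F.card : ℝ) ≤ R * (k * (4 * δ * p * Fintype.card V)) ∧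
      C ∈ containers pt χ (fun i => lamSeq ε η Y i / 2 * (δ * p) ^ i * M) F R ∧
      (∀ ι, ((inClass pt (χ ι) C).card : ℝ) < ε * Fintype.card V * M) ∧
      ∑ j, ((I j \ C j).card : ℝ) ≤ r * (η * p * Fintype.card V) := by
  by_contra! hcon
  obtain ⟨hfew, hcon⟩ := hcon
  have hN : (0 : ℝ) < Fintype.card V := by exact_mod_cast hV
  set τ : ℕ → ℝ := fun i => lamSeq ε η Y i / 2 * (δ * p) ^ i * M with hτ
  have hcompl : ∀ C : Fin r → Finset V, ∑ j, (((C j)ᶜ).card : ℝ) ≤ r * Fintype.card V := by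
    intro C
    calc _ ≤ ∑ _j : Fin r, (Fintype.card V : ℝ) :=
          Finset.sum_le_sum fun j _ => by exact_mod_cast Finset.card_le_univ _
      _ = _ := by simp
  have hind : ∀ ρ : ℕ, ρ ≤ R → ∃ (F : Finset V) (C : Fin r → Finset V), F ⊆ Z ∧
      (F.card : ℝ) ≤ ρ * (k * (4 * δ * p * Fintype.card V)) ∧
      C ∈ containers pt χ τ F ρ ∧
      ρ * (u * Fintype.card V) ≤ ∑ j, (((C j)ᶜ).card : ℝ) ∧
      ∑ j, ((I j \ C j).card : ℝ) ≤ η * p * ∑ j, (((C j)ᶜ).card : ℝ) := by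
    intro ρ
    induction ρ with
    | zero =>
      intro _
      exact ⟨∅, fun _ => Finset.univ, by simp, by simp, by simp [containers], by simp,
        by simp [Finset.sdiff_eq_empty_iff_subset.2 (Finset.subset_univ _)]⟩
    | succ ρ ih =>
      intro hρ
      obtain ⟨F, C, hFZ, hFc, hC, hCc, hIC⟩ := ih (by omega)
      have hρR : (ρ : ℝ) ≤ R := by exact_mod_cast (by omega : ρ ≤ R)
      have hsmall : ∑ j, ((I j \ C j).card : ℝ) ≤ r * (η * p * Fintype.card V) := by
        refine hIC.trans ?_
        calc _ ≤ η * p * (r * Fintype.card V) := by gcongr; exact hcompl C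
          _ = _ := by ring
      have hex : ∃ ι, ε * Fintype.card V * M ≤ ((inClass pt (χ ι) C).card : ℝ) := by
        by_contra! hall
        have h1 := hcon F C hFZ (hFc.trans (by gcongr))
          (containers_mono_rounds pt χ τ F (by omega) hC) hall
        linarith
      obtain ⟨ι, hι⟩ := hex
      rcases many_or_sparse_heavy pt (χ ι) C I Z hδ hδ1 hp hM hε hη hη1 hY hV hpN
        (fun i hi => hbig.trans (by gcongr; exact hu i hi)) hΨ hI hι with hmany | hsp
      · exact absurd hmany (not_le.2 (hfew ι))
      · obtain ⟨i, T, hTI, hTc, hUc, hIU⟩ := hsp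
        set U := heavySet pt (χ ι) C T i (lamSeq ε η Y i / 2 * (δ * p) ^ (i : ℕ) * M) with hU
        have hUC : U ⊆ C (χ ι i) := Finset.filter_subset _ _
        have hC' : ∀ j, shrink pt (χ ι) C T i (τ i) j = if j = χ ι i then C j \ U else C j := by
          intro j
          unfold shrink
          by_cases hj : j = χ ι i
          · subst hj; rw [Function.update_self, if_pos rfl]
          · rw [Function.update_of_ne hj, if_neg hj]
        have hs1 : ∑ j, (((shrink pt (χ ι) C T i (τ i) j)ᶜ).card : ℝ) =
            ∑ j, (((C j)ᶜ).card : ℝ) + U.card := by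
          have : ∀ j, (((shrink pt (χ ι) C T i (τ i) j)ᶜ).card : ℝ) =
              ((C j)ᶜ).card + if j = χ ι i then (U.card : ℝ) else 0 := by
            intro j
            rw [hC']
            split_ifs with hj
            · have h1 : (C j \ U)ᶜ = (C j)ᶜ ∪ U := by
                ext v; simp only [Finset.mem_compl, Finset.mem_sdiff, Finset.mem_union]; tauto
              have h2 : Disjoint (C j)ᶜ U := by
                rw [hj]; exact (disjoint_compl_left (a := C (χ ι i))).mono_right hUC
              rw [h1, Finset.card_union_of_disjoint h2]; push_cast; rfl
            · simp
          simp only [this, Finset.sum_add_distrib, Finset.sum_ite_eq', Finset.mem_univ, if_true]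
        have hs2 : ∑ j, ((I j \ shrink pt (χ ι) C T i (τ i) j).card : ℝ) ≤
            ∑ j, ((I j \ C j).card : ℝ) + (I (χ ι i) ∩ U).card := by
          have : ∀ j, ((I j \ shrink pt (χ ι) C T i (τ i) j).card : ℝ) ≤
              (I j \ C j).card + if j = χ ι i then ((I (χ ι i) ∩ U).card : ℝ) else 0 := by
            intro j
            rw [hC']
            split_ifs with hj
            · subst hj
              have h1 : I (χ ι i) \ (C (χ ι i) \ U) ⊆
                  (I (χ ι i) \ C (χ ι i)) ∪ (I (χ ι i) ∩ U) := by
                intro v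
                simp only [Finset.mem_sdiff, Finset.mem_union, Finset.mem_inter]; tauto
              exact_mod_cast (Finset.card_le_card h1).trans (Finset.card_union_le _ _)
            · simp
          refine (Finset.sum_le_sum fun j _ => this j).trans (le_of_eq ?_)
          simp only [Finset.sum_add_distrib, Finset.sum_ite_eq', Finset.mem_univ, if_true]
        set F' := F ∪ Finset.univ.biUnion T with hF'
        refine ⟨F', shrink pt (χ ι) C T i (τ i), ?_, ?_, ?_, ?_, ?_⟩
        · refine Finset.union_subset hFZ (Finset.biUnion_subset.2 fun q _ => (hTI q).trans (hI _))
        · have h1 : (F'.card : ℝ) ≤ F.card + ∑ q, ((T q).card : ℝ) := by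
            exact_mod_cast (Finset.card_union_le _ _).trans
              (Nat.add_le_add_left Finset.card_biUnion_le _)
          have h2 : ∑ q, ((T q).card : ℝ) ≤ k * (4 * δ * p * Fintype.card V) := by
            refine (Finset.sum_le_sum fun q _ => hTc q).trans (le_of_eq ?_)
            simp
          push_cast
          linarith
        · rw [containers]
          refine Finset.mem_union_right _ (Finset.mem_image.2 ⟨(C, ι, i, T), ?_, rfl⟩)
          simp only [Finset.mem_product, Finset.mem_univ, true_and, Fintype.mem_piFinset,
            Finset.mem_powerset]
          refine ⟨containers_mono_set pt χ τ Finset.subset_union_left ρ hC, fun q => ?_⟩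
          exact (Finset.subset_biUnion_of_mem T (Finset.mem_univ q)).trans Finset.subset_union_right
        · rw [hs1]
          push_cast
          have := hu i i.2
          have : u * Fintype.card V ≤ heavySeq ε η Y i * Fintype.card V := by gcongr
          linarith
        · rw [hs1, mul_add]
          linarith
  obtain ⟨F, C, _, _, _, hCc, _⟩ := hind R le_rfl
  have h1 := hcompl C
  have h2 : (r : ℝ) * Fintype.card V < R * u * Fintype.card V := by gcongr
  nlinarith

end Containers

section GoodSets

variable {V Γ : Type*} [Fintype V] [Fintype Γ] {k : ℕ} {pt : Γ → Fin k → V}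

/-- The initial potential is bounded when the pair counts inside `Z` are under control. -/
lemma potential_zero_le (Z : Finset V) (T : Fin k → Finset V) {δ p M K N : ℝ} (hδ : 0 < δ)
    (hδ1 : δ ≤ 1) (hp : 0 < p) (hN : 0 ≤ N)
    (h1 : ∀ l : Fin k, ((Finset.univ.filter fun x : Γ × Γ => pt x.1 l = pt x.2 l ∧
      pairCover pt (Finset.Iio l) x ⊆ Z).card : ℝ) ≤ K * N * M ^ 2 * p ^ (2 * (l : ℕ)))
    (h2 : ∀ l : Fin k, ((Finset.univ.filter fun x : Γ × Γ => pt x.1 l = pt x.2 l ∧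
      (∃ q ∈ Finset.Iio l, pt x.1 q = pt x.2 q) ∧
      pairCover pt (Finset.Iio l) x ⊆ Z).card : ℝ) ≤
        δ ^ (2 * k) * (N * M ^ 2 * p ^ (2 * (l : ℕ)))) :
    potential pt Z δ p T 0 ≤ k * (K + 1) * N * M ^ 2 := by
  have hl : ∀ l : Fin k, ((δ * p) ^ (2 * (l : ℕ)))⁻¹ *
      ∑ x : Γ × Γ with pt x.1 l = pt x.2 l, ∏ q with q < l, pairWeight pt Z δ T 0 q x ≤
      (K + 1) * N * M ^ 2 := by
    intro l
    have hx : ∀ x : Γ × Γ, ∏ q with q < l, pairWeight pt Z δ T 0 q x ≤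
        δ ^ (2 * (l : ℕ)) * (if pairCover pt (Finset.Iio l) x ⊆ Z then 1 else 0) +
        (if (∃ q ∈ Finset.Iio l, pt x.1 q = pt x.2 q) ∧
          pairCover pt (Finset.Iio l) x ⊆ Z then 1 else 0) := by
      intro x
      have hmem : ∀ q : Fin k, q ∈ Finset.univ.filter (fun q => q < l) ↔ q < l := by simp
      by_cases hcov : pairCover pt (Finset.Iio l) x ⊆ Z
      · have hZ : ∀ q < l, pt x.1 q ∈ Z ∧ pt x.2 q ∈ Z := by
          intro q hq
          have hq' : q ∈ Finset.Iio l := Finset.mem_Iio.2 hq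
          exact ⟨hcov (Finset.mem_union_left _ (Finset.mem_image_of_mem _ hq')),
            hcov (Finset.mem_union_right _ (Finset.mem_image_of_mem _ hq'))⟩
        by_cases hco : ∃ q ∈ Finset.Iio l, pt x.1 q = pt x.2 q
        · rw [if_pos hcov, if_pos ⟨hco, hcov⟩]
          have : ∏ q with q < l, pairWeight pt Z δ T 0 q x ≤ 1 := by
            refine Finset.prod_le_one (fun q _ => pairWeight_nonneg hδ.le _ _ _) fun q _ => ?_
            unfold pairWeight
            rw [if_neg (by omega)]
            split_ifs
            · exact pow_le_one₀ hδ.le hδ1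
            · norm_num
          have : 0 ≤ δ ^ (2 * (l : ℕ)) := by positivity
          linarith
        · rw [if_pos hcov, if_neg (fun h => hco h.1), mul_one, add_zero]
          refine le_of_eq ?_
          rw [Finset.prod_congr rfl (g := fun _ => δ ^ 2)]
          · rw [Finset.prod_const, ← pow_mul]
            congr 2
            have : (Finset.univ.filter fun q : Fin k => q < l) = Finset.Iio l := by
              ext q; simp
            rw [this, Fin.card_Iio]
          · intro q hq
            rw [hmem] at hq
            unfold pairWeight
            rw [if_neg (by omega), if_pos (hZ q hq), Finset.card_pair]
            exact fun h => hco ⟨q, Finset.mem_Iio.2 hq, h⟩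
      · rw [if_neg hcov, if_neg (fun h => hcov h.2), mul_zero, add_zero]
        refine le_of_eq ?_
        obtain ⟨v, hv, hvZ⟩ := Finset.not_subset.1 hcov
        have : ∃ q < l, ¬ (pt x.1 q ∈ Z ∧ pt x.2 q ∈ Z) := by
          simp only [pairCover, Finset.mem_union, Finset.mem_image, Finset.mem_Iio] at hv
          rcases hv with ⟨q, hq, rfl⟩ | ⟨q, hq, rfl⟩
          · exact ⟨q, hq, fun h => hvZ h.1⟩
          · exact ⟨q, hq, fun h => hvZ h.2⟩
        obtain ⟨q, hq, hqZ⟩ := this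
        refine Finset.prod_eq_zero ((hmem q).2 hq) ?_
        unfold pairWeight
        rw [if_neg (by omega), if_neg hqZ]
    have hsum : ∑ x : Γ × Γ with pt x.1 l = pt x.2 l, ∏ q with q < l, pairWeight pt Z δ T 0 q x ≤
        δ ^ (2 * (l : ℕ)) * (K * N * M ^ 2 * p ^ (2 * (l : ℕ))) +
          δ ^ (2 * k) * (N * M ^ 2 * p ^ (2 * (l : ℕ))) := by
      refine (Finset.sum_le_sum fun x _ => hx x).trans ?_
      rw [Finset.sum_add_distrib, ← Finset.mul_sum, Finset.sum_boole, Finset.sum_boole,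
        Finset.filter_filter, Finset.filter_filter]
      exact add_le_add (mul_le_mul_of_nonneg_left (h1 l) (by positivity)) (h2 l)
    have hdk : δ ^ (2 * k) ≤ δ ^ (2 * (l : ℕ)) :=
      pow_le_pow_of_le_one hδ.le hδ1 (by have := l.2; omega)
    rw [inv_mul_le_iff₀ (by positivity)]
    refine hsum.trans ?_
    have : δ ^ (2 * k) * (N * M ^ 2 * p ^ (2 * (l : ℕ))) ≤
        δ ^ (2 * (l : ℕ)) * (N * M ^ 2 * p ^ (2 * (l : ℕ))) := by gcongr
    rw [mul_pow]
    nlinarith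
  unfold potential
  refine (Finset.sum_le_sum fun l _ => hl l).trans ?_
  simp only [Nat.zero_le, Finset.filter_true, Finset.sum_const, Finset.card_univ, Fintype.card_fin,
    nsmul_eq_mul]
  exact le_of_eq (by ring)

/-- Few tuples inside `Z` meet a small set. -/
lemma card_touching_le (Z X : Finset V) {p M K N κ ν : ℝ} (hp : 0 < p) (hM : 0 ≤ M) (hN : 0 ≤ N)
    (hν : 0 ≤ ν) (hκν : κ * K ≤ ν ^ 2)
    (h : ∀ q : Fin k, ((Finset.univ.filter fun x : Γ × Γ => pt x.1 q = pt x.2 q ∧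
      pairCover pt Finset.univ x ⊆ Z).card : ℝ) ≤ K * N * M ^ 2 * p ^ (k + (k - 1)))
    (hX : (X.card : ℝ) ≤ κ * (p * N)) :
    ((Finset.univ.filter fun γ : Γ => (∀ q, pt γ q ∈ Z) ∧ ∃ q, pt γ q ∈ X).card : ℝ) ≤
      k * (ν * N * M * p ^ k) := by
  have hq : ∀ q : Fin k, ((Finset.univ.filter fun γ : Γ =>
      (∀ q, pt γ q ∈ Z) ∧ pt γ q ∈ X).card : ℝ) ≤ ν * N * M * p ^ k := by
    intro q
    set dg : V → Finset Γ := fun u => Finset.univ.filter fun γ : Γ => (∀ q, pt γ q ∈ Z) ∧ pt γ q = u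
      with hdg
    have h1 : (Finset.univ.filter fun γ : Γ => (∀ q, pt γ q ∈ Z) ∧ pt γ q ∈ X).card =
        ∑ u ∈ X, (dg u).card := by
      rw [Finset.card_eq_sum_card_fiberwise (f := fun γ => pt γ q) (t := X)]
      · refine Finset.sum_congr rfl fun u hu => ?_
        congr 1
        ext γ
        simp only [hdg, Finset.mem_filter, Finset.mem_univ, true_and]
        constructor
        · rintro ⟨⟨h1, _⟩, h3⟩; exact ⟨h1, h3⟩
        · rintro ⟨h1, h3⟩; exact ⟨⟨h1, h3 ▸ hu⟩, h3⟩
      · intro γ hγ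
        exact (Finset.mem_filter.1 hγ).2.2
    have h2 : ∑ u ∈ X, ((dg u).card : ℝ) ^ 2 ≤ K * N * M ^ 2 * p ^ (k + (k - 1)) := by
      refine le_trans ?_ (h q)
      have h3 : ∑ u ∈ X, ((dg u).card : ℝ) ^ 2 = ((X.biUnion fun u => dg u ×ˢ dg u).card : ℝ) := by
        rw [Finset.card_biUnion]
        · push_cast
          refine Finset.sum_congr rfl fun u _ => ?_
          rw [Finset.card_product, sq]; push_cast; rfl
        · intro u _ u' _ huu'
          rw [Function.onFun, Finset.disjoint_left]
          intro y hy hy'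
          simp only [Finset.mem_product, hdg, Finset.mem_filter] at hy hy'
          exact huu' (hy.1.2.2.symm.trans hy'.1.2.2)
      rw [h3]
      refine Nat.cast_le.2 (Finset.card_le_card fun y hy => ?_)
      simp only [Finset.mem_biUnion, Finset.mem_product, hdg, Finset.mem_filter, Finset.mem_univ,
        true_and] at hy ⊢
      obtain ⟨u, _, h4, h5⟩ := hy
      refine ⟨h4.2.trans h5.2.symm, ?_⟩
      intro v hv
      simp only [pairCover, Finset.mem_union, Finset.mem_image, Finset.mem_univ, true_and] at hv
      rcases hv with ⟨q, rfl⟩ | ⟨q, rfl⟩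
      exacts [h4.1 q, h5.1 q]
    have h3 : (∑ u ∈ X, ((dg u).card : ℝ)) ^ 2 ≤ X.card * ∑ u ∈ X, ((dg u).card : ℝ) ^ 2 := by
      have := Finset.sum_mul_sq_le_sq_mul_sq X (fun _ => (1 : ℝ)) (fun u => ((dg u).card : ℝ))
      simpa using this
    rw [h1]
    push_cast
    refine abs_le_of_sq_le_sq' (h3.trans ?_) (by positivity) |>.2
    have hκ : 0 ≤ κ * (p * N) := (Nat.cast_nonneg _).trans hX
    have hpk : p * p ^ (k + (k - 1)) = (p ^ k) ^ 2 := by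
      rw [← pow_succ', ← pow_mul]
      congr 1
      have := q.pos
      omega
    calc _ ≤ κ * (p * N) * (K * N * M ^ 2 * p ^ (k + (k - 1))) :=
          mul_le_mul hX h2 (Finset.sum_nonneg fun u _ => sq_nonneg _) hκ
      _ = κ * K * (N * M) ^ 2 * (p * p ^ (k + (k - 1))) := by ring
      _ ≤ ν ^ 2 * (N * M) ^ 2 * (p * p ^ (k + (k - 1))) := by gcongr
      _ = _ := by rw [hpk]; ring
  calc _ ≤ ((Finset.univ.biUnion fun q => Finset.univ.filter fun γ : Γ =>
        (∀ q, pt γ q ∈ Z) ∧ pt γ q ∈ X).card : ℝ) := by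
        refine Nat.cast_le.2 (Finset.card_le_card fun γ hγ => ?_)
        simp only [Finset.mem_filter, Finset.mem_univ, true_and, Finset.mem_biUnion] at hγ ⊢
        obtain ⟨h1, q, h2⟩ := hγ
        exact ⟨q, h1, h2⟩
    _ ≤ ∑ q : Fin k, ((Finset.univ.filter fun γ : Γ =>
        (∀ q, pt γ q ∈ Z) ∧ pt γ q ∈ X).card : ℝ) := by exact_mod_cast Finset.card_biUnion_le
    _ ≤ _ := by
        refine (Finset.sum_le_sum fun q _ => hq q).trans (le_of_eq ?_)
        simp

end GoodSets

section Deletion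

variable {V B : Type*} [Fintype V]

/-- The number of sequences of `m` pairwise disjoint members of the family `W` of sets that avoid
`X` and, together with `X`, lie in `Z`. -/
noncomputable def disjointSeqCount (S : B → Finset V) (W : Finset B) :
    ℕ → Finset V → Finset V → ℝ
  | 0, X, Z => if X ⊆ Z then 1 else 0
  | m + 1, X, Z => ∑ b ∈ W with Disjoint (S b) X, disjointSeqCount S W m (X ∪ S b) Z

lemma disjointSeqCount_nonneg (S : B → Finset V) (W : Finset B) (m : ℕ) (X Z : Finset V) :
    0 ≤ disjointSeqCount S W m X Z := by
  induction m generalizing X with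
  | zero => unfold disjointSeqCount; split_ifs <;> norm_num
  | succ m ih => unfold disjointSeqCount; exact Finset.sum_nonneg fun b _ => ih _

lemma binomExp_disjointSeqCount_le (S : B → Finset V) (W : Finset B) {k : ℕ}
    (hS : ∀ b, (S b).card = k) {p : ℝ} (hp : 0 ≤ p) (m : ℕ) (X : Finset V) :
    binomExp p (disjointSeqCount S W m X) ≤ p ^ X.card * (W.card * p ^ k) ^ m := by
  induction m generalizing X with
  | zero => simp only [disjointSeqCount, binomExp_subset]; simp
  | succ m ih =>
    have : disjointSeqCount S W (m + 1) X = fun Z => ∑ b ∈ W with Disjoint (S b) X,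
        disjointSeqCount S W m (X ∪ S b) Z := by
      funext Z; rw [disjointSeqCount]
    rw [this, binomExp_sum]
    calc _ ≤ ∑ b ∈ W with Disjoint (S b) X, p ^ (X.card + k) * (W.card * p ^ k) ^ m := by
          refine Finset.sum_le_sum fun b hb => ?_
          have := ih (X ∪ S b)
          rwa [Finset.card_union_of_disjoint (Finset.mem_filter.1 hb).2.symm, hS] at this
      _ ≤ W.card * (p ^ (X.card + k) * (W.card * p ^ k) ^ m) := by
          rw [Finset.sum_const, nsmul_eq_mul]
          have : (W.filter fun b => Disjoint (S b) X).card ≤ W.card := Finset.card_filter_le _ _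
          gcongr
      _ = _ := by rw [pow_add, pow_succ]; ring

lemma pow_le_disjointSeqCount (S : B → Finset V) (W : Finset B) {k : ℕ}
    (hS : ∀ b, (S b).card = k) {D : ℝ} (hD : 0 ≤ D) {Z : Finset V} (m s : ℕ) (X : Finset V)
    (hXZ : X ⊆ Z) (hXs : X.card + m * k ≤ s)
    (h : ∀ X', X ⊆ X' → X'.card ≤ s →
      D ≤ (W.filter fun b => S b ⊆ Z ∧ Disjoint (S b) X').card) :
    D ^ m ≤ disjointSeqCount S W m X Z := by
  induction m generalizing X with
  | zero => simp [disjointSeqCount, hXZ]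
  | succ m ih =>
    rw [disjointSeqCount]
    have h1 : ∀ b ∈ W.filter (fun b => S b ⊆ Z ∧ Disjoint (S b) X),
        D ^ m ≤ disjointSeqCount S W m (X ∪ S b) Z := by
      intro b hb
      obtain ⟨_, hbZ, hbX⟩ := Finset.mem_filter.1 hb
      refine ih _ (Finset.union_subset hXZ hbZ) ?_ fun X' hX' =>
        h X' (Finset.subset_union_left.trans hX')
      rw [Finset.card_union_of_disjoint hbX.symm, hS]
      linarith
    calc D ^ (m + 1) = D * D ^ m := pow_succ' _ _
      _ ≤ (W.filter fun b => S b ⊆ Z ∧ Disjoint (S b) X).card * D ^ m := by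
          gcongr
          exact h X subset_rfl (by omega)
      _ ≤ ∑ b ∈ W.filter (fun b => S b ⊆ Z ∧ Disjoint (S b) X),
          disjointSeqCount S W m (X ∪ S b) Z := by
          rw [← nsmul_eq_mul]; exact Finset.card_nsmul_le_sum _ _ _ h1
      _ ≤ _ := by
          refine Finset.sum_le_sum_of_subset_of_nonneg ?_
            fun b _ _ => disjointSeqCount_nonneg S W m _ Z
          intro b hb
          simp only [Finset.mem_filter] at hb ⊢
          exact ⟨hb.1, hb.2.2⟩

/-- The random set `Z` contains `F` and at least `D` members of `W` avoiding any given superset of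
`F` of at most `s` elements. -/
def RobustlyMany (S : B → Finset V) (W : Finset B) (D : ℝ) (s : ℕ) (F Z : Finset V) : Prop :=
  F ⊆ Z ∧ ∀ X, F ⊆ X → X.card ≤ s →
    D ≤ (W.filter fun b => S b ⊆ Z ∧ Disjoint (S b) X).card

/-- It is exponentially unlikely that the number of members of `W` inside a random set stays at
twice its expectation after deleting any small set. -/
lemma prob_robustly_many_le (S : B → Finset V) (W : Finset B) {k : ℕ}
    (hS : ∀ b, (S b).card = k) {p D : ℝ} (hp : 0 ≤ p) (hp1 : p ≤ 1) (hD : 0 < D)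
    (hWD : 2 * (W.card * p ^ k) ≤ D) (F : Finset V) (m : ℕ) :
    binomExp p (fun Z => if RobustlyMany S W D (F.card + m * k) F Z then 1 else 0) ≤
      p ^ F.card * (1 / 2) ^ m := by
  refine (binomExp_markov (a := D ^ m) (f := disjointSeqCount S W m F) hp hp1
    (disjointSeqCount_nonneg S W m F) (by positivity)
    fun Z hZ => pow_le_disjointSeqCount S W hS hD.le m _ F hZ.1 le_rfl hZ.2).trans ?_
  rw [div_le_iff₀ (by positivity)]
  refine (binomExp_disjointSeqCount_le S W hS hp m F).trans ?_
  rw [mul_assoc, ← mul_pow]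
  exact mul_le_mul_of_nonneg_left (pow_le_pow_left₀ (by positivity) (by linarith) _)
    (by positivity)

/-- The sum of `p ^ |F|` over small sets `F`. -/
lemma sum_pow_card_le {p x : ℝ} (hp : 0 ≤ p) (hx : 0 < x) (hx1 : x ≤ 1) (t : ℕ) :
    ∑ F : Finset V with F.card ≤ t, p ^ F.card ≤
      (x⁻¹) ^ t * Real.exp (p * x * Fintype.card V) := by
  have hx' : 1 ≤ x⁻¹ := (one_le_inv₀ hx).2 hx1
  have h1 : ∑ F : Finset V with F.card ≤ t, p ^ F.card ≤
      ∑ F : Finset V, (x⁻¹) ^ t * (p * x) ^ F.card := by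
    rw [Finset.sum_filter]
    refine Finset.sum_le_sum fun F _ => ?_
    split_ifs with hF
    · have h2 : (x⁻¹) ^ F.card ≤ (x⁻¹) ^ t := pow_le_pow_right₀ hx' hF
      calc p ^ F.card = (x⁻¹) ^ F.card * (p * x) ^ F.card := by
            rw [← mul_pow]; congr 1; field_simp
        _ ≤ _ := by gcongr
    · positivity
  refine h1.trans ?_
  rw [← Finset.mul_sum]
  refine mul_le_mul_of_nonneg_left ?_ (by positivity)
  have h3 := Finset.sum_pow_mul_eq_add_pow (p * x) 1 (Finset.univ : Finset V)
  simp only [one_pow, mul_one, Finset.powerset_univ, Finset.card_univ] at h3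
  rw [h3, mul_comm _ (Fintype.card V : ℝ), Real.exp_nat_mul]
  exact pow_le_pow_left₀ (by positivity) (Real.add_one_le_exp _) _

end Deletion

section ColourCounts

variable {V Γ : Type*} [Fintype V] [Fintype Γ] {k r : ℕ}

/-- The number of pairs of a colour pattern and a tuple that respects the colour classes `C`
under this pattern. -/
noncomputable def classCount (pt : Γ → Fin k → V) (χ : Fin r → Fin k → Fin r)
    (C : Fin r → Finset V) : ℕ :=
  ∑ ι, (inClass pt (χ ι) C).card

/-- The pairs counted by `classCount`. -/
noncomputable def classPairs (pt : Γ → Fin k → V) (χ : Fin r → Fin k → Fin r)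
    (C : Fin r → Finset V) : Finset (Fin r × Γ) :=
  Finset.univ.filter fun b => b.2 ∈ inClass pt (χ b.1) C

lemma card_classPairs (pt : Γ → Fin k → V) (χ : Fin r → Fin k → Fin r) (C : Fin r → Finset V) :
    (classPairs pt χ C).card = classCount pt χ C := by
  unfold classCount classPairs
  rw [Finset.card_eq_sum_card_fiberwise (f := Prod.fst) (t := Finset.univ) (by simp)]
  refine Finset.sum_congr rfl fun ι _ => ?_
  refine Finset.card_bij' (fun b _ => b.2) (fun γ _ => (ι, γ)) ?_ ?_ ?_ ?_
  · rintro ⟨i, γ⟩ h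
    simp only [Finset.mem_filter, Finset.mem_univ, true_and] at h
    exact h.2 ▸ h.1
  · intro γ h
    simpa using h
  · rintro ⟨i, γ⟩ h
    simp only [Finset.mem_filter, Finset.mem_univ, true_and] at h
    simp [h.2]
  · intro γ h
    rfl

/-- The vertices of colour `j` in the partial colouring `ψ`. -/
noncomputable def colourClass (ψ : V → Option (Fin r)) (j : Fin r) : Finset V :=
  Finset.univ.filter fun v => ψ v = some j

/-- If tuples in `Z` are spread out, and tuples respecting `C` are not robustly frequent in `Z`,
then few tuples respect a family of subsets of `Z` that is almost contained in `C`. -/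
lemma classCount_lt_of_not_robustlyMany (pt : Γ → Fin k → V) (χ : Fin r → Fin k → Fin r)
    (I C : Fin r → Finset V) (F Z : Finset V) {p M K N κ ν D : ℝ} {s : ℕ} (hp : 0 < p)
    (hM : 0 ≤ M) (hN : 0 ≤ N) (hK : 0 ≤ K) (hν : 0 ≤ ν) (hκν : κ * K ≤ ν ^ 2)
    (h : ∀ q : Fin k, ((Finset.univ.filter fun x : Γ × Γ => pt x.1 q = pt x.2 q ∧
      pairCover pt Finset.univ x ⊆ Z).card : ℝ) ≤ K * N * M ^ 2 * p ^ (k + (k - 1)))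
    (hI : ∀ j, I j ⊆ Z) (hF : F ⊆ Z)
    (hrob : ¬ RobustlyMany (fun b : Fin r × Γ => Finset.univ.image (pt b.2)) (classPairs pt χ C)
      D s F Z)
    (hs : (s : ℝ) + ∑ j, ((I j \ C j).card : ℝ) ≤ κ * (p * N)) :
    (classCount pt χ I : ℝ) < D + r * (k * (ν * N * M * p ^ k)) := by
  simp only [RobustlyMany, not_and, not_forall, not_le] at hrob
  obtain ⟨X', -, hX's, hlt⟩ := hrob hF
  set X : Finset V := X' ∪ Finset.univ.biUnion fun j => I j \ C j with hXdef
  have hXcard : (X.card : ℝ) ≤ κ * (p * N) := by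
    refine le_trans ?_ hs
    have h1 : X.card ≤ s + ∑ j, (I j \ C j).card :=
      (Finset.card_union_le _ _).trans (add_le_add hX's Finset.card_biUnion_le)
    exact_mod_cast h1
  have ht := card_touching_le (pt := pt) Z X hp hM hN hν hκν h hXcard
  set U := Finset.univ.filter fun γ : Γ => (∀ q, pt γ q ∈ Z) ∧ ∃ q, pt γ q ∈ X with hU
  set W := (classPairs pt χ C).filter fun b : Fin r × Γ =>
    Finset.univ.image (pt b.2) ⊆ Z ∧ Disjoint (Finset.univ.image (pt b.2)) X' with hW
  have hsub : classPairs pt χ I ⊆ W ∪ Finset.univ ×ˢ U := by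
    rintro ⟨ι, γ⟩ hb
    simp only [classPairs, inClass, Finset.mem_filter, Finset.mem_univ, true_and] at hb
    have hZ : ∀ q, pt γ q ∈ Z := fun q => hI _ (hb q)
    by_cases hX : ∃ q, pt γ q ∈ X
    · exact Finset.mem_union_right _ (by simp [hU, hZ, hX])
    · refine Finset.mem_union_left _ ?_
      push Not at hX
      simp only [hW, classPairs, inClass, Finset.mem_filter, Finset.mem_univ, true_and]
      refine ⟨fun q => ?_, ?_, ?_⟩
      · by_contra hq
        refine hX q (Finset.mem_union_right _ (Finset.mem_biUnion.2 ⟨χ ι q, Finset.mem_univ _, ?_⟩))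
        exact Finset.mem_sdiff.2 ⟨hb q, hq⟩
      · intro v hv
        obtain ⟨q, -, rfl⟩ := Finset.mem_image.1 hv
        exact hZ q
      · rw [Finset.disjoint_left]
        intro v hv hv'
        obtain ⟨q, -, rfl⟩ := Finset.mem_image.1 hv
        exact hX q (Finset.mem_union_left _ hv')
  have hcard : classCount pt χ I ≤ W.card + r * U.card := by
    rw [← card_classPairs]
    refine (Finset.card_le_card hsub).trans ((Finset.card_union_le _ _).trans ?_)
    simp
  have hcard' : (classCount pt χ I : ℝ) ≤ W.card + r * U.card := by exact_mod_cast hcard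
  have : (r : ℝ) * U.card ≤ r * (k * (ν * N * M * p ^ k)) :=
    mul_le_mul_of_nonneg_left ht (Nat.cast_nonneg r)
  linarith

end ColourCounts

section Decay

/-- Exponential decay beats the number of small fingerprints and containers. -/
lemma exists_fingerprint_union_bound {A d : ℝ} (hA : 0 ≤ A) (hd : 0 < d) (k R : ℕ) :
    ∃ a₀ : ℝ, 0 < a₀ ∧ ∃ x : ℝ, 0 < x ∧ x ≤ 1 ∧ ∀ ϵ : ℝ, 0 < ϵ → ∃ n₀ : ℝ, ∀ y : ℝ, n₀ ≤ y →
      ∀ a : ℝ, a ≤ a₀ → ∀ t m : ℕ, (t : ℝ) ≤ a * y → d * y - 1 ≤ m →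
        (1 + A * 2 ^ (k * t)) ^ R * (x⁻¹ ^ t * Real.exp (x * y)) * (1 / 2) ^ m ≤ ϵ := by
  set x : ℝ := min 1 (d / 8) with hx
  have hx0 : 0 < x := by positivity
  have hx1 : x ≤ 1 := min_le_left _ _
  have hxd : x ≤ d / 8 := min_le_right _ _
  have hlog2 : (1 : ℝ) / 2 < Real.log 2 := by linarith [Real.log_two_gt_d9]
  set L : ℝ := Real.log x⁻¹ + k * R * Real.log 2 + 1 with hL
  have hlx : 0 ≤ Real.log x⁻¹ := Real.log_nonneg ((one_le_inv₀ hx0).2 hx1)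
  have hL0 : 0 < L := by positivity
  refine ⟨d / (8 * L), by positivity, x, hx0, hx1, fun ϵ hϵ => ?_⟩
  set B : ℝ := 2 * (1 + A) ^ R with hB
  have hB0 : 0 < B := by positivity
  refine ⟨max 0 ((4 / d) * Real.log (B / ϵ)), fun y hy a ha t m ht hm => ?_⟩
  have hy0 : 0 ≤ y := (le_max_left _ _).trans hy
  have hyB : (4 / d) * Real.log (B / ϵ) ≤ y := (le_max_right _ _).trans hy
  have htL : t * L ≤ d / 8 * y := by
    have : (t : ℝ) ≤ d / (8 * L) * y := ht.trans (mul_le_mul_of_nonneg_right ha hy0)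
    calc t * L ≤ d / (8 * L) * y * L := mul_le_mul_of_nonneg_right this hL0.le
      _ = d / 8 * y := by field_simp
  have h1 : (1 + A * 2 ^ (k * t)) ^ R ≤ (1 + A) ^ R * Real.exp (t * (k * R * Real.log 2)) := by
    have h2 : (2 : ℝ) ^ (k * t) = Real.exp ((k * t : ℕ) * Real.log 2) := by
      rw [Real.exp_nat_mul, Real.exp_log (by norm_num)]
    have h3 : (1 : ℝ) ≤ 2 ^ (k * t) := one_le_pow₀ (by norm_num)
    have h4 : 1 + A * 2 ^ (k * t) ≤ (1 + A) * 2 ^ (k * t) := by nlinarith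
    refine (pow_le_pow_left₀ (by positivity) h4 R).trans (le_of_eq ?_)
    rw [mul_pow, h2, ← Real.exp_nat_mul]
    congr 2
    push_cast
    ring
  have h2 : x⁻¹ ^ t = Real.exp (t * Real.log x⁻¹) := by
    rw [Real.exp_nat_mul, Real.exp_log (by positivity)]
  have h3 : ((1 : ℝ) / 2) ^ m ≤ 2 * Real.exp (-(d * y * Real.log 2)) := by
    have h4 : ((1 : ℝ) / 2) ^ m = Real.exp (-(m * Real.log 2)) := by
      rw [← mul_neg, ← Real.log_inv, Real.exp_nat_mul, Real.exp_log (by norm_num)]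
      norm_num
    have h5 : (2 : ℝ) * Real.exp (-(d * y * Real.log 2)) =
        Real.exp (-((d * y - 1) * Real.log 2)) := by
      rw [show -((d * y - 1) * Real.log 2) = Real.log 2 + -(d * y * Real.log 2) by ring,
        Real.exp_add, Real.exp_log (by norm_num)]
    rw [h4, h5, Real.exp_le_exp]
    have := mul_le_mul_of_nonneg_right hm (by linarith : 0 ≤ Real.log 2)
    linarith
  calc (1 + A * 2 ^ (k * t)) ^ R * (x⁻¹ ^ t * Real.exp (x * y)) * (1 / 2) ^ m
      ≤ ((1 + A) ^ R * Real.exp (t * (k * R * Real.log 2))) *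
        (Real.exp (t * Real.log x⁻¹) * Real.exp (x * y)) *
        (2 * Real.exp (-(d * y * Real.log 2))) := by
          rw [h2]
          gcongr
    _ = B * Real.exp (t * (k * R * Real.log 2) + (t * Real.log x⁻¹ + x * y) +
          -(d * y * Real.log 2)) := by
          rw [Real.exp_add, Real.exp_add, Real.exp_add, hB]
          ring
    _ ≤ B * Real.exp (-(d / 4 * y)) := by
          gcongr
          have e1 : t * (k * R * Real.log 2) + t * Real.log x⁻¹ ≤ t * L := by
            rw [hL]
            have : (0 : ℝ) ≤ t := Nat.cast_nonneg t
            nlinarith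
          have e2 : x * y ≤ d / 8 * y := mul_le_mul_of_nonneg_right hxd hy0
          have e3 : d * y * (1 / 2) ≤ d * y * Real.log 2 :=
            mul_le_mul_of_nonneg_left hlog2.le (by positivity)
          nlinarith
    _ ≤ ϵ := by
          rw [Real.exp_neg, ← div_eq_mul_inv, div_le_iff₀ (Real.exp_pos _), mul_comm,
            ← div_le_iff₀ hϵ]
          rw [← Real.log_le_iff_le_exp (by positivity)]
          have := mul_le_mul_of_nonneg_left hyB (by positivity : 0 ≤ d / 4)
          calc Real.log (B / ϵ) = d / 4 * (4 / d * Real.log (B / ϵ)) := by field_simp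
            _ ≤ _ := this

end Decay

section Transference

variable {V Γ : Type*} [Fintype V] [Fintype Γ] {k r : ℕ}

/-- The event that the tuples respecting one of the listed containers of the fingerprint `y.1`
are robustly frequent in a random set. -/
def BadContainer (pt : Γ → Fin k → V) (χ : Fin r → Fin k → Fin r)
    (cont : Finset V → Finset (Fin r → Finset V)) (t m : ℕ) (B D : ℝ)
    (y : Finset V × (Fin r → Finset V)) (Z : Finset V) : Prop :=
  (y.1.card ≤ t ∧ y.2 ∈ cont y.1 ∧ (classCount pt χ y.2 : ℝ) ≤ B) ∧
    RobustlyMany (fun b : Fin r × Γ => Finset.univ.image (pt b.2)) (classPairs pt χ y.2)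
      D (y.1.card + m * k) y.1 Z

lemma sum_badContainer_le (pt : Γ → Fin k → V) (hinj : ∀ γ, Function.Injective (pt γ))
    (χ : Fin r → Fin k → Fin r) (cont : Finset V → Finset (Fin r → Finset V)) (t m : ℕ)
    {p x B D A : ℝ} (hp : 0 ≤ p) (hp1 : p ≤ 1) (hx : 0 < x) (hx1 : x ≤ 1) (hD : 0 < D)
    (hBD : 2 * (B * p ^ k) ≤ D) (hA : ∀ F : Finset V, F.card ≤ t → ((cont F).card : ℝ) ≤ A)
    (hA0 : 0 ≤ A) :
    ∑ y : Finset V × (Fin r → Finset V),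
      binomExp p (fun Z => if BadContainer pt χ cont t m B D y Z then 1 else 0) ≤
      A * (x⁻¹ ^ t * Real.exp (x * (p * Fintype.card V))) * (1 / 2) ^ m := by
  have hterm : ∀ y : Finset V × (Fin r → Finset V),
      binomExp p (fun Z => if BadContainer pt χ cont t m B D y Z then 1 else 0) ≤
      if y.1.card ≤ t then (if y.2 ∈ cont y.1 then p ^ y.1.card * (1 / 2) ^ m else 0) else 0 := by
    rintro ⟨F, C⟩
    by_cases hy : F.card ≤ t ∧ C ∈ cont F ∧ (classCount pt χ C : ℝ) ≤ B
    · rw [if_pos hy.1, if_pos hy.2.1]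
      refine (binomExp_mono hp hp1 fun Z => ?_).trans (prob_robustly_many_le
        (fun b : Fin r × Γ => Finset.univ.image (pt b.2)) (classPairs pt χ C) (k := k)
        (fun b => ?_) hp hp1 hD ?_ F m)
      · by_cases hr : RobustlyMany (fun b : Fin r × Γ => Finset.univ.image (pt b.2))
            (classPairs pt χ C) D (F.card + m * k) F Z
        · rw [if_pos hr]
          split_ifs <;> norm_num
        · rw [if_neg hr, if_neg fun h => hr h.2]
      · rw [Finset.card_image_of_injective _ (hinj b.2)]
        simp
      · rw [card_classPairs]
        refine le_trans ?_ hBD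
        gcongr
        exact hy.2.2
    · have : (fun Z => if BadContainer pt χ cont t m B D (F, C) Z then (1 : ℝ) else 0) =
          fun _ => 0 := by
        funext Z
        rw [if_neg fun h => hy h.1]
      rw [this, binomExp_const]
      split_ifs <;> positivity
  refine (Finset.sum_le_sum fun y _ => hterm y).trans ?_
  rw [Fintype.sum_prod_type]
  have hF : ∀ F : Finset V, (∑ C : Fin r → Finset V,
      if F.card ≤ t then (if C ∈ cont F then p ^ F.card * (1 / 2) ^ m else 0) else 0) ≤
      A * (1 / 2) ^ m * if F.card ≤ t then p ^ F.card else 0 := by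
    intro F
    split_ifs with hFt
    · rw [← Finset.sum_filter, Finset.sum_const, nsmul_eq_mul]
      rw [Finset.filter_mem_eq_inter, Finset.univ_inter]
      calc _ ≤ A * (p ^ F.card * (1 / 2) ^ m) :=
            mul_le_mul_of_nonneg_right (hA F hFt) (by positivity)
        _ = _ := by ring
    · simp
  refine (Finset.sum_le_sum fun F _ => hF F).trans ?_
  rw [← Finset.mul_sum, ← Finset.sum_filter]
  calc _ ≤ A * (1 / 2) ^ m * (x⁻¹ ^ t * Real.exp (p * x * Fintype.card V)) :=
        mul_le_mul_of_nonneg_left (sum_pow_card_le hp hx hx1 t) (by positivity)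
    _ = _ := by
        rw [show p * x * (Fintype.card V : ℝ) = x * (p * Fintype.card V) by ring]
        ring

end Transference

/-- Transference of a supersaturation implication between two families of tuples from the full
vertex set to a binomial random subset. -/
theorem transference {r ks kc : ℕ} (hr : 0 < r) (hks : 0 < ks) (hkc : 0 < kc) {K βs γ : ℝ}
    (hK : 0 < K) (hβs : 0 < βs) (hγ : 0 < γ) :
    ∃ βc : ℝ, 0 < βc ∧ ∀ ϵ : ℝ, 0 < ϵ → ∃ θ : ℝ, 0 < θ ∧ ∃ n₀ : ℝ,
      ∀ (V Γs Γc : Type) [Fintype V] [Fintype Γs] [Fintype Γc]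
        (pts : Γs → Fin ks → V) (ptc : Γc → Fin kc → V)
        (χs : Fin r → Fin ks → Fin r) (χc : Fin r → Fin kc → Fin r) (p Ms Mc : ℝ),
        (∀ g, Function.Injective (pts g)) → (∀ g, Function.Injective (ptc g)) →
        0 < p → p ≤ 1 → 0 < Ms → 0 < Mc → 0 < Fintype.card V → n₀ ≤ p * Fintype.card V →
        PinBound pts p Ms K 1 → PinBound ptc p Mc K 1 → PinBound ptc p Mc θ 2 →
        (∀ C : Fin r → Finset V, (classCount ptc χc C : ℝ) < γ * Fintype.card V * Mc →
          (classCount pts χs C : ℝ) ≤ βs / 4 * Fintype.card V * Ms) →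
        1 - ϵ ≤ probSub Finset.univ p (fun Z => ∀ ψ : V → Option (Fin r),
          (∀ v, ψ v ≠ none → v ∈ Z) →
          βs * p ^ ks * Fintype.card V * Ms ≤ classCount pts χs (colourClass ψ) →
          βc * p ^ kc * Fintype.card V * Mc ≤ classCount ptc χc (colourClass ψ)) := by
  have hr' : (0 : ℝ) < r := by exact_mod_cast hr
  have hks' : (0 : ℝ) < ks := by exact_mod_cast hks
  have hkc' : (0 : ℝ) < kc := by exact_mod_cast hkc
  have hPs := pairConst_pos ks hK
  have hPc := pairConst_pos kc hK
  set ν : ℝ := βs / (4 * r * ks) with hν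
  have hν0 : 0 < ν := by positivity
  set κ : ℝ := min 1 (ν ^ 2 / (2 * pairConst ks K)) with hκ
  have hκ0 : 0 < κ := by positivity
  have hκν : κ * (2 * pairConst ks K) ≤ ν ^ 2 := by
    rw [← le_div_iff₀ (by positivity)]
    exact min_le_right _ _
  set ε : ℝ := γ / r with hε
  have hε0 : 0 < ε := by positivity
  set η : ℝ := κ / (3 * r) with hη
  have hη0 : 0 < η := by positivity
  have hη1 : η ≤ 1 := by
    have h1 : (1 : ℝ) ≤ r := by exact_mod_cast hr
    rw [hη, div_le_one (by positivity)]
    linarith [min_le_left 1 (ν ^ 2 / (2 * pairConst ks K))]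
  set Y : ℝ := kc * (2 * pairConst kc K + 1) with hY
  have hY0 : 0 < Y := by positivity
  obtain ⟨u, hu0, hu⟩ : ∃ u : ℝ, 0 < u ∧ ∀ i < kc, u ≤ heavySeq ε η Y i := by
    have hne : (Finset.range kc).Nonempty := ⟨0, by simpa using hkc⟩
    refine ⟨(Finset.range kc).inf' hne (heavySeq ε η Y), ?_, fun i hi =>
      Finset.inf'_le _ (by simpa using hi)⟩
    rw [Finset.lt_inf'_iff]
    exact fun i _ => heavySeq_pos hε0 hη0 hY0 i
  obtain ⟨R, hR⟩ := exists_nat_gt (r / u)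
  rw [div_lt_iff₀ hu0] at hR
  have hR0 : (0 : ℝ) < R := by
    by_contra h
    have : (R : ℝ) * u ≤ 0 := mul_nonpos_of_nonpos_of_nonneg (not_lt.1 h) hu0.le
    linarith
  obtain ⟨a₀, ha₀, x, hx0, hx1, hdecay⟩ := exists_fingerprint_union_bound (A := r * kc)
    (d := κ / 3 / ks) (by positivity) (by positivity) kc R
  set δ : ℝ := min 1 (min a₀ (κ / 3) / (4 * R * kc)) with hδ
  have hδ0 : 0 < δ := by positivity
  have hδ1 : δ ≤ 1 := min_le_left _ _
  have hδa : R * (kc * (4 * δ)) ≤ min a₀ (κ / 3) := by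
    have : δ ≤ min a₀ (κ / 3) / (4 * R * kc) := min_le_right _ _
    rw [le_div_iff₀ (by positivity)] at this
    linarith
  have hlam := lamSeq_pos hε0 hη0 hY0 kc
  refine ⟨lamSeq ε η Y kc * δ ^ kc, by positivity, fun ϵ hϵ => ?_⟩
  obtain ⟨n₁, hn₁⟩ := hdecay (ϵ / 4) (by positivity)
  set Θ : ℝ := kc * (kc * (kc + 1) ^ kc * K) / δ ^ (2 * kc) with hΘ
  have hΘ0 : 0 < Θ := by positivity
  refine ⟨ϵ / 4 / Θ, by positivity, max n₁ (max 1 (max (16 / (δ * η * u))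
    (4 * (kc + ks) / ϵ))), ?_⟩
  intro V Γs Γc _ _ _ pts ptc χs χc p Ms Mc hinjs hinjc hp hp1 hMs hMc hV hn hPins hPinc hPinθ
    hdense
  set N : ℝ := (Fintype.card V : ℝ) with hN
  have hN0 : 0 < N := by rw [hN]; exact_mod_cast hV
  simp only [max_le_iff] at hn
  obtain ⟨hnn₁, hn1, hn16, hnϵ⟩ := hn
  have hpN : 0 < p * N := by positivity
  set t : ℕ := ⌊R * (kc * (4 * δ)) * (p * N)⌋₊ with ht
  set m : ℕ := ⌊κ / 3 / ks * (p * N)⌋₊ with hm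
  have htle : (t : ℝ) ≤ R * (kc * (4 * δ)) * (p * N) := Nat.floor_le (by positivity)
  have hmle : (m : ℝ) ≤ κ / 3 / ks * (p * N) := Nat.floor_le (by positivity)
  have hmge : κ / 3 / ks * (p * N) - 1 ≤ m := by
    linarith [Nat.lt_floor_add_one (κ / 3 / ks * (p * N))]
  set cont : Finset V → Finset (Fin r → Finset V) := fun F =>
    containers ptc χc (fun i => lamSeq ε η Y i / 2 * (δ * p) ^ i * Mc) F R with hcont
  set D : ℝ := 2 * (βs / 4 * N * Ms * p ^ ks) with hD
  have hD0 : 0 < D := by positivity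
  -- the exceptional events
  set Q : (Fin kc ⊕ Fin kc) ⊕ (Fin ks ⊕ (Finset V × (Fin r → Finset V))) → Finset V → Prop :=
    fun i Z => match i with
    | .inl (.inl l) => 2 * (pairConst kc K * N * Mc ^ 2 *
          p ^ ((Finset.Iio l).card + ((insert l (Finset.Iio l)).card - 1))) <
        ((Finset.univ.filter fun x : Γc × Γc => ptc x.1 l = ptc x.2 l ∧
          pairCover ptc (Finset.Iio l) x ⊆ Z).card : ℝ)
    | .inl (.inr l) => δ ^ (2 * kc) * (N * Mc ^ 2 * p ^ (2 * (Finset.Iio l).card)) <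
        ((Finset.univ.filter fun x : Γc × Γc => ptc x.1 l = ptc x.2 l ∧
          (∃ q ∈ Finset.Iio l, ptc x.1 q = ptc x.2 q) ∧
          pairCover ptc (Finset.Iio l) x ⊆ Z).card : ℝ)
    | .inr (.inl q) => 2 * (pairConst ks K * N * Ms ^ 2 *
          p ^ ((Finset.univ : Finset (Fin ks)).card +
            ((insert q (Finset.univ : Finset (Fin ks))).card - 1))) <
        ((Finset.univ.filter fun x : Γs × Γs => pts x.1 q = pts x.2 q ∧
          pairCover pts Finset.univ x ⊆ Z).card : ℝ)
    | .inr (.inr y) => BadContainer pts χs cont t m (βs / 4 * N * Ms) D y Z with hQ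
  have hprob : ∑ i, binomExp p (fun Z => if Q i Z then 1 else 0) ≤ ϵ := by
    rw [Fintype.sum_sum_type, Fintype.sum_sum_type, Fintype.sum_sum_type]
    have h1 : ∑ l : Fin kc, binomExp p (fun Z => if Q (.inl (.inl l)) Z then 1 else 0) ≤
        ∑ _l : Fin kc, 1 / (p * N) := Finset.sum_le_sum fun l _ => by
      convert hPinc.pair_concentration hinjc hp hp1 hMc hK hV (Finset.Iio l) l l Iff.rfl
    have h2 : ∑ l : Fin kc, binomExp p (fun Z => if Q (.inl (.inr l)) Z then 1 else 0) ≤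
        ∑ _l : Fin kc, kc * (kc + 1) ^ kc * K * (ϵ / 4 / Θ) / δ ^ (2 * kc) :=
      Finset.sum_le_sum fun l _ => by
        convert hPinc.clustered_pair_prob_le hinjc hp hp1 hMc hK hV (by positivity) hPinθ
          (Finset.Iio l) l (by simp)
          (show (0 : ℝ) < δ ^ (2 * kc) by positivity)
    have h3 : ∑ l : Fin ks, binomExp p (fun Z => if Q (.inr (.inl l)) Z then 1 else 0) ≤
        ∑ _l : Fin ks, 1 / (p * N) := Finset.sum_le_sum fun l _ => by
      convert hPins.pair_concentration hinjs hp hp1 hMs hK hV Finset.univ l l Iff.rfl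
    have h4 : ∑ y, binomExp p (fun Z => if Q (.inr (.inr y)) Z then 1 else 0) ≤ ϵ / 4 := by
      refine (sum_badContainer_le pts hinjs χs cont t m (x := x)
        (A := (1 + (r * kc : ℝ) * 2 ^ (kc * t)) ^ R) hp.le hp1 hx0 hx1 hD0 le_rfl ?_
        (by positivity)).trans
        (hn₁ (p * N) hnn₁ _ (hδa.trans (min_le_left _ _)) t m htle hmge)
      intro F hF
      have hc := card_containers_le ptc χc
        (fun i => lamSeq ε η Y i / 2 * (δ * p) ^ i * Mc) F R
      rw [Fintype.card_fin] at hc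
      have hc' : ((cont F).card : ℝ) ≤ (1 + (r * kc : ℝ) * 2 ^ (kc * F.card)) ^ R := by
        exact_mod_cast hc
      refine hc'.trans ?_
      gcongr
      norm_num
    have e2 : ∑ _l : Fin kc, kc * (kc + 1) ^ kc * K * (ϵ / 4 / Θ) / δ ^ (2 * kc) = ϵ / 4 := by
      rw [Finset.sum_const, Finset.card_univ, Fintype.card_fin, nsmul_eq_mul]
      have : (kc : ℝ) * (kc * (kc + 1) ^ kc * K * (ϵ / 4 / Θ) / δ ^ (2 * kc)) =
          Θ * (ϵ / 4 / Θ) := by rw [hΘ]; ring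
      rw [this]
      field_simp
    have e13 : ∑ _l : Fin kc, 1 / (p * N) + ∑ _l : Fin ks, 1 / (p * N) ≤ ϵ / 4 := by
      simp only [Finset.sum_const, Finset.card_univ, Fintype.card_fin, nsmul_eq_mul]
      rw [← add_mul, mul_one_div, div_le_iff₀ hpN]
      rw [div_le_iff₀ hϵ] at hnϵ
      linarith
    linarith
  refine (by linarith : 1 - ϵ ≤ 1 - ∑ i, binomExp p (fun Z => if Q i Z then 1 else 0)).trans
    (one_sub_le_probSub hp.le hp1 Finset.univ ?_)
  intro Z hZ ψ hψ hmany
  have hG1 : ∀ l : Fin kc, ((Finset.univ.filter fun x : Γc × Γc => ptc x.1 l = ptc x.2 l ∧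
      pairCover ptc (Finset.Iio l) x ⊆ Z).card : ℝ) ≤
      2 * pairConst kc K * N * Mc ^ 2 * p ^ (2 * (l : ℕ)) := by
    intro l
    have := not_lt.1 (hZ (.inl (.inl l)) (Finset.mem_univ _))
    rw [Finset.card_insert_of_notMem (by simp), Fin.card_Iio] at this
    refine this.trans (le_of_eq ?_)
    rw [show (l : ℕ) + (l + 1 - 1) = 2 * l by omega]
    ring
  have hG2 : ∀ l : Fin kc, ((Finset.univ.filter fun x : Γc × Γc => ptc x.1 l = ptc x.2 l ∧
      (∃ q ∈ Finset.Iio l, ptc x.1 q = ptc x.2 q) ∧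
      pairCover ptc (Finset.Iio l) x ⊆ Z).card : ℝ) ≤
      δ ^ (2 * kc) * (N * Mc ^ 2 * p ^ (2 * (l : ℕ))) := by
    intro l
    have := not_lt.1 (hZ (.inl (.inr l)) (Finset.mem_univ _))
    rwa [Fin.card_Iio] at this
  have hG3 : ∀ q : Fin ks, ((Finset.univ.filter fun x : Γs × Γs => pts x.1 q = pts x.2 q ∧
      pairCover pts Finset.univ x ⊆ Z).card : ℝ) ≤
      2 * pairConst ks K * N * Ms ^ 2 * p ^ (ks + (ks - 1)) := by
    intro q
    have := not_lt.1 (hZ (.inr (.inl q)) (Finset.mem_univ _))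
    rw [Finset.insert_eq_of_mem (Finset.mem_univ q), Finset.card_univ, Fintype.card_fin] at this
    refine this.trans (le_of_eq ?_)
    ring
  have hI : ∀ j, colourClass ψ j ⊆ Z := fun j v hv => hψ v (by
    simp only [colourClass, Finset.mem_filter, Finset.mem_univ, true_and] at hv
    simp [hv])
  have hΨ := potential_zero_le (pt := ptc) Z (fun _ => ∅) hδ0 hδ1 hp hN0.le hG1 hG2
  rcases many_or_container ptc χc (colourClass ψ) Z hδ0 hδ1 hp hMc hε0 hη0 hη1 hY0 hV hn1 hu
    (by
      rw [div_le_iff₀ (by positivity)] at hn16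
      linarith) hΨ hI R hR with ⟨ι, hι⟩ | ⟨F, C, hFZ, hFcard, hCmem, hCfew, hdisc⟩
  · have h1 : (inClass ptc (χc ι) (colourClass ψ)).card ≤ classCount ptc χc (colourClass ψ) :=
      Finset.single_le_sum (f := fun ι => (inClass ptc (χc ι) (colourClass ψ)).card)
        (fun _ _ => Nat.zero_le _) (Finset.mem_univ ι)
    have h2 : ((inClass ptc (χc ι) (colourClass ψ)).card : ℝ) ≤
      classCount ptc χc (colourClass ψ) := by exact_mod_cast h1
    refine le_trans (le_of_eq ?_) (hι.trans h2)
    rw [mul_pow]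
    ring
  · exfalso
    have hFt : F.card ≤ t := Nat.le_floor (hFcard.trans (le_of_eq (by ring)))
    have hCs : (classCount pts χs C : ℝ) ≤ βs / 4 * N * Ms := by
      refine hdense C ?_
      unfold classCount
      push_cast
      calc ∑ ι, ((inClass ptc (χc ι) C).card : ℝ) < ∑ _ι : Fin r, ε * N * Mc :=
            Finset.sum_lt_sum_of_nonempty ⟨⟨0, hr⟩, Finset.mem_univ _⟩ fun ι _ => hCfew ι
        _ = γ * N * Mc := by
            rw [Finset.sum_const, Finset.card_univ, Fintype.card_fin, nsmul_eq_mul, hε]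
            field_simp
    have hnotrob := fun h => hZ (.inr (.inr (F, C))) (Finset.mem_univ _)
      (show BadContainer pts χs cont t m (βs / 4 * N * Ms) D (F, C) Z from
        ⟨⟨hFt, hCmem, hCs⟩, h⟩)
    have hfew := classCount_lt_of_not_robustlyMany pts χs (colourClass ψ) C F Z
      (κ := κ) (ν := ν) hp hMs.le hN0.le (by positivity : 0 ≤ 2 * pairConst ks K) hν0.le
      hκν hG3 hI hFZ hnotrob (by
        have e1 : (F.card : ℝ) ≤ κ / 3 * (p * N) := by
          refine hFcard.trans ?_
          calc R * (kc * (4 * δ * p * N)) = R * (kc * (4 * δ)) * (p * N) := by ring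
            _ ≤ κ / 3 * (p * N) :=
              mul_le_mul_of_nonneg_right (hδa.trans (min_le_right _ _)) hpN.le
        have e2 : (m : ℝ) * ks ≤ κ / 3 * (p * N) := by
          calc (m : ℝ) * ks ≤ κ / 3 / ks * (p * N) * ks :=
                mul_le_mul_of_nonneg_right hmle hks'.le
            _ = _ := by field_simp
        have e3 : (r : ℝ) * (η * p * N) = κ / 3 * (p * N) := by
          rw [hη]; field_simp
        push_cast
        linarith)
    have e4 : (r : ℝ) * (ks * (ν * N * Ms * p ^ ks)) = βs / 4 * (p ^ ks * N * Ms) := by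
      rw [hν]; field_simp
    have e5 : D = βs / 2 * (p ^ ks * N * Ms) := by rw [hD]; ring
    have e6 : 0 < βs * (p ^ ks * N * Ms) := by positivity
    rw [e4, e5] at hfew
    linarith

section Counting

/-- The slice of `T` at first coordinate `a`. -/
noncomputable def slice {α β : Type*} [Fintype β] (T : Finset (α × β)) (a : α) : Finset β :=
  Finset.univ.filter fun b => (a, b) ∈ T

lemma mem_slice {α β : Type*} [Fintype β] {T : Finset (α × β)} {a : α} {b : β} :
    b ∈ slice T a ↔ (a, b) ∈ T := by
  simp [slice]

lemma sum_card_slice {α β : Type*} [Fintype α] [Fintype β] (T : Finset (α × β)) :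
    ∑ a, (slice T a).card = T.card := by
  have h : T.card = ∑ x : α × β, if x ∈ T then 1 else 0 := by simp
  rw [h, Fintype.sum_prod_type]
  refine Finset.sum_congr rfl fun a _ => ?_
  simp [slice]

variable {V : Type*} [Fintype V]

/-- The number of ways to embed an edge with the positions in `T` prescribed. -/
lemma card_edge_embeddings_le {ι : Type*} [Fintype ι] (H : Finset (Finset V))
    (hH : ∀ e ∈ H, e.card = Fintype.card ι) (T : Finset ι) (σ : ι → V) :
    (Finset.univ.filter fun h : ι → V => Function.Injective h ∧ Finset.univ.image h ∈ H ∧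
      ∀ q ∈ T, h q = σ q).card ≤ Fintype.card ι ^ Fintype.card ι * maxDeg H T.card := by
  set A := Finset.univ.filter fun h : ι → V => Function.Injective h ∧ Finset.univ.image h ∈ H ∧
      ∀ q ∈ T, h q = σ q with hA
  rcases A.eq_empty_or_nonempty with hE | ⟨h₀, hh₀⟩
  · simp [hE]
  simp only [hA, Finset.mem_filter, Finset.mem_univ, true_and] at hh₀
  have himg : ∀ h : ι → V, (∀ q ∈ T, h q = σ q) → T.image h = T.image σ := fun h hh =>
    Finset.image_congr fun q hq => hh q hq
  have hcard : (T.image σ).card = T.card := by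
    rw [← himg h₀ hh₀.2.2, Finset.card_image_of_injective _ hh₀.1]
  have hdeg : degH H (T.image σ) ≤ maxDeg H T.card :=
    Finset.le_sup (f := degH H) (by simp [hcard])
  refine (Finset.card_le_mul_card_image (f := fun h : ι → V => Finset.univ.image h) A
    (Fintype.card ι ^ Fintype.card ι) ?_).trans (Nat.mul_le_mul_left _ ?_)
  · intro e he
    obtain ⟨h₁, hh₁, rfl⟩ := Finset.mem_image.1 he
    simp only [hA, Finset.mem_filter, Finset.mem_univ, true_and] at hh₁
    calc _ ≤ (Fintype.piFinset fun _ : ι => Finset.univ.image h₁).card := by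
          refine Finset.card_le_card fun h hh => ?_
          rw [Fintype.mem_piFinset]
          intro q
          rw [← (Finset.mem_filter.1 hh).2]
          exact Finset.mem_image_of_mem _ (Finset.mem_univ q)
      _ = _ := by
          rw [Fintype.card_piFinset, Finset.prod_const, hH _ hh₁.2.1, Finset.card_univ]
  · refine le_trans (Finset.card_le_card ?_) hdeg
    intro e he
    obtain ⟨h, hh, rfl⟩ := Finset.mem_image.1 he
    simp only [hA, Finset.mem_filter, Finset.mem_univ, true_and] at hh
    refine Finset.mem_filter.2 ⟨hh.2.1, ?_⟩
    rw [← himg h hh.2.2]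
    exact Finset.image_subset_image (Finset.subset_univ _)

variable {R S : ℕ}

/-- The tuple `h` lists the vertices other than `v` of an edge through `v`. -/
def IsLeafTuple (H : Finset (Finset V)) (v : V) (h : Fin S → V) : Prop :=
  insert v (Finset.univ.image h) ∈ H ∧ Function.Injective h ∧ ∀ l, h l ≠ v

/-- An upper bound for the number of embeddings of an edge with `t` prescribed vertices. -/
noncomputable def embedBound (H : Finset (Finset V)) (S t : ℕ) : ℕ := (S + 1) ^ (S + 1) * maxDeg H t

lemma option_elim_injective {v : V} {h : Fin S → V} (hi : Function.Injective h)
    (hv : ∀ l, h l ≠ v) : Function.Injective fun o : Option (Fin S) => o.elim v h := by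
  rintro (_ | a) (_ | b) hab
  · rfl
  · exact absurd hab.symm (hv b)
  · exact absurd hab (hv a)
  · exact congrArg some (hi hab)

lemma image_option_elim (v : V) (h : Fin S → V) :
    (Finset.univ : Finset (Option (Fin S))).image (fun o => o.elim v h) =
      insert v (Finset.univ.image h) := by
  ext w
  simp only [Finset.mem_image, Finset.mem_univ, true_and, Finset.mem_insert]
  constructor
  · rintro ⟨_ | l, rfl⟩
    · exact Or.inl rfl
    · exact Or.inr ⟨l, rfl⟩
  · rintro (rfl | ⟨l, rfl⟩)
    · exact ⟨none, rfl⟩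
    · exact ⟨some l, rfl⟩

/-- Leaf tuples at a fixed centre with some positions prescribed. -/
lemma card_leafTuple_le (H : Finset (Finset V)) (hH : ∀ e ∈ H, e.card = S + 1) (v : V)
    (T : Finset (Fin S)) (σ : Fin S → V) :
    (Finset.univ.filter fun h : Fin S → V => IsLeafTuple H v h ∧ ∀ l ∈ T, h l = σ l).card ≤
      embedBound H S (T.card + 1) := by
  have := card_edge_embeddings_le (ι := Option (Fin S)) H (by simpa using hH)
    (insert none (T.map Function.Embedding.some)) (fun o => o.elim v σ)
  rw [Finset.card_insert_of_notMem (by simp), Finset.card_map, Fintype.card_option,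
    Fintype.card_fin] at this
  refine le_trans (Finset.card_le_card_of_injOn (fun h o => o.elim v h) ?_ ?_) this
  · intro h hh
    simp only [Finset.coe_filter, Finset.mem_univ, true_and, Set.mem_ofPred_eq] at hh
    simp only [Finset.coe_filter, Finset.mem_univ, true_and, Set.mem_ofPred_eq]
    refine ⟨option_elim_injective hh.1.2.1 hh.1.2.2, ?_, ?_⟩
    · rw [image_option_elim]; exact hh.1.1
    · intro q hq
      rw [Finset.mem_insert, Finset.mem_map] at hq
      rcases hq with rfl | ⟨l, hl, rfl⟩
      · rfl
      · exact hh.2 l hl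
  · intro h _ h' _ heq
    funext l
    exact congrFun heq (some l)

/-- Centres together with leaf tuples with some positions prescribed. -/
lemma card_centred_leafTuple_le (H : Finset (Finset V)) (hH : ∀ e ∈ H, e.card = S + 1)
    (T : Finset (Fin S)) (σ : Fin S → V) :
    (Finset.univ.filter fun x : V × (Fin S → V) => IsLeafTuple H x.1 x.2 ∧
      ∀ l ∈ T, x.2 l = σ l).card ≤ embedBound H S T.card := by
  rcases isEmpty_or_nonempty V with hV | ⟨⟨v₀⟩⟩
  · simp
  have := card_edge_embeddings_le (ι := Option (Fin S)) H (by simpa using hH)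
    (T.map Function.Embedding.some) (fun o => o.elim v₀ σ)
  rw [Finset.card_map, Fintype.card_option, Fintype.card_fin] at this
  refine le_trans (Finset.card_le_card_of_injOn
    (fun (x : V × (Fin S → V)) (o : Option (Fin S)) => o.elim x.1 x.2) ?_ ?_) this
  · rintro ⟨v, h⟩ hh
    simp only [Finset.coe_filter, Finset.mem_univ, true_and, Set.mem_ofPred_eq] at hh
    simp only [Finset.coe_filter, Finset.mem_univ, true_and, Set.mem_ofPred_eq]
    refine ⟨option_elim_injective hh.1.2.1 hh.1.2.2, ?_, ?_⟩
    · rw [image_option_elim]; exact hh.1.1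
    · intro q hq
      rw [Finset.mem_map] at hq
      obtain ⟨l, hl, rfl⟩ := hq
      exact hh.2 l hl
  · rintro ⟨v, h⟩ _ ⟨v', h'⟩ _ heq
    refine Prod.ext (congrFun heq none) (funext fun l => congrFun heq (some l))

/-- The leaf arrays of `R` edges through `v` with the positions in `T` prescribed by `σ`. -/
noncomputable def rootedArrays (H : Finset (Finset V)) (v : V) (T : Finset (Fin R × Fin S))
    (σ : Fin R × Fin S → V) : Finset (Fin R → Fin S → V) :=
  Finset.univ.filter fun g => (∀ j, IsLeafTuple H v (g j)) ∧ ∀ x ∈ T, g x.1 x.2 = σ x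

/-- The centred leaf arrays of `R` edges with the positions in `T` prescribed by `σ`. -/
noncomputable def centredArrays (H : Finset (Finset V)) (T : Finset (Fin R × Fin S))
    (σ : Fin R × Fin S → V) : Finset (V × (Fin R → Fin S → V)) :=
  Finset.univ.filter fun x => x.2 ∈ rootedArrays H x.1 T σ

lemma card_rootedArrays_le (H : Finset (Finset V)) (hH : ∀ e ∈ H, e.card = S + 1) (v : V)
    (T : Finset (Fin R × Fin S)) (σ : Fin R × Fin S → V) :
    (rootedArrays H v T σ).card ≤ ∏ j, embedBound H S ((slice T j).card + 1) := by
  calc _ ≤ (Fintype.piFinset fun j => Finset.univ.filter fun h : Fin S → V =>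
        IsLeafTuple H v h ∧ ∀ l ∈ slice T j, h l = σ (j, l)).card := by
        refine Finset.card_le_card fun g hg => ?_
        simp only [rootedArrays, Finset.mem_filter, Finset.mem_univ, true_and] at hg
        simp only [Fintype.mem_piFinset, Finset.mem_filter, Finset.mem_univ, true_and]
        exact fun j => ⟨hg.1 j, fun l hl => hg.2 (j, l) (mem_slice.1 hl)⟩
    _ ≤ _ := by
        rw [Fintype.card_piFinset]
        exact Finset.prod_le_prod' fun j _ => card_leafTuple_le H hH v _ fun l => σ (j, l)

lemma card_centredArrays_le (H : Finset (Finset V)) (hH : ∀ e ∈ H, e.card = S + 1)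
    (T : Finset (Fin R × Fin S)) (σ : Fin R × Fin S → V) (j₀ : Fin R) :
    (centredArrays H T σ).card ≤
      ∏ j, embedBound H S ((slice T j).card + if j = j₀ then 0 else 1) := by
  rw [← Finset.mul_prod_erase _ _ (Finset.mem_univ j₀), if_pos rfl, add_zero, mul_comm]
  refine (Finset.card_le_mul_card_image (f := fun x : V × (Fin R → Fin S → V) => (x.1, x.2 j₀))
    (centredArrays H T σ) _ ?_).trans (Nat.mul_le_mul_left _ (le_trans (Finset.card_le_card ?_)
      (card_centred_leafTuple_le H hH (slice T j₀) fun l => σ (j₀, l))))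
  · rintro ⟨v, h⟩ -
    calc _ ≤ (Fintype.piFinset fun j => if j = j₀ then {h} else
          Finset.univ.filter fun h : Fin S → V =>
            IsLeafTuple H v h ∧ ∀ l ∈ slice T j, h l = σ (j, l)).card := by
          refine Finset.card_le_card_of_injOn Prod.snd ?_ ?_
          · rintro ⟨w, g⟩ hg
            simp only [centredArrays, rootedArrays, Finset.coe_filter, Finset.mem_univ, true_and,
              Set.mem_ofPred_eq, Prod.mk.injEq, Finset.mem_filter] at hg
            obtain ⟨⟨hg1, hg2⟩, rfl, hg3⟩ := hg
            simp only [Finset.mem_coe, Fintype.mem_piFinset]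
            intro j
            split_ifs with hj
            · simp [hj, hg3]
            · simpa using ⟨hg1 j, fun l hl => hg2 (j, l) (mem_slice.1 hl)⟩
          · rintro ⟨w, g⟩ hg ⟨w', g'⟩ hg' heq
            simp only [Finset.coe_filter, Set.mem_ofPred_eq, Prod.mk.injEq] at hg hg'
            exact Prod.ext (hg.2.1.trans hg'.2.1.symm) heq
      _ ≤ _ := by
          rw [Fintype.card_piFinset, ← Finset.mul_prod_erase _ _ (Finset.mem_univ j₀), if_pos rfl,
            Finset.card_singleton, one_mul]
          refine Finset.prod_le_prod' fun j hj => ?_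
          rw [if_neg (Finset.ne_of_mem_erase hj), if_neg (Finset.ne_of_mem_erase hj)]
          exact card_leafTuple_le H hH v _ fun l => σ (j, l)
  · rintro ⟨v, h⟩ hvh
    obtain ⟨⟨w, g⟩, hg, heq⟩ := Finset.mem_image.1 hvh
    simp only [centredArrays, rootedArrays, Finset.mem_filter, Finset.mem_univ, true_and] at hg
    simp only [Prod.mk.injEq] at heq
    obtain ⟨rfl, rfl⟩ := heq
    simpa using ⟨hg.1 j₀, fun l hl => hg.2 (j₀, l) (mem_slice.1 hl)⟩

/-- Arrays consisting of a base edge and `R` edges through each of its vertices, with the leaves in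
`T` prescribed by `σ`. -/
noncomputable def basedArrays (H : Finset (Finset V)) (T : Finset (Fin (S + 1) × Fin R × Fin S))
    (σ : Fin (S + 1) × Fin R × Fin S → V) :
    Finset ((Fin (S + 1) → V) × (Fin (S + 1) → Fin R → Fin S → V)) :=
  Finset.univ.filter fun x => Function.Injective x.1 ∧ Finset.univ.image x.1 ∈ H ∧
    ∀ a, x.2 a ∈ rootedArrays H (x.1 a) (slice T a) fun y => σ (a, y)

lemma card_basedArrays_le (H : Finset (Finset V)) (hH : ∀ e ∈ H, e.card = S + 1)
    (T : Finset (Fin (S + 1) × Fin R × Fin S)) (σ : Fin (S + 1) × Fin R × Fin S → V)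
    (B : Finset (Fin (S + 1))) :
    (basedArrays H T σ).card ≤ (∏ a, if a ∈ B then
        (centredArrays H (slice T a) fun y => σ (a, y)).card
      else ∏ j, embedBound H S ((slice (slice T a) j).card + 1)) * embedBound H S B.card := by
  have hsplit : (∏ a, if a ∈ B then (centredArrays H (slice T a) fun y => σ (a, y)).card
      else ∏ j, embedBound H S ((slice (slice T a) j).card + 1)) =
      (∏ a, if a ∈ B then 1 else ∏ j, embedBound H S ((slice (slice T a) j).card + 1)) *
      ∏ a, if a ∈ B then (centredArrays H (slice T a) fun y => σ (a, y)).card else 1 := by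
    rw [← Finset.prod_mul_distrib]
    refine Finset.prod_congr rfl fun a _ => ?_
    split_ifs <;> simp
  rw [hsplit, mul_right_comm]
  set Φ : (Fin (S + 1) → V) × (Fin (S + 1) → Fin R → Fin S → V) →
      Fin (S + 1) → Option (V × (Fin R → Fin S → V)) :=
    fun x a => if a ∈ B then some (x.1 a, x.2 a) else none with hΦ
  refine (Finset.card_le_mul_card_image (f := Φ) (basedArrays H T σ) _ ?_).trans
    (Nat.mul_le_mul_left _ ?_)
  · intro b hb
    obtain ⟨x₀, hx₀, rfl⟩ := Finset.mem_image.1 hb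
    have hagree : ∀ x, Φ x = Φ x₀ → ∀ a ∈ B, x.1 a = x₀.1 a ∧ x.2 a = x₀.2 a := by
      intro x hx a ha
      have := congrFun hx a
      simpa [hΦ, ha] using this
    refine (Finset.card_le_mul_card_image (f := Prod.fst) _ _ ?_).trans
      (Nat.mul_le_mul_left _ (le_trans (Finset.card_le_card ?_)
        ((card_edge_embeddings_le (ι := Fin (S + 1)) H (by simpa using hH) B x₀.1).trans
          (by rw [Fintype.card_fin]; exact le_rfl))))
    · intro f _
      calc _ ≤ (Fintype.piFinset fun a => if a ∈ B then {x₀.2 a} else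
            rootedArrays H (f a) (slice T a) fun y => σ (a, y)).card := by
            refine Finset.card_le_card_of_injOn Prod.snd ?_ ?_
            · rintro ⟨f', g⟩ hg
              simp only [Finset.coe_filter, Set.mem_ofPred_eq, Finset.mem_filter] at hg
              obtain ⟨⟨hg1, hg2⟩, rfl⟩ := hg
              simp only [basedArrays, Finset.mem_filter, Finset.mem_univ, true_and] at hg1
              simp only [Finset.mem_coe, Fintype.mem_piFinset]
              intro a
              split_ifs with ha
              · simpa using (hagree _ hg2 a ha).2
              · exact hg1.2.2 a
            · rintro ⟨f', g⟩ hg ⟨f'', g'⟩ hg' heq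
              simp only [Finset.coe_filter, Set.mem_ofPred_eq] at hg hg'
              exact Prod.ext (hg.2.trans hg'.2.symm) heq
        _ ≤ _ := by
            rw [Fintype.card_piFinset]
            refine Finset.prod_le_prod' fun a _ => ?_
            split_ifs with ha
            · simp
            · exact card_rootedArrays_le H hH _ _ _
    · intro f hf
      obtain ⟨x, hx, rfl⟩ := Finset.mem_image.1 hf
      obtain ⟨hx1, hx2⟩ := Finset.mem_filter.1 hx
      simp only [basedArrays, Finset.mem_filter, Finset.mem_univ, true_and] at hx1
      simp only [Finset.mem_filter, Finset.mem_univ, true_and]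
      exact ⟨hx1.1, hx1.2.1, fun a ha => (hagree x hx2 a ha).1⟩
  · calc _ ≤ (Fintype.piFinset fun a => if a ∈ B then
          (centredArrays H (slice T a) fun y => σ (a, y)).map Function.Embedding.some
          else {none}).card := by
          refine Finset.card_le_card fun b hb => ?_
          obtain ⟨x, hx, rfl⟩ := Finset.mem_image.1 hb
          simp only [basedArrays, Finset.mem_filter, Finset.mem_univ, true_and] at hx
          rw [Fintype.mem_piFinset]
          intro a
          simp only [hΦ]
          split_ifs with ha
          · rw [Finset.mem_map]
            exact ⟨(x.1 a, x.2 a), by simpa [centredArrays] using hx.2.2 a, rfl⟩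
          · simp
      _ = _ := by
          rw [Fintype.card_piFinset]
          refine Finset.prod_congr rfl fun a _ => ?_
          split_ifs <;> simp

end Counting

section PinnedBounds

/-- A product of factors of the shape `w * p ^ e * D`. -/
lemma prod_le_prod_mul_pow {ι : Type*} [Fintype ι] {x w : ι → ℝ} {e : ι → ℕ} {p D : ℝ}
    (hx : ∀ j, 0 ≤ x j) (h : ∀ j, x j ≤ w j * p ^ e j * D) :
    ∏ j, x j ≤ (∏ j, w j) * p ^ (∑ j, e j) * D ^ Fintype.card ι := by
  calc ∏ j, x j ≤ ∏ j, (w j * p ^ e j * D) :=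
        Finset.prod_le_prod (fun j _ => hx j) fun j _ => h j
    _ = _ := by
        rw [Finset.prod_mul_distrib, Finset.prod_mul_distrib, Finset.prod_pow_eq_pow_sum,
          Finset.prod_const, Finset.card_univ]

/-- A product in which one factor is exceptionally small. -/
lemma prod_ite_eq_le {ι : Type*} [Fintype ι] [DecidableEq ι] (j₁ : ι) {K θ : ℝ} (hK : 1 ≤ K)
    (hθ : 0 ≤ θ) :
    ∏ j, (if j = j₁ then θ else K) ≤ θ * K ^ Fintype.card ι := by
  rw [← Finset.mul_prod_erase _ _ (Finset.mem_univ j₁), if_pos rfl]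
  refine mul_le_mul_of_nonneg_left ?_ hθ
  calc ∏ j ∈ Finset.univ.erase j₁, (if j = j₁ then θ else K)
      = ∏ j ∈ Finset.univ.erase j₁, K :=
        Finset.prod_congr rfl fun j hj => if_neg (Finset.ne_of_mem_erase hj)
    _ ≤ K ^ Fintype.card ι := by
        rw [Finset.prod_const]
        exact pow_le_pow_right₀ hK (Finset.card_le_univ _)

lemma sum_add_ite_eq {ι : Type*} [Fintype ι] [DecidableEq ι] (n : ι → ℕ) (B : Finset ι)
    (hB : ∀ a ∈ B, 1 ≤ n a) :
    ∑ a, (n a - if a ∈ B then 1 else 0) + B.card = ∑ a, n a := by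
  have h : B.card = ∑ a, if a ∈ B then 1 else 0 := by simp
  rw [h, ← Finset.sum_add_distrib]
  refine Finset.sum_congr rfl fun a _ => ?_
  split_ifs with ha
  · have := hB a ha; omega
  · omega

lemma exists_slice_pos {α β : Type*} [Fintype α] [Fintype β] {T : Finset (α × β)}
    (hT : 1 ≤ T.card) : ∃ a, 1 ≤ (slice T a).card := by
  by_contra! h
  have : ∑ a, (slice T a).card = 0 := Finset.sum_eq_zero fun a _ => by have := h a; omega
  rw [sum_card_slice] at this
  omega

/-- Two prescribed positions lie in the same slice or in two different slices. -/
lemma exists_slice_two {α β : Type*} [Fintype α] [Fintype β] {T : Finset (α × β)}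
    (hT : 2 ≤ T.card) : (∃ a, 2 ≤ (slice T a).card) ∨
      (∃ a b, a ≠ b ∧ (slice T a).card = 1 ∧ (slice T b).card = 1) := by
  by_contra! h
  obtain ⟨h1, h2⟩ := h
  obtain ⟨a, ha⟩ := exists_slice_pos (show 1 ≤ T.card by omega)
  have hone : ∀ b, b ≠ a → (slice T b).card = 0 := fun b hb => by
    have := h2 a b hb.symm (by have := h1 a; omega)
    have := h1 b
    omega
  have hsum := sum_card_slice T
  rw [Finset.sum_eq_single a (fun b _ hb => hone b hb) (by simp)] at hsum
  have := h1 a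
  omega

variable {V : Type*} [Fintype V] {R S : ℕ} {H : Finset (Finset V)} {p D K θ : ℝ}

lemma rootedBound_le
    (hd : ∀ t, 1 ≤ t → t ≤ S + 1 → (embedBound H S t : ℝ) ≤ K * p ^ (t - 1) * D)
    (T : Finset (Fin R × Fin S)) :
    ((∏ j, embedBound H S ((slice T j).card + 1) : ℕ) : ℝ) ≤ K ^ R * p ^ T.card * D ^ R := by
  push_cast
  refine (prod_le_prod_mul_pow (w := fun _ => K) (e := fun j => (slice T j).card) (p := p) (D := D)
    (fun j => Nat.cast_nonneg _) fun j => ?_).trans (le_of_eq ?_)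
  · have := Finset.card_le_univ (slice T j)
    rw [Fintype.card_fin] at this
    simpa using hd ((slice T j).card + 1) (by omega) (by omega)
  · rw [sum_card_slice, Finset.prod_const, Finset.card_univ, Fintype.card_fin]

lemma centredBound_aux (hH : ∀ e ∈ H, e.card = S + 1)
    (T : Finset (Fin R × Fin S)) (σ : Fin R × Fin S → V) (j₀ : Fin R)
    (hj₀ : 1 ≤ (slice T j₀).card) (w : Fin R → ℝ)
    (hw : ∀ j, (embedBound H S ((slice T j).card + if j = j₀ then 0 else 1) : ℝ) ≤
      w j * p ^ ((slice T j).card - if j = j₀ then 1 else 0) * D) :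
    ((centredArrays H T σ).card : ℝ) ≤ (∏ j, w j) * p ^ (T.card - 1) * D ^ R := by
  have h1 : ((centredArrays H T σ).card : ℝ) ≤
      ∏ j, (embedBound H S ((slice T j).card + if j = j₀ then 0 else 1) : ℝ) := by
    exact_mod_cast card_centredArrays_le H hH T σ j₀
  refine h1.trans ((prod_le_prod_mul_pow (fun j => Nat.cast_nonneg _) hw).trans (le_of_eq ?_))
  have h2 := sum_add_ite_eq (fun j => (slice T j).card) {j₀} (by simpa using hj₀)
  simp only [Finset.mem_singleton, Finset.card_singleton, sum_card_slice] at h2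
  rw [Fintype.card_fin, ← h2, Nat.add_sub_cancel]

lemma centredBound_le (hH : ∀ e ∈ H, e.card = S + 1)
    (hd : ∀ t, 1 ≤ t → t ≤ S + 1 → (embedBound H S t : ℝ) ≤ K * p ^ (t - 1) * D)
    (T : Finset (Fin R × Fin S)) (σ : Fin R × Fin S → V) (hT : 1 ≤ T.card) :
    ((centredArrays H T σ).card : ℝ) ≤ K ^ R * p ^ (T.card - 1) * D ^ R := by
  obtain ⟨j₀, hj₀⟩ := exists_slice_pos hT
  refine (centredBound_aux (p := p) (D := D) hH T σ j₀ hj₀ (fun _ => K)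
    fun j => ?_).trans (le_of_eq ?_)
  · have := Finset.card_le_univ (slice T j)
    rw [Fintype.card_fin] at this
    split_ifs with h
    · subst h
      simpa using hd (slice T j).card hj₀ (by omega)
    · simpa using hd ((slice T j).card + 1) (by omega) (by omega)
  · rw [Finset.prod_const, Finset.card_univ, Fintype.card_fin]

lemma centredBound_small (hp : 0 ≤ p) (hH : ∀ e ∈ H, e.card = S + 1) (hK : 1 ≤ K) (hθ : 0 ≤ θ)
    (hS : 2 ≤ S) (hD : 0 ≤ D)
    (hd : ∀ t, 1 ≤ t → t ≤ S + 1 → (embedBound H S t : ℝ) ≤ K * p ^ (t - 1) * D)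
    (hd' : ∀ t, 2 ≤ t → t ≤ S → (embedBound H S t : ℝ) ≤ θ * p ^ (t - 1) * D)
    (T : Finset (Fin R × Fin S)) (σ : Fin R × Fin S → V) (hT : 2 ≤ T.card) :
    ((centredArrays H T σ).card : ℝ) ≤ θ * K ^ R * p ^ (T.card - 1) * D ^ R := by
  have hcard : ∀ j, (slice T j).card ≤ S := fun j => by
    simpa using Finset.card_le_univ (slice T j)
  obtain ⟨j₀, j₁, hj₀, hw⟩ : ∃ j₀ j₁ : Fin R, 1 ≤ (slice T j₀).card ∧
      ∀ j, (embedBound H S ((slice T j).card + if j = j₀ then 0 else 1) : ℝ) ≤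
      (if j = j₁ then θ else K) * p ^ ((slice T j).card - if j = j₀ then 1 else 0) * D := by
    rcases exists_slice_two hT with ⟨a, ha⟩ | ⟨a, b, hab, ha, hb⟩
    · refine ⟨a, a, by omega, fun j => ?_⟩
      split_ifs with h
      · subst h
        simpa using hd' (slice T j).card ha (hcard j)
      · simpa using hd ((slice T j).card + 1) (by omega) (by have := hcard j; omega)
    · refine ⟨a, b, by omega, fun j => ?_⟩
      rcases eq_or_ne j b with rfl | hjb
      · rw [if_neg hab.symm, if_pos rfl, if_neg hab.symm, hb]
        simpa using hd' 2 le_rfl hS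
      · rw [if_neg hjb]
        split_ifs with h
        · subst h
          simpa using hd (slice T j).card (by omega) (by have := hcard j; omega)
        · simpa using hd ((slice T j).card + 1) (by omega) (by have := hcard j; omega)
  refine (centredBound_aux hH T σ j₀ hj₀ _ hw).trans ?_
  have := prod_ite_eq_le j₁ hK hθ
  rw [Fintype.card_fin] at this
  gcongr

lemma basedBound_aux (hH : ∀ e ∈ H, e.card = S + 1) (hp : 0 ≤ p) (hD : 0 ≤ D)
    (hd : ∀ t, 1 ≤ t → t ≤ S + 1 → (embedBound H S t : ℝ) ≤ K * p ^ (t - 1) * D)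
    (T : Finset (Fin (S + 1) × Fin R × Fin S)) (σ : Fin (S + 1) × Fin R × Fin S → V)
    (B : Finset (Fin (S + 1))) (hB : B.Nonempty) (hBT : ∀ a ∈ B, 1 ≤ (slice T a).card)
    (w : Fin (S + 1) → ℝ) (w₀ L : ℝ) (hw0 : ∀ a, 0 ≤ w a)
    (hw : ∀ a ∈ B, ((centredArrays H (slice T a) fun y => σ (a, y)).card : ℝ) ≤
      w a * p ^ ((slice T a).card - 1) * D ^ R)
    (hwK : ∀ a ∉ B, K ^ R ≤ w a)
    (hw₀ : (embedBound H S B.card : ℝ) ≤ w₀ * p ^ (B.card - 1) * D)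
    (hL : (∏ a, w a) * w₀ ≤ L) :
    ((basedArrays H T σ).card : ℝ) ≤ L * p ^ (T.card - 1) * D ^ ((S + 1) * R + 1) := by
  have h1 : ((basedArrays H T σ).card : ℝ) ≤ (∏ a, ((if a ∈ B then
        (centredArrays H (slice T a) fun y => σ (a, y)).card
      else ∏ j, embedBound H S ((slice (slice T a) j).card + 1) : ℕ) : ℝ)) *
      embedBound H S B.card := by
    exact_mod_cast card_basedArrays_le H hH T σ B
  have h2 := prod_le_prod_mul_pow (x := fun a => ((if a ∈ B then
        (centredArrays H (slice T a) fun y => σ (a, y)).card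
      else ∏ j, embedBound H S ((slice (slice T a) j).card + 1) : ℕ) : ℝ)) (w := w)
      (e := fun a => (slice T a).card - if a ∈ B then 1 else 0) (p := p) (D := D ^ R)
      (fun a => Nat.cast_nonneg _) (fun a => by
        by_cases ha : a ∈ B
        · simp only [if_pos ha]
          exact hw a ha
        · simp only [if_neg ha, Nat.sub_zero]
          refine (rootedBound_le hd (slice T a)).trans ?_
          have := hwK a ha
          gcongr)
  refine h1.trans ((mul_le_mul h2 hw₀ (Nat.cast_nonneg _) ?_).trans ?_)
  · have : 0 ≤ ∏ a, w a := Finset.prod_nonneg fun a _ => hw0 a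
    positivity
  · have h3 := sum_add_ite_eq (fun a => (slice T a).card) B hBT
    rw [sum_card_slice] at h3
    have hB1 : 1 ≤ B.card := hB.card_pos
    rw [Fintype.card_fin]
    calc _ = ((∏ a, w a) * w₀) *
          p ^ (∑ a, ((slice T a).card - if a ∈ B then 1 else 0) + (B.card - 1)) *
          D ^ ((S + 1) * R + 1) := by
          rw [pow_add p, pow_succ D, mul_comm (S + 1) R, pow_mul D]
          ring
      _ ≤ _ := by
          rw [show ∑ a, ((slice T a).card - if a ∈ B then 1 else 0) + (B.card - 1) = T.card - 1 by
            omega]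
          gcongr

lemma basedBound_le (hp : 0 ≤ p) (hH : ∀ e ∈ H, e.card = S + 1) (hK : 1 ≤ K) (hD : 0 ≤ D)
    (hd : ∀ t, 1 ≤ t → t ≤ S + 1 → (embedBound H S t : ℝ) ≤ K * p ^ (t - 1) * D)
    (T : Finset (Fin (S + 1) × Fin R × Fin S)) (σ : Fin (S + 1) × Fin R × Fin S → V)
    (hT : 1 ≤ T.card) :
    ((basedArrays H T σ).card : ℝ) ≤
      K ^ ((S + 1) * R + 1) * p ^ (T.card - 1) * D ^ ((S + 1) * R + 1) := by
  obtain ⟨a, ha⟩ := exists_slice_pos hT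
  refine basedBound_aux hH hp hD hd T σ {a} (by simp) (by simpa using ha) (fun _ => K ^ R) K _
    (fun _ => by positivity) (fun b hb => centredBound_le hH hd _ _ ?_) (fun _ _ => le_rfl)
    (by simpa using hd 1 le_rfl (by omega)) (le_of_eq ?_)
  · rw [Finset.mem_singleton.1 hb]; exact ha
  · rw [Finset.prod_const, Finset.card_univ, Fintype.card_fin, ← pow_mul, pow_succ, mul_comm R]

lemma basedBound_small (hp : 0 ≤ p) (hH : ∀ e ∈ H, e.card = S + 1) (hK : 1 ≤ K) (hθ : 0 ≤ θ)
    (hS : 2 ≤ S) (hD : 0 ≤ D)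
    (hd : ∀ t, 1 ≤ t → t ≤ S + 1 → (embedBound H S t : ℝ) ≤ K * p ^ (t - 1) * D)
    (hd' : ∀ t, 2 ≤ t → t ≤ S → (embedBound H S t : ℝ) ≤ θ * p ^ (t - 1) * D)
    (T : Finset (Fin (S + 1) × Fin R × Fin S)) (σ : Fin (S + 1) × Fin R × Fin S → V)
    (hT : 2 ≤ T.card) :
    ((basedArrays H T σ).card : ℝ) ≤
      θ * K ^ ((S + 1) * R + R + 1) * p ^ (T.card - 1) * D ^ ((S + 1) * R + 1) := by
  have hKR : 1 ≤ K ^ R := one_le_pow₀ hK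
  rcases exists_slice_two hT with ⟨a, ha⟩ | ⟨a, b, hab, ha, hb⟩
  · refine basedBound_aux hH hp hD hd T σ {a} (by simp)
      (fun b hb => by rw [Finset.mem_singleton.1 hb]; omega)
      (fun b => if b = a then θ * K ^ R else K ^ R) K _
      (fun _ => by split_ifs <;> positivity) (fun b hb => ?_) (fun b hb => ?_)
      (by simpa using hd 1 le_rfl (by omega)) ?_
    · rw [Finset.mem_singleton.1 hb, if_pos rfl]
      exact centredBound_small hp hH hK hθ hS hD hd hd' _ _ ha
    · rw [if_neg (by simpa using hb)]
    · have := prod_ite_eq_le a hKR (mul_nonneg hθ (by positivity : 0 ≤ K ^ R))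
      rw [Fintype.card_fin] at this
      refine (mul_le_mul_of_nonneg_right this (by linarith : 0 ≤ K)).trans (le_of_eq ?_)
      rw [pow_add, pow_add, pow_one, ← pow_mul, mul_comm R]
      ring
  · refine basedBound_aux hH hp hD hd T σ {a, b} (by simp)
      (fun c hc => by
        rcases Finset.mem_insert.1 hc with rfl | hc
        · omega
        · rw [Finset.mem_singleton.1 hc]; omega)
      (fun _ => K ^ R) θ _ (fun _ => by positivity)
      (fun c hc => centredBound_le hH hd _ _ ?_) (fun _ _ => le_rfl)
      (by rw [Finset.card_pair hab]; exact hd' 2 le_rfl hS) ?_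
    · rcases Finset.mem_insert.1 hc with rfl | hc
      · omega
      · rw [Finset.mem_singleton.1 hc]; omega
    · rw [Finset.prod_const, Finset.card_univ, Fintype.card_fin, ← pow_mul, mul_comm]
      refine mul_le_mul_of_nonneg_left (pow_le_pow_right₀ hK ?_) hθ
      rw [mul_comm R]
      omega

end PinnedBounds

section Tuples

/-- A bound on pinned tuples over an arbitrary index type gives a `PinBound`. -/
lemma pinBound_of_equiv {Γ V α : Type*} [Fintype Γ] [Fintype V] {k : ℕ} (e : α ≃ Fin k)
    (pt : Γ → α → V) {p M K : ℝ} {a : ℕ}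
    (h : ∀ T : Finset α, 1 ≤ T.card → a ≤ T.card → ∀ σ : α → V,
      ((Finset.univ.filter fun γ => ∀ x ∈ T, pt γ x = σ x).card : ℝ) ≤ K * p ^ (T.card - 1) * M) :
    PinBound (fun γ q => pt γ (e.symm q)) p M K a := by
  intro S hS ha σ
  have h1 := h (S.map e.symm.toEmbedding) (by simpa using hS.card_pos) (by simpa using ha)
    (fun x => σ (e x))
  rw [Finset.card_map] at h1
  refine le_trans (le_of_eq ?_) h1
  congr 2
  ext γ
  simp only [Finset.mem_filter, Finset.mem_univ, true_and, Finset.mem_map_equiv, Equiv.symm_symm]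
  exact ⟨fun h x hx => by simpa using h (e x) hx,
    fun h q hq => by simpa using h (e.symm q) (by simpa using hq)⟩

variable {V : Type} [Fintype V] (H : Finset (Finset V)) (R S : ℕ)

/-- The tuple lists the centre and the leaves of a star. -/
def IsStarTuple {V : Type} {R S : ℕ} (H : Finset (Finset V))
    (x : V × (Fin R → Fin S → V)) : Prop :=
  (∀ j, IsLeafTuple H x.1 (x.2 j)) ∧ Function.Injective fun y : Fin R × Fin S => x.2 y.1 y.2

/-- The tuple lists the base and the leaves of a constellation. -/
def IsConstellationTuple {V : Type} {R S : ℕ} (H : Finset (Finset V))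
    (x : (Fin (S + 1) → V) × (Fin (S + 1) → Fin R → Fin S → V)) : Prop :=
  Function.Injective x.1 ∧ Finset.univ.image x.1 ∈ H ∧
    (∀ a j, IsLeafTuple H (x.1 a) (x.2 a j)) ∧
    (Function.Injective fun y : Fin (S + 1) × Fin R × Fin S => x.2 y.1 y.2.1 y.2.2) ∧
    ∀ a b j l, x.2 a j l ≠ x.1 b

/-- The labelled stars of `H`. -/
abbrev StarTuple : Type := {x : V × (Fin R → Fin S → V) // IsStarTuple H x}

/-- The labelled constellations of `H`. -/
abbrev ConstellationTuple : Type :=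
  {x : (Fin (S + 1) → V) × (Fin (S + 1) → Fin R → Fin S → V) // IsConstellationTuple H x}

/-- Enumeration of the leaf positions of a constellation. -/
def constellationEquiv : Fin (S + 1) × Fin R × Fin S ≃ Fin ((S + 1) * (R * S)) :=
  (Equiv.prodCongr (Equiv.refl _) finProdFinEquiv).trans finProdFinEquiv

variable {H R S}

/-- The leaves of a labelled star. -/
def starPt (x : StarTuple H R S) (q : Fin (R * S)) : V :=
  x.1.2 (finProdFinEquiv.symm q).1 (finProdFinEquiv.symm q).2

/-- The leaves of a labelled constellation. -/
def constellationPt (x : ConstellationTuple H R S) (q : Fin ((S + 1) * (R * S))) : V :=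
  x.1.2 ((constellationEquiv R S).symm q).1 ((constellationEquiv R S).symm q).2.1
    ((constellationEquiv R S).symm q).2.2

lemma starPt_injective (x : StarTuple H R S) : Function.Injective (starPt x) := fun _ _ h =>
  finProdFinEquiv.symm.injective (x.2.2 h)

lemma constellationPt_injective (x : ConstellationTuple H R S) :
    Function.Injective (constellationPt x) := fun _ _ h =>
  (constellationEquiv R S).symm.injective (x.2.2.2.2.1 h)

variable {p D K θ : ℝ}

lemma starPt_pinBound (hH : ∀ e ∈ H, e.card = S + 1)
    (hd : ∀ t, 1 ≤ t → t ≤ S + 1 → (embedBound H S t : ℝ) ≤ K * p ^ (t - 1) * D) :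
    PinBound (starPt (H := H) (R := R) (S := S)) p (D ^ R) (K ^ R) 1 := by
  refine pinBound_of_equiv finProdFinEquiv
    (fun (x : StarTuple H R S) (y : Fin R × Fin S) => x.1.2 y.1 y.2) fun T hT _ σ => ?_
  refine le_trans ?_ (centredBound_le hH hd T σ hT)
  exact_mod_cast Finset.card_le_card_of_injOn Subtype.val (fun x hx => by
    simp only [Finset.coe_filter, Finset.mem_univ, true_and, Set.mem_ofPred_eq] at hx
    simpa [centredArrays, rootedArrays] using
      ⟨x.2.1, fun a b hab => hx (a, b) hab⟩) Subtype.val_injective.injOn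

lemma card_constellationTuple_pinned_le (T : Finset (Fin (S + 1) × Fin R × Fin S))
    (σ : Fin (S + 1) × Fin R × Fin S → V) :
    (Finset.univ.filter fun x : ConstellationTuple H R S =>
      ∀ y ∈ T, x.1.2 y.1 y.2.1 y.2.2 = σ y).card ≤ (basedArrays H T σ).card :=
  Finset.card_le_card_of_injOn Subtype.val (fun x hx => by
    simp only [Finset.coe_filter, Finset.mem_univ, true_and, Set.mem_ofPred_eq] at hx
    simp only [basedArrays, rootedArrays, Finset.coe_filter, Finset.mem_filter, Finset.mem_univ,
      true_and, Set.mem_ofPred_eq]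
    exact ⟨x.2.1, x.2.2.1, fun a => ⟨x.2.2.2.1 a, fun y hy => hx (a, y) (mem_slice.1 hy)⟩⟩)
    Subtype.val_injective.injOn

lemma constellationPt_pinBound (hp : 0 ≤ p) (hH : ∀ e ∈ H, e.card = S + 1) (hK : 1 ≤ K)
    (hD : 0 ≤ D)
    (hd : ∀ t, 1 ≤ t → t ≤ S + 1 → (embedBound H S t : ℝ) ≤ K * p ^ (t - 1) * D) :
    PinBound (constellationPt (H := H) (R := R) (S := S)) p (D ^ ((S + 1) * R + 1))
      (K ^ ((S + 1) * R + 1)) 1 := by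
  refine pinBound_of_equiv (constellationEquiv R S)
    (fun (x : ConstellationTuple H R S) y => x.1.2 y.1 y.2.1 y.2.2) fun T hT _ σ => ?_
  refine (Nat.cast_le.2 ?_).trans (basedBound_le hp hH hK hD hd T σ hT)
  convert card_constellationTuple_pinned_le T σ

lemma constellationPt_pinBound_small (hp : 0 ≤ p) (hH : ∀ e ∈ H, e.card = S + 1) (hK : 1 ≤ K)
    (hθ : 0 ≤ θ) (hS : 2 ≤ S) (hD : 0 ≤ D)
    (hd : ∀ t, 1 ≤ t → t ≤ S + 1 → (embedBound H S t : ℝ) ≤ K * p ^ (t - 1) * D)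
    (hd' : ∀ t, 2 ≤ t → t ≤ S → (embedBound H S t : ℝ) ≤ θ * p ^ (t - 1) * D) :
    PinBound (constellationPt (H := H) (R := R) (S := S)) p (D ^ ((S + 1) * R + 1))
      (θ * K ^ ((S + 1) * R + R + 1)) 2 := by
  refine pinBound_of_equiv (constellationEquiv R S)
    (fun (x : ConstellationTuple H R S) y => x.1.2 y.1 y.2.1 y.2.2) fun T _ hT σ => ?_
  refine (Nat.cast_le.2 ?_).trans (basedBound_small hp hH hK hθ hS hD hd hd' T σ hT)
  convert card_constellationTuple_pinned_le T σ

end Tuples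

section Conversion

variable {V : Type} [Fintype V] {H : Finset (Finset V)} {R S : ℕ}

/-- The edges of the star listed by a tuple. -/
noncomputable def starOf (v : V) (g : Fin R → Fin S → V) : Finset (Finset V) :=
  Finset.univ.image fun j => insert v (Finset.univ.image (g j))

/-- The assignment of stars given by a tuple listing a constellation. -/
noncomputable def starAssignment (f : Fin (S + 1) → V) (g : Fin (S + 1) → Fin R → Fin S → V)
    (w : V) :
    Finset (Finset V) :=
  (Finset.univ.filter fun a => f a = w).biUnion fun a => starOf (f a) (g a)

lemma mem_sup_starOf {v u : V} {g : Fin R → Fin S → V} :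
    u ∈ (starOf v g).sup id ↔ ∃ j, u = v ∨ ∃ l, g j l = u := by
  simp [starOf, Finset.mem_sup]

lemma starAssignment_apply {f : Fin (S + 1) → V} (hf : Function.Injective f)
    (g : Fin (S + 1) → Fin R → Fin S → V) (a : Fin (S + 1)) :
    starAssignment f g (f a) = starOf (f a) (g a) := by
  have : (Finset.univ.filter fun b => f b = f a) = {a} := by
    ext b
    simp [hf.eq_iff]
  simp [starAssignment, this]

lemma exists_enumeration {α : Type*} {A : Finset α} {n : ℕ} (hA : A.card = n) :
    ∃ f : Fin n → α, Function.Injective f ∧ Finset.univ.image f = A := by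
  refine ⟨fun l => (A.equivFinOfCardEq hA).symm l,
    Subtype.val_injective.comp (A.equivFinOfCardEq hA).symm.injective, ?_⟩
  ext u
  simp only [Finset.mem_image, Finset.mem_univ, true_and]
  exact ⟨fun ⟨l, hl⟩ => hl ▸ Subtype.coe_prop _, fun hu => ⟨A.equivFinOfCardEq hA ⟨u, hu⟩, by simp⟩⟩

/-- Every rainbow star is listed by a tuple. -/
lemma exists_starTuple (hH : ∀ e ∈ H, e.card = S + 1) {ψ : V → Option (Fin (R + 1))}
    {P : Finset (Finset V)} {v : V} {i : Fin (R + 1)} (hP : IsStar H R P v)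
    (hψ : IsRainbowStar (R + 1) ψ P v i) :
    ∃ g : Fin R → Fin S → V, IsStarTuple H (v, g) ∧ starOf v g = P ∧
      ∀ j l, ψ (g j l) = some (i.succAbove j) := by
  obtain ⟨hcard, hPH, hv, hinter⟩ := hP
  obtain ⟨col, hinj, hne, hcol⟩ := hψ
  have himg : P.image col = Finset.univ.erase i := by
    refine Finset.eq_of_subset_of_card_le (fun c hc => ?_) ?_
    · obtain ⟨e, he, rfl⟩ := Finset.mem_image.1 hc
      simpa using hne e he
    · rw [Finset.card_image_of_injOn hinj, hcard]
      simp
  have hE : ∀ j, ∃ e ∈ P, col e = i.succAbove j := fun j => by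
    have : i.succAbove j ∈ P.image col := by simp [himg, Fin.succAbove_ne]
    simpa using this
  choose E hEP hEcol using hE
  have hEinj : Function.Injective E := fun j j' h =>
    Fin.succAbove_right_injective (p := i) (by rw [← hEcol, ← hEcol, h])
  have hg : ∀ j, ∃ h : Fin S → V, Function.Injective h ∧
      Finset.univ.image h = (E j).erase v := fun j =>
    exists_enumeration (by rw [Finset.card_erase_of_mem (hv _ (hEP j)), hH _ (hPH (hEP j))]; rfl)
  choose g hginj hgimg using hg
  have hgE : ∀ j, insert v (Finset.univ.image (g j)) = E j := fun j => by
    rw [hgimg, Finset.insert_erase (hv _ (hEP j))]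
  have hmem : ∀ j l, g j l ≠ v ∧ g j l ∈ E j := fun j l => by
    have : g j l ∈ (E j).erase v := hgimg j ▸ Finset.mem_image_of_mem _ (Finset.mem_univ l)
    simpa using this
  refine ⟨g, ⟨fun j => ⟨?_, hginj j, fun l => (hmem j l).1⟩, ?_⟩, ?_, fun j l => ?_⟩
  · exact (hgE j).symm ▸ hPH (hEP j)
  · rintro ⟨j, l⟩ ⟨j', l'⟩ h
    simp only at h
    obtain rfl | hj := eq_or_ne j j'
    · rw [hginj j h]
    · have h1 : g j l ∈ E j ∩ E j' := Finset.mem_inter.2 ⟨(hmem j l).2, h ▸ (hmem j' l').2⟩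
      rw [hinter _ (hEP j) _ (hEP j') (hEinj.ne hj)] at h1
      exact absurd (Finset.mem_singleton.1 h1) (hmem j l).1
  · refine Finset.eq_of_subset_of_card_le (fun e he => ?_) ?_
    · obtain ⟨j, -, rfl⟩ := Finset.mem_image.1 he
      exact (hgE j).symm ▸ hEP j
    · rw [starOf, funext hgE, Finset.card_image_of_injective _ hEinj, hcard]
      simp
  · rw [hcol _ (hEP j) _ (hmem j l).2 (hmem j l).1, hEcol]

/-- A suitably coloured star tuple lists a rainbow star. -/
lemma isStar_starOf (hS : 1 ≤ S) {ψ : V → Option (Fin (R + 1))} {v : V} {g : Fin R → Fin S → V}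
    {i : Fin (R + 1)} (hg : IsStarTuple H (v, g))
    (hψ : ∀ j l, ψ (g j l) = some (i.succAbove j)) :
    IsStar H R (starOf v g) v ∧ IsRainbowStar (R + 1) ψ (starOf v g) v i := by
  set E : Fin R → Finset V := fun j => insert v (Finset.univ.image (g j)) with hEdef
  have hmem : ∀ j u, u ∈ E j ↔ u = v ∨ ∃ l, g j l = u := fun j u => by simp [E]
  have hsep : ∀ j l j' l', g j l = g j' l' → j = j' := fun j l j' l' h =>
    congrArg Prod.fst (@hg.2 (j, l) (j', l') h)
  have hne : ∀ j l, g j l ≠ v := fun j l => (hg.1 j).2.2 l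
  have hEinj : Function.Injective E := fun j j' h => by
    have h1 : g j ⟨0, hS⟩ ∈ E j' := h ▸ (hmem j _).2 (Or.inr ⟨_, rfl⟩)
    obtain h1 | ⟨l, hl⟩ := (hmem _ _).1 h1
    · exact absurd h1 (hne _ _)
    · exact (hsep _ _ _ _ hl).symm
  have hall : ∀ Q : Finset V → Prop, (∀ e ∈ starOf v g, Q e) ↔ ∀ j, Q (E j) := fun Q => by
    simp [starOf, E]
  refine ⟨⟨?_, (hall _).2 fun j => (hg.1 j).1, (hall _).2 fun j => by simp [E], ?_⟩,
    Function.extend E i.succAbove fun _ => i, ?_, ?_, ?_⟩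
  · rw [starOf, Finset.card_image_of_injective _ hEinj]
    simp
  · rw [hall]
    intro j
    rw [hall]
    intro j' h
    ext u
    rw [Finset.mem_inter, hmem, hmem, Finset.mem_singleton]
    constructor
    · rintro ⟨rfl | ⟨l, rfl⟩, h2 | ⟨l', h2⟩⟩
      · rfl
      · rfl
      · exact h2
      · exact absurd (hsep _ _ _ _ h2) fun h' => h (by rw [h'])
    · exact fun h => ⟨Or.inl h, Or.inl h⟩
  · intro e he e' he'
    obtain ⟨j, -, rfl⟩ := Finset.mem_image.1 (Finset.mem_coe.1 he)
    obtain ⟨j', -, rfl⟩ := Finset.mem_image.1 (Finset.mem_coe.1 he')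
    change Function.extend E _ _ (E j) = Function.extend E _ _ (E j') → E j = E j'
    rw [hEinj.extend_apply, hEinj.extend_apply]
    exact fun h => by rw [Fin.succAbove_right_injective h]
  · rw [hall]
    intro j
    rw [hEinj.extend_apply]
    exact Fin.succAbove_ne i j
  · rw [hall]
    intro j u hu huv
    rw [hEinj.extend_apply]
    obtain h | ⟨l, rfl⟩ := (hmem _ _).1 hu
    · exact absurd h huv
    · exact hψ j l

/-- Every rainbow constellation is listed by a tuple. -/
lemma exists_constellationTuple (hH : ∀ e ∈ H, e.card = S + 1) {ψ : V → Option (Fin (R + 1))}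
    {A : Finset V} {F : V → Finset (Finset V)} {i : Fin (R + 1)} (hA : IsConstellation H R A F)
    (hψ : ∀ v ∈ A, IsRainbowStar (R + 1) ψ (F v) v i) :
    ∃ f : Fin (S + 1) → V, ∃ g : Fin (S + 1) → Fin R → Fin S → V,
      IsConstellationTuple H (f, g) ∧ Finset.univ.image f = A ∧ starAssignment f g = F ∧
      ∀ a j l, ψ (g a j l) = some (i.succAbove j) := by
  obtain ⟨hAH, hstar, hempty, hdisj⟩ := hA
  obtain ⟨f, hf, hfA⟩ := exists_enumeration (hH A hAH)
  have hfm : ∀ a, f a ∈ A := fun a => hfA ▸ Finset.mem_image_of_mem _ (Finset.mem_univ a)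
  choose g hg hgF hgψ using fun a => exists_starTuple hH (hstar _ (hfm a)) (hψ _ (hfm a))
  have hsep : ∀ a b, a ≠ b → ∀ u, u ∈ (starOf (f a) (g a)).sup id →
      u ∉ (starOf (f b) (g b)).sup id := fun a b hab u hu hu' => by
    have := hdisj _ (hfm a) _ (hfm b) (hf.ne hab)
    rw [← hgF, ← hgF] at this
    exact Finset.disjoint_left.1 this hu hu'
  refine ⟨f, g, ⟨hf, ?_, fun a j => (hg a).1 j, ?_, ?_⟩, hfA, ?_, hgψ⟩
  · exact hfA.symm ▸ hAH
  · rintro ⟨a, j, l⟩ ⟨a', j', l'⟩ h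
    simp only at h
    obtain rfl | ha := eq_or_ne a a'
    · have := @(hg a).2 (j, l) (j', l') h
      rw [this]
    · exact absurd (mem_sup_starOf.2 ⟨j', Or.inr ⟨l', h.symm⟩⟩)
        (hsep a a' ha _ (mem_sup_starOf.2 ⟨j, Or.inr ⟨l, rfl⟩⟩))
  · intro a b j l h
    obtain rfl | ha := eq_or_ne a b
    · exact ((hg a).1 j).2.2 l h
    · exact hsep a b ha _ (mem_sup_starOf.2 ⟨j, Or.inr ⟨l, rfl⟩⟩)
        (mem_sup_starOf.2 ⟨j, Or.inl h⟩)
  · funext w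
    by_cases hw : w ∈ A
    · obtain ⟨a, -, rfl⟩ := Finset.mem_image.1 (hfA.symm ▸ hw)
      rw [starAssignment_apply hf, hgF]
    · rw [hempty w hw, starAssignment, Finset.filter_false_of_mem, Finset.biUnion_empty]
      rintro a - rfl
      exact hw (hfm a)

/-- A suitably coloured constellation tuple lists a rainbow constellation. -/
lemma isConstellation_starAssignment (hS : 1 ≤ S) {ψ : V → Option (Fin (R + 1))}
    {f : Fin (S + 1) → V} {g : Fin (S + 1) → Fin R → Fin S → V} {i : Fin (R + 1)}
    (hg : IsConstellationTuple H (f, g)) (hψ : ∀ a j l, ψ (g a j l) = some (i.succAbove j)) :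
    IsConstellation H R (Finset.univ.image f) (starAssignment f g) ∧
      ∀ v ∈ Finset.univ.image f, IsRainbowStar (R + 1) ψ (starAssignment f g v) v i := by
  obtain ⟨hf, hfH, hleaf, hinj, hne⟩ := hg
  simp only at hf hfH hleaf hinj hne
  have hall : ∀ Q : V → Prop, (∀ v ∈ Finset.univ.image f, Q v) ↔ ∀ a, Q (f a) := fun Q => by simp
  have hstar : ∀ a, IsStar H R (starAssignment f g (f a)) (f a) ∧
      IsRainbowStar (R + 1) ψ (starAssignment f g (f a)) (f a) i := fun a => by
    rw [starAssignment_apply hf]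
    exact isStar_starOf hS ⟨hleaf a, fun y y' h =>
      congrArg Prod.snd (@hinj (a, y) (a, y') h)⟩ (hψ a)
  refine ⟨⟨hfH, (hall _).2 fun a => (hstar a).1, fun v hv => ?_, ?_⟩,
    (hall _).2 fun a => (hstar a).2⟩
  · rw [starAssignment, Finset.filter_false_of_mem, Finset.biUnion_empty]
    rintro a - rfl
    exact hv (Finset.mem_image_of_mem _ (Finset.mem_univ a))
  · rw [hall]
    intro a
    rw [hall]
    intro b hab
    rw [starAssignment_apply hf, starAssignment_apply hf, Finset.disjoint_left]
    intro u hu hu'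
    obtain ⟨j, rfl | ⟨l, rfl⟩⟩ := mem_sup_starOf.1 hu
    · obtain ⟨j', h | ⟨l', h⟩⟩ := mem_sup_starOf.1 hu'
      · exact hab h
      · exact hne _ _ _ _ h
    · obtain ⟨j', h | ⟨l', h⟩⟩ := mem_sup_starOf.1 hu'
      · exact hne _ _ _ _ h
      · have : b = a := congrArg Prod.fst (@hinj (b, j', l') (a, j, l) h)
        exact hab (by rw [this])

end Conversion

section Counting

variable {V : Type} [Fintype V] {H : Finset (Finset V)} {R S : ℕ}

/-- The colours of the leaves of an `i`-rainbow star tuple. -/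
def starColour (R S : ℕ) (i : Fin (R + 1)) (q : Fin (R * S)) : Fin (R + 1) :=
  i.succAbove (finProdFinEquiv.symm q).1

/-- The colours of the leaves of an `i`-rainbow constellation tuple. -/
def constellationColour (R S : ℕ) (i : Fin (R + 1)) (q : Fin ((S + 1) * (R * S))) : Fin (R + 1) :=
  i.succAbove ((constellationEquiv R S).symm q).2.1

lemma mem_colourClass {r : ℕ} {ψ : V → Option (Fin r)} {j : Fin r} {v : V} :
    v ∈ colourClass ψ j ↔ ψ v = some j := by
  simp [colourClass]

lemma mem_classPairs {Γ : Type*} [Fintype Γ] {k r : ℕ} {pt : Γ → Fin k → V}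
    {χ : Fin r → Fin k → Fin r} {C : Fin r → Finset V} {b : Fin r × Γ} :
    b ∈ classPairs pt χ C ↔ ∀ q, pt b.2 q ∈ C (χ b.1 q) := by
  simp [classPairs, inClass]

lemma mem_classPairs_starPt {ψ : V → Option (Fin (R + 1))} {i : Fin (R + 1)}
    {x : StarTuple H R S} :
    (i, x) ∈ classPairs starPt (starColour R S) (colourClass ψ) ↔
      ∀ j l, ψ (x.1.2 j l) = some (i.succAbove j) := by
  simp only [mem_classPairs, mem_colourClass, starPt, starColour]
  exact ⟨fun h j l => by simpa using h (finProdFinEquiv (j, l)), fun h q => h _ _⟩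

lemma mem_classPairs_constellationPt {ψ : V → Option (Fin (R + 1))} {i : Fin (R + 1)}
    {x : ConstellationTuple H R S} :
    (i, x) ∈ classPairs constellationPt (constellationColour R S) (colourClass ψ) ↔
      ∀ a j l, ψ (x.1.2 a j l) = some (i.succAbove j) := by
  simp only [mem_classPairs, mem_colourClass, constellationPt, constellationColour]
  exact ⟨fun h a j l => by simpa using h (constellationEquiv R S (a, j, l)), fun h q => h _ _ _⟩

lemma numRainbowStarPairs_le (hH : ∀ e ∈ H, e.card = S + 1) (ψ : V → Option (Fin (R + 1))) :
    numRainbowStarPairs (R + 1) H ψ ≤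
      classCount (starPt (H := H) (R := R) (S := S)) (starColour R S) (colourClass ψ) := by
  rw [← card_classPairs, numRainbowStarPairs, Nat.card_eq_fintype_card, Fintype.card_subtype]
  refine le_trans (Finset.card_le_card ?_) (Finset.card_image_le (f := fun b =>
    (b.1, starOf b.2.1.1 b.2.1.2, b.2.1.1)))
  rintro ⟨i, P, v⟩ hP
  simp only [Finset.mem_filter, Finset.mem_univ, true_and] at hP
  obtain ⟨g, hg, rfl, hψ⟩ := exists_starTuple hH hP.1 hP.2
  exact Finset.mem_image.2 ⟨(i, ⟨(v, g), hg⟩), mem_classPairs_starPt.2 hψ, rfl⟩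

lemma numRainbowConstellations_le (hH : ∀ e ∈ H, e.card = S + 1)
    (ψ : V → Option (Fin (R + 1))) :
    numRainbowConstellations (R + 1) H ψ ≤
      classCount (constellationPt (H := H) (R := R) (S := S)) (constellationColour R S)
        (colourClass ψ) := by
  rw [← card_classPairs, numRainbowConstellations, Nat.card_eq_fintype_card, Fintype.card_subtype]
  refine le_trans (Finset.card_le_card ?_) (Finset.card_image_le (f := fun b =>
    (Finset.univ.image b.2.1.1, starAssignment b.2.1.1 b.2.1.2)))
  rintro ⟨A, F⟩ hA
  simp only [Finset.mem_filter, Finset.mem_univ, true_and] at hA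
  obtain ⟨hA, i, hi⟩ := hA
  obtain ⟨f, g, hg, rfl, rfl, hψ⟩ := exists_constellationTuple hH hA hi
  exact Finset.mem_image.2 ⟨(i, ⟨(f, g), hg⟩), mem_classPairs_constellationPt.2 hψ, rfl⟩

lemma card_sup_starOf_le (v : V) (g : Fin R → Fin S → V) :
    ((starOf v g).sup id).card ≤ R * (S + 1) := by
  have h1 : (starOf v g).sup id ⊆
      Finset.univ.biUnion fun j => insert v (Finset.univ.image (g j)) := fun u hu => by
    simpa using mem_sup_starOf.1 hu
  refine (Finset.card_le_card h1).trans ((Finset.card_biUnion_le_card_mul _ _ (S + 1)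
    fun j _ => (Finset.card_insert_le _ _).trans ?_).trans (by simp))
  simpa using Finset.card_image_le (s := (Finset.univ : Finset (Fin S))) (f := g j)

/-- The maximal number of coloured tuples listing the same star. -/
def starMultiplicity (R S : ℕ) : ℕ := (R + 1) * ((R * (S + 1)) ^ S) ^ R

/-- The maximal number of tuples listing the same constellation. -/
def constellationMultiplicity (R S : ℕ) : ℕ :=
  (S + 1) ^ (S + 1) * ((((S + 1) * (R * (S + 1))) ^ S) ^ R) ^ (S + 1)

lemma classCount_starPt_le (hS : 1 ≤ S) (ψ : V → Option (Fin (R + 1))) :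
    classCount (starPt (H := H) (R := R) (S := S)) (starColour R S) (colourClass ψ) ≤
      starMultiplicity R S * numRainbowStars (R + 1) H ψ := by
  rw [← card_classPairs, numRainbowStars, Nat.card_eq_fintype_card, Fintype.card_subtype]
  refine (Finset.card_le_mul_card_image (f := fun b => (starOf b.2.1.1 b.2.1.2, b.2.1.1)) _
    (starMultiplicity R S) ?_).trans (Nat.mul_le_mul_left _ (Finset.card_le_card ?_))
  · intro P hP
    obtain ⟨⟨-, x₀⟩, -, rfl⟩ := Finset.mem_image.1 hP
    set U := (starOf x₀.1.1 x₀.1.2).sup id with hU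
    refine (Finset.card_le_card_of_injOn (fun b => (b.1, b.2.1.2))
      (t := (Finset.univ : Finset (Fin (R + 1))) ×ˢ
        Fintype.piFinset fun _ : Fin R => Fintype.piFinset fun _ : Fin S => U) ?_ ?_).trans ?_
    · rintro ⟨i, x⟩ hx
      simp only [Finset.coe_filter, Set.mem_ofPred_eq, Prod.mk.injEq] at hx
      simp only [Finset.coe_product, Finset.coe_univ, Set.mem_prod, Set.mem_univ, true_and,
        Finset.mem_coe, Fintype.mem_piFinset]
      intro j l
      rw [hU, ← hx.2.1]
      exact mem_sup_starOf.2 ⟨j, Or.inr ⟨l, rfl⟩⟩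
    · rintro ⟨i, x⟩ hx ⟨i', x'⟩ hx' h
      simp only [Finset.coe_filter, Set.mem_ofPred_eq, Prod.mk.injEq] at hx hx' h
      obtain ⟨rfl, h⟩ := h
      rw [Subtype.ext (Prod.ext (hx.2.2.trans hx'.2.2.symm) h)]
    · rw [Finset.card_product]
      simp only [Finset.card_univ, Fintype.card_fin, Fintype.card_piFinset, Finset.prod_const]
      exact Nat.mul_le_mul_left _ (Nat.pow_le_pow_left (Nat.pow_le_pow_left
        (card_sup_starOf_le _ _) _) _)
  · intro P hP
    obtain ⟨⟨i, x⟩, hx, rfl⟩ := Finset.mem_image.1 hP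
    have := isStar_starOf hS x.2 (mem_classPairs_starPt.1 hx)
    exact Finset.mem_filter.2 ⟨Finset.mem_univ _, this.1, i, this.2⟩

lemma classCount_constellationPt_le (hS : 1 ≤ S) (ψ : V → Option (Fin (R + 1))) :
    classCount (constellationPt (H := H) (R := R) (S := S)) (constellationColour R S)
        (colourClass ψ) ≤
      constellationMultiplicity R S * numRainbowConstPairs (R + 1) H ψ := by
  rw [← card_classPairs, numRainbowConstPairs, Nat.card_eq_fintype_card, Fintype.card_subtype]
  refine (Finset.card_le_mul_card_image
    (f := fun b => (b.1, Finset.univ.image b.2.1.1, starAssignment b.2.1.1 b.2.1.2)) _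
    (constellationMultiplicity R S) ?_).trans (Nat.mul_le_mul_left _ (Finset.card_le_card ?_))
  · intro P hP
    obtain ⟨⟨i₀, x₀⟩, -, rfl⟩ := Finset.mem_image.1 hP
    set A := Finset.univ.image x₀.1.1 with hA
    set U := Finset.univ.biUnion fun a => (starOf (x₀.1.1 a) (x₀.1.2 a)).sup id with hU
    have hAcard : A.card ≤ S + 1 := by
      simpa using Finset.card_image_le (s := (Finset.univ : Finset (Fin (S + 1)))) (f := x₀.1.1)
    have hUcard : U.card ≤ (S + 1) * (R * (S + 1)) :=
      (Finset.card_biUnion_le_card_mul _ _ _ fun a _ => card_sup_starOf_le _ _).trans (by simp)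
    refine (Finset.card_le_card_of_injOn (fun b => b.2.1)
      (t := (Fintype.piFinset fun _ : Fin (S + 1) => A) ×ˢ Fintype.piFinset fun _ : Fin (S + 1) =>
        Fintype.piFinset fun _ : Fin R => Fintype.piFinset fun _ : Fin S => U) ?_ ?_).trans ?_
    · rintro ⟨i, x⟩ hx
      simp only [Finset.coe_filter, Set.mem_ofPred_eq, Prod.mk.injEq] at hx
      obtain ⟨-, -, hxA, hxF⟩ := hx
      have hxm : ∀ a, x.1.1 a ∈ A := fun a =>
        hxA ▸ Finset.mem_image_of_mem _ (Finset.mem_univ a)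
      simp only [Finset.coe_product, Set.mem_prod, Finset.mem_coe, Fintype.mem_piFinset]
      refine ⟨hxm, fun a j l => ?_⟩
      obtain ⟨b, -, hb⟩ := Finset.mem_image.1 (hxm a)
      refine Finset.mem_biUnion.2 ⟨b, Finset.mem_univ b, ?_⟩
      rw [← starAssignment_apply x₀.2.1, ← hxF, hb, starAssignment_apply x.2.1]
      exact mem_sup_starOf.2 ⟨j, Or.inr ⟨l, rfl⟩⟩
    · rintro ⟨i, x⟩ hx ⟨i', x'⟩ hx' h
      simp only [Finset.coe_filter, Set.mem_ofPred_eq, Prod.mk.injEq] at hx hx' h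
      rw [hx.2.1, hx'.2.1, Subtype.ext h]
    · rw [Finset.card_product]
      simp only [Finset.card_univ, Fintype.card_fin, Fintype.card_piFinset, Finset.prod_const]
      exact Nat.mul_le_mul (Nat.pow_le_pow_left hAcard _) (Nat.pow_le_pow_left
        (Nat.pow_le_pow_left (Nat.pow_le_pow_left hUcard _) _) _)
  · intro P hP
    obtain ⟨⟨i, x⟩, hx, rfl⟩ := Finset.mem_image.1 hP
    exact Finset.mem_filter.2 ⟨Finset.mem_univ _,
      isConstellation_starAssignment hS x.2 (mem_classPairs_constellationPt.1 hx)⟩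

end Counting

section Averaging

variable {V : Type} [Fintype V]

/-- Prescribing the values of a colouring on `k` points costs a factor of at most `r ^ k`. -/
lemma card_colourings_le {k r : ℕ} {q : Fin k → V} (hq : Function.Injective q) (c : Fin k → Fin r) :
    Fintype.card (V → Fin r) ≤
      r ^ k * (Finset.univ.filter fun f : V → Fin r => ∀ i, f (q i) = c i).card := by
  rw [← Finset.card_univ]
  refine (Finset.card_le_mul_card_image (f := fun f : V → Fin r => Function.extend q c f) _
    (r ^ k) ?_).trans (Nat.mul_le_mul_left _ (Finset.card_le_card ?_))
  · intro h _
    refine (Finset.card_le_card_of_injOn (t := (Finset.univ : Finset (Fin k → Fin r)))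
      (fun f => f ∘ q) (fun _ _ => Finset.mem_coe.2 (Finset.mem_univ _)) ?_).trans (by simp)
    intro f hf f' hf' hff
    simp only [Finset.coe_filter, Finset.mem_univ, true_and, Set.mem_ofPred_eq] at hf hf'
    funext v
    by_cases hv : ∃ i, q i = v
    · obtain ⟨i, rfl⟩ := hv
      exact congrFun hff i
    · have := congrFun (hf.trans hf'.symm) v
      rwa [Function.extend_apply' _ _ _ hv, Function.extend_apply' _ _ _ hv] at this
  · intro f hf
    obtain ⟨f, -, rfl⟩ := Finset.mem_image.1 hf
    exact Finset.mem_filter.2 ⟨Finset.mem_univ _, fun i => hq.extend_apply _ _ i⟩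

/-- Any family of sets can be refined to the colour classes of a partial colouring while
preserving a positive proportion of the tuples respecting it. -/
lemma exists_colouring {Γ : Type*} [Fintype Γ] {k r : ℕ} (hr : 0 < r) (pt : Γ → Fin k → V)
    (hpt : ∀ x, Function.Injective (pt x)) (χ : Fin r → Fin k → Fin r) (C : Fin r → Finset V) :
    ∃ ψ : V → Option (Fin r), (∀ j, colourClass ψ j ⊆ C j) ∧
      classCount pt χ C ≤ r ^ k * classCount pt χ (colourClass ψ) := by
  let ψ : (V → Fin r) → V → Option (Fin r) := fun f v => if v ∈ C (f v) then some (f v) else none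
  have hψ : ∀ f v j, v ∈ colourClass (ψ f) j ↔ v ∈ C j ∧ f v = j := fun f v j => by
    simp only [mem_colourClass, ψ]
    split_ifs with h
    · simp only [Option.some.injEq]
      exact ⟨fun h' => ⟨h' ▸ h, h'⟩, And.right⟩
    · simp only [false_iff]
      rintro ⟨h', rfl⟩
      exact h h'
  have : Nonempty (V → Fin r) := ⟨fun _ => ⟨0, hr⟩⟩
  have hsum : ∑ _f : V → Fin r, classCount pt χ C ≤
      ∑ f, r ^ k * classCount pt χ (colourClass (ψ f)) := by
    have h1 : ∀ f, classPairs pt χ (colourClass (ψ f)) =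
        (classPairs pt χ C).filter fun b => ∀ q, f (pt b.2 q) = χ b.1 q := fun f => by
      ext b
      simp only [Finset.mem_filter, mem_classPairs, hψ, forall_and]
    simp_rw [← card_classPairs, h1, ← Finset.mul_sum, Finset.card_filter]
    rw [Finset.sum_comm, Finset.sum_const, Finset.card_univ, smul_eq_mul, mul_comm, Finset.mul_sum,
      ← smul_eq_mul, ← Finset.sum_const]
    refine Finset.sum_le_sum fun b _ => ?_
    rw [← Finset.card_filter]
    exact card_colourings_le (hpt b.2) (χ b.1)
  obtain ⟨f, -, hf⟩ := Finset.exists_le_of_sum_le Finset.univ_nonempty hsum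
  exact ⟨ψ f, fun j v hv => ((hψ f v j).1 hv).1, hf⟩

lemma classCount_mono {Γ : Type*} [Fintype Γ] {k r : ℕ} (pt : Γ → Fin k → V)
    (χ : Fin r → Fin k → Fin r) {C C' : Fin r → Finset V} (h : ∀ j, C j ⊆ C' j) :
    classCount pt χ C ≤ classCount pt χ C' := by
  rw [← card_classPairs, ← card_classPairs]
  exact Finset.card_le_card fun b hb => mem_classPairs.2 fun q => h _ (mem_classPairs.1 hb q)

/-- The rainbow star-constellation property in terms of families of sets. -/
lemma classCount_starPt_le_of_constellationPt {H : Finset (Finset V)} {R S : ℕ} (hS : 1 ≤ S)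
    (hH : ∀ e ∈ H, e.card = S + 1) {β b γ : ℝ}
    (hsc : ∀ ψ : V → Option (Fin (R + 1)), b ≤ (numRainbowStars (R + 1) H ψ : ℝ) →
      γ ≤ (numRainbowConstellations (R + 1) H ψ : ℝ))
    (hb : ((R + 1) ^ (R * S) * starMultiplicity R S : ℕ) * b ≤ β) (C : Fin (R + 1) → Finset V)
    (hC : (classCount (constellationPt (H := H) (R := R) (S := S)) (constellationColour R S) C : ℝ)
      < γ) :
    (classCount (starPt (H := H) (R := R) (S := S)) (starColour R S) C : ℝ) ≤ β := by
  obtain ⟨ψ, hψ, hle⟩ := exists_colouring R.succ_pos (starPt (H := H) (R := R) (S := S))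
    starPt_injective (starColour R S) C
  have h1 : (numRainbowStars (R + 1) H ψ : ℝ) < b := by
    by_contra! h
    refine absurd ((hsc ψ h).trans ?_) hC.not_ge
    exact_mod_cast (numRainbowConstellations_le hH ψ).trans (classCount_mono _ _ hψ)
  have h2 := hle.trans (Nat.mul_le_mul_left _ (classCount_starPt_le hS ψ))
  rw [← mul_assoc] at h2
  refine le_trans (Nat.cast_le.2 h2) (le_trans ?_ hb)
  rw [Nat.cast_mul]
  exact mul_le_mul_of_nonneg_left h1.le (Nat.cast_nonneg _)

end Averaging

section Density

variable {V : Type} [Fintype V] {H : Finset (Finset V)} {S : ℕ}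

lemma card_vertices_pos (hne : H.Nonempty) (hH : ∀ e ∈ H, e.card = S + 1) :
    0 < Fintype.card V := by
  obtain ⟨e, he⟩ := hne
  have : e.card ≤ Fintype.card V := Finset.card_le_univ e
  have := hH e he
  omega

lemma pH_pos (s : ℕ) (hne : H.Nonempty) (hN : 0 < Fintype.card V) : 0 < pH s H := by
  have h1 : (0 : ℝ) < Fintype.card V := by exact_mod_cast hN
  have h2 : (0 : ℝ) < H.card := by exact_mod_cast hne.card_pos
  exact Real.rpow_pos_of_pos (div_pos h1 h2) _

lemma pH_pow (hS : 1 ≤ S) : pH (S + 1) H ^ S = (Fintype.card V : ℝ) / H.card := by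
  have hS' : (S : ℝ) ≠ 0 := by exact_mod_cast (by omega : S ≠ 0)
  rw [pH, ← Real.rpow_natCast, ← Real.rpow_mul (by positivity)]
  push_cast
  rw [add_sub_cancel_right, one_div, inv_mul_cancel₀ hS', Real.rpow_one]

lemma maxDeg_uniform_le (hH : ∀ e ∈ H, e.card = S + 1) : maxDeg H (S + 1) ≤ 1 := by
  refine Finset.sup_le fun T hT => Finset.card_le_one.2 ?_
  have hT' : T.card = S + 1 := (Finset.mem_filter.1 hT).2
  have key : ∀ e ∈ H.filter fun e => T ⊆ e, T = e := fun e he =>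
    Finset.eq_of_subset_of_card_le (Finset.mem_filter.1 he).2
      (by rw [hH e (Finset.mem_filter.1 he).1, hT'])
  exact fun e he e' he' => (key e he).symm.trans (key e' he')

lemma degH_le_maxDeg (T : Finset V) : degH H T ≤ maxDeg H T.card :=
  Finset.le_sup (f := degH H) (Finset.mem_filter.2 ⟨Finset.mem_univ T, rfl⟩)

lemma card_edges_le (hS : 1 ≤ S) (hH : ∀ e ∈ H, e.card = S + 1) :
    H.card ≤ Fintype.card V ^ 2 * maxDeg H 2 := by
  have h1 : H ⊆ ((Finset.univ : Finset V).powersetCard 2).biUnion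
      fun T => H.filter fun e => T ⊆ e := fun e he => by
    obtain ⟨T, hT, hT2⟩ := Finset.exists_subset_card_eq (s := e) (n := 2) (by rw [hH e he]; omega)
    exact Finset.mem_biUnion.2 ⟨T, Finset.mem_powersetCard.2 ⟨Finset.subset_univ _, hT2⟩,
      Finset.mem_filter.2 ⟨he, hT⟩⟩
  refine (Finset.card_le_card h1).trans ((Finset.card_biUnion_le_card_mul _ _ (maxDeg H 2)
    fun T hT => ?_).trans (Nat.mul_le_mul_right _ ?_))
  · have := degH_le_maxDeg (H := H) T
    rwa [(Finset.mem_powersetCard.1 hT).2] at this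
  · rw [Finset.card_powersetCard, Finset.card_univ]
    exact Nat.choose_le_pow _ _

lemma embedBound_le_of_maxDeg_le {p q D M ε : ℝ} (hp : 0 ≤ p) (hq : 0 ≤ q) (hD : 0 ≤ D)
    (hM : 1 ≤ M) (hε : 0 ≤ ε) (hqp : q ≤ M * p) {t : ℕ} (ht : t ≤ S + 1)
    (h : (maxDeg H t : ℝ) ≤ ε * q ^ (t - 1) * D) :
    (embedBound H S t : ℝ) ≤ (S + 1) ^ (S + 1) * M ^ S * ε * p ^ (t - 1) * D := by
  have h1 : q ^ (t - 1) ≤ M ^ S * p ^ (t - 1) := by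
    refine (pow_le_pow_left₀ hq hqp _).trans ?_
    rw [mul_pow]
    exact mul_le_mul_of_nonneg_right (pow_le_pow_right₀ hM (by omega)) (by positivity)
  rw [embedBound]
  push_cast
  calc ((S : ℝ) + 1) ^ (S + 1) * maxDeg H t
      ≤ (S + 1) ^ (S + 1) * (ε * (M ^ S * p ^ (t - 1)) * D) := by gcongr; exact h.trans (by gcongr)
    _ = _ := by ring

/-- In a non-clustered sequence, tuples of edges satisfy the degree bounds used for pinning. -/
lemma NonClustered.exists_embedBound_le {V : ℕ → Type} [∀ n, Fintype (V n)]
    {H : ∀ n, Finset (Finset (V n))} (hS : 1 ≤ S) (hne : ∀ n, (H n).Nonempty)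
    (hunif : ∀ n, ∀ e ∈ H n, e.card = S + 1) (h : NonClustered (S + 1) V H) {c : ℝ} (hc : 0 < c) :
    ∃ K : ℝ, 1 ≤ K ∧ ∀ θ : ℝ, 0 < θ → ∀ᶠ n in atTop, ∀ p : ℝ, c * pH (S + 1) (H n) ≤ p →
      (∀ t, 1 ≤ t → t ≤ S + 1 → (embedBound (H n) S t : ℝ) ≤
        K * p ^ (t - 1) * ((H n).card / Fintype.card (V n))) ∧
      ∀ t, 2 ≤ t → t ≤ S → (embedBound (H n) S t : ℝ) ≤
        θ * p ^ (t - 1) * ((H n).card / Fintype.card (V n)) := by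
  obtain ⟨⟨C, hC⟩, hsmall⟩ := h
  set M : ℝ := max 1 c⁻¹ with hMdef
  have hM : 1 ≤ M := le_max_left _ _
  set L : ℝ := ((S : ℝ) + 1) ^ (S + 1) * M ^ S with hLdef
  have hL : 0 < L := by positivity
  refine ⟨L * (|C| + 1) + 1, by nlinarith [abs_nonneg C], fun θ hθ => ?_⟩
  have hev : ∀ᶠ n in atTop, ∀ t ∈ Finset.Icc 2 S, (maxDeg (H n) t : ℝ) ≤
      min 1 (θ / L) * pH (S + 1) (H n) ^ (t - 1) * ((H n).card / Fintype.card (V n)) := by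
    rw [Finset.eventually_all]
    intro t ht
    rw [Finset.mem_Icc] at ht
    filter_upwards [hsmall t ht.1 (by omega) (min 1 (θ / L)) (by positivity)] with n hn
    rwa [← mul_div_assoc]
  filter_upwards [hev] with n hn p hp
  have hN := card_vertices_pos (hne n) (hunif n)
  have hq := pH_pos (S + 1) (hne n) hN
  have hp0 : 0 ≤ p := (mul_pos hc hq).le.trans hp
  have hqp : pH (S + 1) (H n) ≤ M * p := by
    calc pH (S + 1) (H n) = c⁻¹ * (c * pH (S + 1) (H n)) := by field_simp
      _ ≤ M * p := mul_le_mul (le_max_right _ _) hp (mul_pos hc hq).le (by positivity)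
  have hNr : (0 : ℝ) < Fintype.card (V n) := by exact_mod_cast hN
  have her : (0 : ℝ) < (H n).card := by exact_mod_cast (hne n).card_pos
  set D : ℝ := (H n).card / Fintype.card (V n) with hD
  have hD0 : 0 < D := div_pos her hNr
  have hone : pH (S + 1) (H n) ^ S * D = 1 := by
    rw [pH_pow hS, hD]
    field_simp
  have hgen : ∀ (ε B : ℝ) (t : ℕ), 0 ≤ ε → L * ε ≤ B → t ≤ S + 1 →
      (maxDeg (H n) t : ℝ) ≤ ε * pH (S + 1) (H n) ^ (t - 1) * D →
      (embedBound (H n) S t : ℝ) ≤ B * p ^ (t - 1) * D := fun ε B t hε hB ht h =>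
    (embedBound_le_of_maxDeg_le hp0 hq.le hD0.le hM hε hqp ht h).trans (by gcongr)
  constructor
  · intro t ht1 htS
    obtain rfl | ht1' := eq_or_lt_of_le ht1
    · refine hgen |C| _ 1 (abs_nonneg C) (by nlinarith) htS ?_
      have h1 := hC n
      rw [mul_div_assoc] at h1
      simpa using h1.trans (mul_le_mul_of_nonneg_right (le_abs_self C) hD0.le)
    · obtain rfl | htS' := eq_or_lt_of_le htS
      · refine hgen 1 _ _ zero_le_one (by nlinarith [abs_nonneg C]) le_rfl ?_
        rw [Nat.add_sub_cancel, one_mul, hone]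
        exact_mod_cast maxDeg_uniform_le (hunif n)
      · refine hgen _ _ t (by positivity) ?_ htS
          (hn t (Finset.mem_Icc.2 ⟨ht1', by omega⟩))
        have : L * min 1 (θ / L) ≤ L * 1 := mul_le_mul_of_nonneg_left (min_le_left _ _) hL.le
        nlinarith [abs_nonneg C]
  · intro t ht2 htS
    refine hgen _ _ t (by positivity) ?_ (by omega) (hn t (Finset.mem_Icc.2 ⟨ht2, htS⟩))
    calc L * min 1 (θ / L) ≤ L * (θ / L) := mul_le_mul_of_nonneg_left (min_le_right _ _) hL.le
      _ = θ := by field_simp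

/-- In a non-clustered sequence, the expected size of the random set is unbounded. -/
lemma NonClustered.eventually_le_mul_card {V : ℕ → Type} [∀ n, Fintype (V n)]
    {H : ∀ n, Finset (Finset (V n))} (hS : 2 ≤ S) (hne : ∀ n, (H n).Nonempty)
    (hunif : ∀ n, ∀ e ∈ H n, e.card = S + 1) (h : NonClustered (S + 1) V H) {c : ℝ} (hc : 0 < c)
    (B : ℝ) :
    ∀ᶠ n in atTop, ∀ p : ℝ, c * pH (S + 1) (H n) ≤ p → B ≤ p * Fintype.card (V n) := by
  have hB : 0 < |B| + 1 := by positivity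
  filter_upwards [h.2 2 le_rfl (by omega) (c / (|B| + 1)) (by positivity)] with n hn p hp
  have hN := card_vertices_pos (hne n) (hunif n)
  have hNr : (0 : ℝ) < Fintype.card (V n) := by exact_mod_cast hN
  have her : (0 : ℝ) < (H n).card := by exact_mod_cast (hne n).card_pos
  set q := pH (S + 1) (H n)
  have h1 : ((H n).card : ℝ) ≤ (Fintype.card (V n) : ℝ) ^ 2 * maxDeg (H n) 2 := by
    exact_mod_cast card_edges_le (by omega) (hunif n)
  have h2 : ((H n).card : ℝ) * 1 ≤ (H n).card * (c * q * Fintype.card (V n) / (|B| + 1)) := by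
    calc ((H n).card : ℝ) * 1 ≤ (Fintype.card (V n) : ℝ) ^ 2 * maxDeg (H n) 2 := by rwa [mul_one]
      _ ≤ (Fintype.card (V n) : ℝ) ^ 2 * _ := mul_le_mul_of_nonneg_left hn (by positivity)
      _ = _ := by
        simp only [Nat.add_one_sub_one, pow_one]
        field_simp
  have h3 := (one_le_div hB).1 (le_of_mul_le_mul_left h2 her)
  calc B ≤ |B| + 1 := (le_abs_self B).trans (by linarith)
    _ ≤ c * q * Fintype.card (V n) := h3
    _ ≤ p * Fintype.card (V n) := by gcongr

end Density

lemma PinBound.mono {Γ V : Type*} [Fintype Γ] [Fintype V] {k a : ℕ} {pt : Γ → Fin k → V}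
    {p M K K' : ℝ} (hp : 0 ≤ p) (hM : 0 ≤ M) (hK : K ≤ K') (h : PinBound pt p M K a) :
    PinBound pt p M K' a := fun S hS ha σ => (h S hS ha σ).trans (by gcongr)

lemma mul_div_pow_succ {x y : ℝ} (hy : y ≠ 0) (m : ℕ) :
    y * (x / y) ^ (m + 1) = x ^ (m + 1) / y ^ m := by
  rw [div_pow, pow_succ y]
  field_simp

lemma probSub_mono {α : Type*} (X : Finset α) {p : ℝ} (h0 : 0 ≤ p) (h1 : p ≤ 1)
    {P Q : Finset α → Prop} (h : ∀ Z, P Z → Q Z) : probSub X p P ≤ probSub X p Q := by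
  refine Finset.sum_le_sum fun Z _ => ?_
  have h2 : 0 ≤ p ^ Z.card * (1 - p) ^ (X.card - Z.card) :=
    mul_nonneg (pow_nonneg h0 _) (pow_nonneg (sub_nonneg.2 h1) _)
  by_cases hP : P Z
  · rw [if_pos hP, if_pos (h Z hP)]
  · rw [if_neg hP]
    split_ifs
    exacts [h2, le_rfl]

/-- **Quantitative sparse rainbow star-constellation theorem.** Let `(𝓗_n)` be
non-clustered with the rainbow star-constellation property for `r` colours.
For all `β_s > 0` and `c > 0` there is `β_c > 0` such that for every sequence
`p_n ≥ c·p_{𝓗_n}`, a.a.s. the random set `Z = V(𝓗_n)_{p_n}` has the property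
that every partial `r`-colouring of `Z` with at least
`β_s·(p_n/p_{𝓗_n})^{(r−1)(s−1)}·v(𝓗_n)` rainbow star pairs `(i, S)` has at
least `β_c·(p_n/p_{𝓗_n})^{(r−1)(s−1)s}·e(𝓗_n)` rainbow constellation pairs
`(i, C)`. -/
theorem sparse_rainbow_star_constellation (s r : ℕ) (hs : 3 ≤ s) (hr : 2 ≤ r)
    (V : ℕ → Type) [∀ n, Fintype (V n)] (H : ∀ n, Finset (Finset (V n)))
    (hne : ∀ n, (H n).Nonempty) (hunif : ∀ n, ∀ e ∈ H n, e.card = s)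
    (hA2 : NonClustered s V H) (hA5 : RainbowSC s r V H)
    (βs c : ℝ) (hβs : 0 < βs) (hc : 0 < c) :
    ∃ βc : ℝ, 0 < βc ∧ ∀ p : ℕ → ℝ, (∀ n, p n ∈ Set.Icc (0 : ℝ) 1) →
      (∀ n, c * pH s (H n) ≤ p n) →
      Tendsto (fun n => probSub (Finset.univ : Finset (V n)) (p n) (fun Z =>
        ∀ ψ : V n → Option (Fin r), (∀ v : V n, ψ v ≠ none → v ∈ Z) →
          βs * (p n / pH s (H n)) ^ ((r - 1) * (s - 1)) * (Fintype.card (V n) : ℝ) ≤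
            (numRainbowStarPairs r (H n) ψ : ℝ) →
          βc * (p n / pH s (H n)) ^ ((r - 1) * (s - 1) * s) * ((H n).card : ℝ) ≤
            (numRainbowConstPairs r (H n) ψ : ℝ))) atTop (nhds 1) := by
  obtain ⟨S, rfl⟩ : ∃ S, s = S + 1 := ⟨s - 1, by omega⟩
  obtain ⟨R, rfl⟩ : ∃ R, r = R + 1 := ⟨r - 1, by omega⟩
  have hS : 2 ≤ S := by omega
  have hR : 1 ≤ R := by omega
  obtain ⟨K, hK, hdeg⟩ := hA2.exists_embedBound_le (by omega) hne hunif hc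
  have hc₁ : 0 < (R + 1) ^ (R * S) * starMultiplicity R S := by
    unfold starMultiplicity
    positivity
  have hc₁r : (0 : ℝ) < ((R + 1) ^ (R * S) * starMultiplicity R S : ℕ) := by exact_mod_cast hc₁
  have hc₂ : (0 : ℝ) < constellationMultiplicity R S := by
    have : 0 < constellationMultiplicity R S := by
      unfold constellationMultiplicity
      positivity
    exact_mod_cast this
  obtain ⟨γ, hγ, hsc⟩ := hA5 (βs / (4 * ((R + 1) ^ (R * S) * starMultiplicity R S : ℕ)))
    (by positivity)
  obtain ⟨βc, hβc, htr⟩ := transference (r := R + 1) (ks := R * S) (kc := (S + 1) * (R * S))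
    (K := K ^ ((S + 1) * R + 1)) R.succ_pos (by positivity) (by positivity) (by positivity) hβs hγ
  refine ⟨βc / constellationMultiplicity R S, by positivity, fun p hp hpc => ?_⟩
  rw [tendsto_order]
  refine ⟨fun a ha => ?_, fun a ha => Eventually.of_forall fun n =>
    (probSub_le_one (hp n).1 (hp n).2 _).trans_lt ha⟩
  obtain ⟨θ, hθ, n₀, hn₀⟩ := htr ((1 - a) / 2) (by linarith)
  have hKpos : 0 < K := by linarith
  filter_upwards [hdeg (θ / K ^ ((S + 1) * R + R + 1)) (by positivity), hsc,
    hA2.eventually_le_mul_card hS hne hunif hc n₀] with n hdn hscn hpN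
  refine lt_of_lt_of_le (by linarith : a < 1 - (1 - a) / 2) ?_
  have hN := card_vertices_pos (hne n) (hunif n)
  have hq := pH_pos (S + 1) (hne n) hN
  have hqS := pH_pow (H := H n) (S := S) (by omega)
  have hp0 : 0 < p n := (mul_pos hc hq).trans_le (hpc n)
  have hNr : (0 : ℝ) < Fintype.card (V n) := by exact_mod_cast hN
  have her : (0 : ℝ) < (H n).card := by exact_mod_cast (hne n).card_pos
  obtain ⟨hd, hd'⟩ := hdn (p n) (hpc n)
  have hD : (0 : ℝ) < (H n).card / Fintype.card (V n) := div_pos her hNr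
  have hqD : ∀ m : ℕ, (p n / pH (S + 1) (H n)) ^ (m * S) =
      p n ^ (m * S) * ((H n).card / Fintype.card (V n) : ℝ) ^ m := fun m => by
    rw [div_pow, mul_comm m S, pow_mul (pH _ _), hqS, div_eq_mul_inv, ← inv_pow, inv_div]
  have hmain := hn₀ (V n) (StarTuple (H n) R S) (ConstellationTuple (H n) R S) starPt
    constellationPt (starColour R S) (constellationColour R S) (p n)
    (((H n).card / Fintype.card (V n) : ℝ) ^ R)
    (((H n).card / Fintype.card (V n) : ℝ) ^ ((S + 1) * R + 1)) starPt_injective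
    constellationPt_injective hp0 (hp n).2 (by positivity) (by positivity) hN (hpN _ (hpc n))
    ((starPt_pinBound (hunif n) hd).mono hp0.le (by positivity)
      (pow_le_pow_right₀ hK (by nlinarith)))
    (constellationPt_pinBound hp0.le (hunif n) hK hD.le hd)
    ((constellationPt_pinBound_small hp0.le (hunif n) hK (by positivity) hS hD.le hd hd').mono
      hp0.le (by positivity) (le_of_eq (by field_simp)))
    fun C hC => ?_
  · refine hmain.trans (probSub_mono _ (hp n).1 (hp n).2 fun Z hZ ψ hψ hstar => ?_)
    have h1 := hZ ψ hψ (le_trans (le_of_eq ?_)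
      (hstar.trans (Nat.cast_le.2 (numRainbowStarPairs_le (hunif n) ψ))))
    · have h2 : (classCount (constellationPt (H := H n)) (constellationColour R S)
          (colourClass ψ) : ℝ) ≤
            constellationMultiplicity R S * numRainbowConstPairs (R + 1) (H n) ψ := by
        exact_mod_cast classCount_constellationPt_le (by omega) ψ
      refine le_of_mul_le_mul_left (le_trans (le_of_eq ?_) (h1.trans h2)) hc₂
      have h3 : (R + 1 - 1) * (S + 1 - 1) * (S + 1) = ((S + 1) * R) * S := by
        simp only [Nat.add_sub_cancel]
        ring
      rw [h3, hqD, pow_succ _ ((S + 1) * R), ← mul_assoc (S + 1) R S]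
      field_simp
    · simp only [Nat.add_sub_cancel]
      rw [hqD]
      ring
  · refine classCount_starPt_le_of_constellationPt (by omega) (hunif n) hscn ?_ C
      (hC.trans_le (le_of_eq ?_))
    · obtain ⟨m, rfl⟩ : ∃ m, R = m + 1 := ⟨R - 1, by omega⟩
      refine le_of_eq ?_
      rw [mul_assoc (βs / 4), mul_div_pow_succ hNr.ne', show m + 1 + 1 - 1 = m + 1 from rfl,
        show m + 1 + 1 - 2 = m from rfl]
      field_simp
    · rw [mul_assoc γ, mul_div_pow_succ hNr.ne', Nat.add_sub_cancel, mul_div_assoc]
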